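/- Let 1 ≤ j < k be integers and ε > 0. There exists t_0 such that for every t ≥ t_0 the following holds, where T = t(k-1)+1, m̃ = t^{100k} and m = T·m̃. Let G' be a k-graph with |V(G')| = m and δ_j(G') ≥ (δ_j^k(1)+ε/4)·m^{k-j}, let ℛ' = {{u^i_a,u^i_b} : i ∈ [m̃]} be a collection of m̃ pairwise disjoint pairs of vertices of G', and let B be a (2-uniform) graph with V(B) = V(G') and maximum degree Δ(B) ≤ 2tk². Then there is a collection 𝒞' = {P_1,…,P_{m̃}} of m̃ pairwise vertex-disjoint loose paths in G', each of length at most 2t, such that V(G') = P_1 ∪ … ∪ P_{m̃} (the paths cover all vertices), V^E(P_i) = {u^i_a,u^i_b} for each i ∈ [m̃], and no edge of any path P_i contains both endpoints of an edge of B. -/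

import Mathlib

open Finset

open scoped Classical

noncomputable section

/-- A `k`-uniform hypergraph with vertices drawn from `ℕ`. -/
structure HGraph (k : ℕ) where
  verts : Finset ℕ
  edges : Finset (Finset ℕ)
  edge_sub : ∀ e ∈ edges, e ⊆ verts
  edge_card : ∀ e ∈ edges, e.card = k

namespace HGraph

variable {k : ℕ}

/-- The number of edges of `G` containing the vertex set `S`. -/
def degOn (G : HGraph k) (S : Finset ℕ) : ℕ :=
  (G.edges.filter fun e => S ⊆ e).card

/-- The relative degree `deg_G(S; W)`: edges containing `S` whose other vertices lie in `W`. -/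
def degIn (G : HGraph k) (S W : Finset ℕ) : ℕ :=
  (G.edges.filter fun e => S ⊆ e ∧ e \ S ⊆ W).card

/-- The edge set of the induced subhypergraph `G[U]`. -/
def inducedEdges (G : HGraph k) (U : Finset ℕ) : Finset (Finset ℕ) :=
  G.edges.filter fun e => e ⊆ U

/-- `δ_j(G) ≥ d`. -/
def MinDegGe (G : HGraph k) (j : ℕ) (d : ℝ) : Prop :=
  ∀ T ⊆ G.verts, T.card = j → d ≤ (G.degOn T : ℝ)

/-- `δ_j(G[U]) ≥ d`. -/
def MinDegOnGe (G : HGraph k) (j : ℕ) (U : Finset ℕ) (d : ℝ) : Prop :=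
  ∀ T ⊆ U, T.card = j → d ≤ (((G.inducedEdges U).filter fun e => T ⊆ e).card : ℝ)

end HGraph

/-- A colouring is rainbow on a set of edges if distinct edges receive distinct colours. -/
def RainbowEdges (χ : Finset ℕ → ℕ) (E : Finset (Finset ℕ)) : Prop :=
  ∀ e ∈ E, ∀ f ∈ E, χ e = χ f → e = f

/-- `χ` is globally `b`-bounded on `G`: every colour class has at most `b` edges. -/
def GloballyBounded {k : ℕ} (G : HGraph k) (χ : Finset ℕ → ℕ) (b : ℝ) : Prop :=
  ∀ c : ℕ, ((G.edges.filter fun e => χ e = c).card : ℝ) ≤ b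

/-- The number of edges of a loose Hamilton cycle of `G`. -/
def numE {k : ℕ} (G : HGraph k) : ℕ := G.verts.card / (k - 1)

/-- A loose Hamilton cycle in `G`, recorded by a cyclic ordering of the vertices:
`σ` enumerates the vertices, and the `i`-th edge consists of the `k` consecutive
vertices starting at position `i(k-1)`, so that consecutive edges share exactly one
vertex (when `(k-1) ∣ |V(G)|`). -/
structure LooseHamCycle (k : ℕ) (G : HGraph k) where
  σ : ℕ → ℕ
  injOn : Set.InjOn σ (Set.Iio G.verts.card)
  image_eq : (Finset.range G.verts.card).image σ = G.verts
  edges_mem : ∀ i < numE G,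
    (Finset.range k).image (fun r => σ ((i * (k - 1) + r) % G.verts.card)) ∈ G.edges

namespace LooseHamCycle

variable {k : ℕ} {G : HGraph k}

/-- The `i`-th edge of the cycle. -/
def cedge (H : LooseHamCycle k G) (i : ℕ) : Finset ℕ :=
  (Finset.range k).image fun r => H.σ ((i * (k - 1) + r) % G.verts.card)

/-- The edge set of the cycle. -/
def cedges (H : LooseHamCycle k G) : Finset (Finset ℕ) :=
  (Finset.range (numE G)).image H.cedge

/-- The edge set of the increasing loose path of length `t` starting at edge `i`. -/
def pEdges (H : LooseHamCycle k G) (i t : ℕ) : Finset (Finset ℕ) :=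
  (Finset.range t).image fun r => H.cedge ((i + r) % numE G)

/-- The vertex set of the increasing loose path of length `t` starting at edge `i`. -/
def pVerts (H : LooseHamCycle k G) (i t : ℕ) : Finset ℕ :=
  (Finset.range (t * (k - 1) + 1)).image fun r => H.σ ((i * (k - 1) + r) % G.verts.card)

/-- The first endvertex of the increasing loose path starting at edge `i`. -/
def pEndA (H : LooseHamCycle k G) (i : ℕ) : ℕ := H.σ ((i * (k - 1)) % G.verts.card)

/-- The last endvertex of the increasing loose path of length `t` starting at edge `i`. -/
def pEndB (H : LooseHamCycle k G) (i t : ℕ) : ℕ :=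
  H.σ ((i * (k - 1) + t * (k - 1)) % G.verts.card)

/-- The endvertex pair of the increasing loose path of length `t` starting at edge `i`. -/
def pEnds (H : LooseHamCycle k G) (i t : ℕ) : Finset ℕ := {H.pEndA i, H.pEndB i t}

end LooseHamCycle

/-- The loose Hamilton cycle threshold `δ_j^k(1)`: the least `δ ≥ 0` such that for every
`ε > 0` all sufficiently large `k`-graphs `G` (with `(k-1) ∣ n`) satisfying
`δ_j(G) ≥ (δ+ε)n^{k-j}` contain a loose Hamilton cycle. -/
noncomputable def looseHamThreshold (j k : ℕ) : ℝ :=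
  sInf {δ : ℝ | 0 ≤ δ ∧ ∀ ε : ℝ, 0 < ε → ∃ n₀ : ℕ, ∀ n : ℕ, n₀ ≤ n → (k - 1) ∣ n →
    ∀ G : HGraph k, G.verts.card = n →
      G.MinDegGe j ((δ + ε) * (n : ℝ) ^ (k - j)) → Nonempty (LooseHamCycle k G)}

/-- `T = t(k-1)+1`. -/
def TOf (k t : ℕ) : ℕ := t * (k - 1) + 1
/-- `m̃ = t^{100k}`. -/
def mtOf (k t : ℕ) : ℕ := t ^ (100 * k)
/-- `m = T·m̃`. -/
def mOf (k t : ℕ) : ℕ := TOf k t * mtOf k t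
/-- `M = T·m`. -/
def MOf (k t : ℕ) : ℕ := TOf k t * mOf k t

section Splittings

variable {k : ℕ} {G : HGraph k}

/-- `I` is the index set of a `t`-balanced splitting of `H`: a collection of
pairwise vertex-disjoint increasing loose paths of length `t` of `H`. -/
def IsSplitting (H : LooseHamCycle k G) (t : ℕ) (I : Finset ℕ) : Prop :=
  (∀ i ∈ I, i < numE G) ∧
    ∀ i ∈ I, ∀ i' ∈ I, i ≠ i' → Disjoint (H.pVerts i t) (H.pVerts i' t)

/-- `V(𝒫)` for the splitting indexed by `I`. -/
def splitVerts (H : LooseHamCycle k G) (t : ℕ) (I : Finset ℕ) : Finset ℕ :=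
  I.biUnion fun i => H.pVerts i t

/-- `V^E(𝒫)` for the splitting indexed by `I`. -/
def splitEnds (H : LooseHamCycle k G) (t : ℕ) (I : Finset ℕ) : Finset ℕ :=
  I.biUnion fun i => H.pEnds i t

/-- `V^I(𝒫)` for the splitting indexed by `I`. -/
def splitInt (H : LooseHamCycle k G) (t : ℕ) (I : Finset ℕ) : Finset ℕ :=
  splitVerts H t I \ splitEnds H t I

/-- A vertex set `S` is transverse with respect to the splitting indexed by `I`. -/
def Transverse (H : LooseHamCycle k G) (t : ℕ) (I : Finset ℕ) (S : Finset ℕ) : Prop :=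
  ∀ i ∈ I, (S ∩ H.pVerts i t).card ≤ 1

/-- The splitting indexed by `I` is suitable for the path `P₀` (the increasing path
of length `t` starting at edge `i₀`). -/
def Suitable (χ : Finset ℕ → ℕ) (ε : ℝ) (m : ℕ) (H : LooseHamCycle k G)
    (t : ℕ) (I : Finset ℕ) (i₀ : ℕ) : Prop :=
  (∀ S ⊆ splitVerts H t I \ H.pVerts i₀ t, S.card = k - 1 → Transverse H t I S →
    ((((G.inducedEdges (splitVerts H t I)).filter
        fun e => S ⊆ e ∧ ∃ f ∈ H.cedges, χ f = χ e).card : ℝ) ≤ ε * (m : ℝ) / 4)) ∧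
  (∀ X ⊆ splitVerts H t I \ H.pVerts i₀ t, Transverse H t I X →
    ∀ e ∈ G.inducedEdges X, ∀ f ∈ G.inducedEdges X,
      χ e = χ f → (e ∩ f).card = 1 → False) ∧
  (∀ e ∈ G.inducedEdges (splitVerts H t I \ H.pVerts i₀ t),
    ∀ f ∈ G.inducedEdges (splitVerts H t I \ H.pVerts i₀ t),
      χ e = χ f → Disjoint e f → Transverse H t I e → Transverse H t I f →
      ∃ i ∈ I, ∃ i' ∈ I, i ≠ i' ∧
        (H.pVerts i t ∩ e).Nonempty ∧ (H.pVerts i t ∩ f).Nonempty ∧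
        (H.pVerts i' t ∩ e).Nonempty ∧ (H.pVerts i' t ∩ f).Nonempty)

/-- The cyclic successor of `i` within the index set `I`. -/
def nextIdx (I : Finset ℕ) (i : ℕ) : ℕ :=
  if h : (I.filter fun i' => i < i').Nonempty then (I.filter fun i' => i < i').min' h
  else if h2 : I.Nonempty then I.min' h2 else 0

/-- `M` is a rerouting of the splitting indexed by `I`: a partition of `V^E(𝒫)` into
pairs such that identifying the two vertices of each pair connects the paths of
`H[V(G) ∖ V^I(𝒫)]` into a single loose cycle (the arcs of `H` between consecutive
paths of the splitting, together with the identified pairs, form a connected graph). -/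
def IsRerouting (H : LooseHamCycle k G) (t : ℕ) (I : Finset ℕ)
    (M : Finset (Finset ℕ)) : Prop :=
  (∀ p ∈ M, p.card = 2 ∧ p ⊆ splitEnds H t I) ∧
  (∀ p ∈ M, ∀ q ∈ M, p ≠ q → Disjoint p q) ∧
  M.biUnion id = splitEnds H t I ∧
  ∀ u ∈ splitEnds H t I, ∀ v ∈ splitEnds H t I,
    Relation.ReflTransGen
      (fun a b => ({a, b} : Finset ℕ) ∈ M ∨
        ∃ i ∈ I, ({a, b} : Finset ℕ) = {H.pEndB i t, H.pEndA (nextIdx I i)}) u v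

/-- `X` (indexed over `Finset.range T`) is a viable partition of `V(𝒫)` for the
`t`-balanced splitting indexed by `I`. -/
def IsViablePartition (j : ℕ) (ε : ℝ) (t : ℕ) (H : LooseHamCycle k G)
    (I : Finset ℕ) (X : ℕ → Finset ℕ) : Prop :=
  (Finset.range (TOf k t)).biUnion X = splitVerts H t I ∧
  (∀ h ∈ Finset.range (TOf k t), ∀ h' ∈ Finset.range (TOf k t), h ≠ h' →
    Disjoint (X h) (X h')) ∧
  (∀ h ∈ Finset.range (TOf k t), Transverse H t I (X h)) ∧
  (∃ M : Finset (Finset ℕ), IsRerouting H t I M ∧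
    ∀ h ∈ Finset.range (TOf k t), (M.filter fun p => p ⊆ X h).card = mtOf k t) ∧
  ∀ h ∈ Finset.range (TOf k t),
    G.MinDegOnGe j (X h) ((looseHamThreshold j k + ε / 2) * (mOf k t : ℝ) ^ (k - j))

/-- The vertex set spanned by a set of edges. -/
def eVerts (E : Finset (Finset ℕ)) : Finset ℕ := E.biUnion id

/-- `(𝒫, H', 𝒫')` is a `(P₀,H)`-switching of size `m`, where `𝒫` is the `t`-balanced
splitting of `H` indexed by `I` containing `P₀` (the increasing path of length `t`
starting at edge `i₀`), and `𝒫'` is the `2t`-bounded splitting of `H'` whose paths are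
recorded in `Q` as pairs (edge set, endvertex pair). -/
def IsSwitching (t m : ℕ) (H : LooseHamCycle k G) (i₀ : ℕ) (I : Finset ℕ)
    (H' : LooseHamCycle k G) (Q : Finset (Finset (Finset ℕ) × Finset ℕ)) : Prop :=
  IsSplitting H t I ∧ I.card = m ∧ i₀ ∈ I ∧
  Q.card = m ∧
  (∀ q ∈ Q, ∃ i ℓ : ℕ, i < numE G ∧ 1 ≤ ℓ ∧ ℓ ≤ 2 * t ∧
    q.1 = H'.pEdges i ℓ ∧ q.2 = H'.pEnds i ℓ) ∧
  (∀ q ∈ Q, ∀ q' ∈ Q, q ≠ q' → Disjoint (eVerts q.1) (eVerts q'.1)) ∧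
  splitInt H t I = (Q.biUnion fun q => eVerts q.1) \ (Q.biUnion fun q => q.2) ∧
  H.cedges.filter (fun e => e ⊆ G.verts \ splitInt H t I) =
    H'.cedges.filter (fun e =>
      e ⊆ G.verts \ ((Q.biUnion fun q => eVerts q.1) \ (Q.biUnion fun q => q.2))) ∧
  ∀ q ∈ Q, (H.pVerts i₀ t ∩ eVerts q.1).card ≤ 1

/-- A feasible `(P₀,H)`-switching: additionally `F' = H'[V(𝒫') ∖ V(P₀)]` is rainbow and
no edge of `F'` shares a colour with an edge of `H[V(G) ∖ V^I(𝒫)]`. -/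
def IsFeasibleSwitching (χ : Finset ℕ → ℕ) (t m : ℕ) (H : LooseHamCycle k G)
    (i₀ : ℕ) (I : Finset ℕ) (H' : LooseHamCycle k G)
    (Q : Finset (Finset (Finset ℕ) × Finset ℕ)) : Prop :=
  IsSwitching t m H i₀ I H' Q ∧
  RainbowEdges χ (H'.cedges.filter fun e =>
    e ⊆ (Q.biUnion fun q => eVerts q.1) \ H.pVerts i₀ t) ∧
  ∀ e ∈ H'.cedges.filter (fun e =>
      e ⊆ (Q.biUnion fun q => eVerts q.1) \ H.pVerts i₀ t),
    ∀ f ∈ H.cedges.filter (fun f => f ⊆ G.verts \ splitInt H t I), χ e ≠ χ f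

/-- Two vertices are close (with respect to `H` and `t`) if they lie in edges of `H`
both contained in a loose path of `H` of length at most `2t+1`. -/
def Close (H : LooseHamCycle k G) (t : ℕ) (u v : ℕ) : Prop :=
  ∃ i < numE G, ∃ i' < numE G, u ∈ H.cedge i ∧ v ∈ H.cedge i' ∧
    ∃ d ≤ 2 * t, (i + d) % numE G = i' ∨ (i' + d) % numE G = i

/-- A vertex set is spread if no two of its vertices are close. -/
def SpreadSet (H : LooseHamCycle k G) (t : ℕ) (S : Finset ℕ) : Prop :=
  ∀ u ∈ S, ∀ v ∈ S, u ≠ v → ¬ Close H t u v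

/-- A vertex set is almost spread if exactly one pair of its vertices is close. -/
def AlmostSpreadSet (H : LooseHamCycle k G) (t : ℕ) (S : Finset ℕ) : Prop :=
  ∃ u ∈ S, ∃ v ∈ S, u ≠ v ∧ Close H t u v ∧
    ∀ u' ∈ S, ∀ v' ∈ S, u' ≠ v' → Close H t u' v' → ({u', v'} : Finset ℕ) = {u, v}

end Splittings

/-- The probability that a `p`-random subset of `Finset.range N` (each element included
independently with probability `p`) satisfies `A`. -/
noncomputable def probOver (N : ℕ) (p : ℝ) (A : Finset ℕ → Prop) : ℝ :=
  ∑ S ∈ (Finset.range N).powerset,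
    if A S then p ^ S.card * (1 - p) ^ (N - S.card) else 0

/-- A loose path of length `t` in `G`, recorded by an ordering of its vertices. -/
structure LoosePath (k t : ℕ) (G : HGraph k) where
  σ : ℕ → ℕ
  injOn : Set.InjOn σ (Set.Iio (t * (k - 1) + 1))
  mem_verts : ∀ r < t * (k - 1) + 1, σ r ∈ G.verts
  edges_mem : ∀ i < t, (Finset.range k).image (fun r => σ (i * (k - 1) + r)) ∈ G.edges

namespace LoosePath

variable {k t : ℕ} {G : HGraph k}

/-- The vertex set of a loose path. -/
def verts (P : LoosePath k t G) : Finset ℕ := (Finset.range (t * (k - 1) + 1)).image P.σ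

/-- The edge set of a loose path. -/
def edgeSet (P : LoosePath k t G) : Finset (Finset ℕ) :=
  (Finset.range t).image fun i => (Finset.range k).image fun r => P.σ (i * (k - 1) + r)

/-- The first endvertex of a loose path. -/
def endA (P : LoosePath k t G) : ℕ := P.σ 0

/-- The last endvertex of a loose path. -/
def endB (P : LoosePath k t G) : ℕ := P.σ (t * (k - 1))

end LoosePath

/-! ### Loose paths as an inductive predicate -/

/-- loose path from `u` to `v`, vertex set `insert v S`, edges in `E`. -/
inductive LP (E : Set (Finset ℕ)) : ℕ → ℕ → Finset ℕ → Prop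
  | nil (v : ℕ) : LP E v v ∅
  | cons {u w v : ℕ} {e S : Finset ℕ} : e ∈ E → u ∈ e → w ∈ e → u ≠ w → LP E w v S →
      Disjoint (e.erase w) (insert v S) → LP E u v (e.erase w ∪ S)

theorem LP.end_notMem {E : Set (Finset ℕ)} {u v : ℕ} {S : Finset ℕ} (h : LP E u v S) : v ∉ S := by
  induction h with
  | nil v => simp
  | cons he hu hw huw h hd ih =>
    rw [mem_union, not_or]
    refine ⟨?_, ih⟩
    intro h1
    exact (Finset.disjoint_left.1 hd h1) (mem_insert_self _ _)

theorem LP.start_mem {E : Set (Finset ℕ)} {u v : ℕ} {S : Finset ℕ} (h : LP E u v S) :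
    u ∈ insert v S := by
  cases h with
  | nil v => simp
  | cons he hu hw huw h hd =>
    apply mem_insert_of_mem
    apply mem_union_left
    exact mem_erase.2 ⟨huw, hu⟩

theorem LP.append {E : Set (Finset ℕ)} {u v w : ℕ} {S S' : Finset ℕ} (h : LP E u v S)
    (h' : LP E v w S') (hd : Disjoint S (insert w S')) : LP E u w (S ∪ S') := by
  induction h with
  | nil v => simpa using h'
  | @cons u z v e S he hu hw huw h hd2 ih =>
    rw [union_assoc]
    have h1 : Disjoint S (insert w S') := hd.mono_left subset_union_right
    refine LP.cons he hu hw huw (ih h' h1) ?_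
    have h2 : Disjoint (e.erase z) (insert w S') := hd.mono_left subset_union_left
    rw [Finset.disjoint_left] at *
    intro x hx hx'
    rcases mem_insert.1 hx' with rfl | hx'
    · exact h2 hx (mem_insert_self _ _)
    · rcases mem_union.1 hx' with h3 | h3
      · exact hd2 hx (mem_insert_of_mem h3)
      · exact h2 hx (mem_insert_of_mem h3)

theorem LP.edge {E : Set (Finset ℕ)} {u w : ℕ} {e : Finset ℕ} (he : e ∈ E) (hu : u ∈ e)
    (hw : w ∈ e) (huw : u ≠ w) : LP E u w (e.erase w) := by
  have := LP.cons he hu hw huw (LP.nil (E := E) w) (by simp)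
  simpa using this

theorem LP.mono {E E' : Set (Finset ℕ)} {u v : ℕ} {S : Finset ℕ} (h : LP E u v S) (hE : E ⊆ E') :
    LP E' u v S := by
  induction h with
  | nil v => exact LP.nil v
  | cons he hu hw huw h hd ih => exact LP.cons (hE he) hu hw huw ih hd

theorem LP.card {E : Set (Finset ℕ)} {k : ℕ} (hE : ∀ e ∈ E, e.card = k) {u v : ℕ} {S : Finset ℕ}
    (h : LP E u v S) : ∃ l : ℕ, S.card = l * (k - 1) := by
  induction h with
  | nil v => exact ⟨0, by simp⟩
  | cons he hu hw huw h hd ih =>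
    obtain ⟨l, hl⟩ := ih
    refine ⟨l + 1, ?_⟩
    rw [card_union_of_disjoint (hd.mono_right (subset_insert _ _)), hl, card_erase_of_mem hw,
      hE _ he]
    ring

theorem exists_enum (A : Finset ℕ) (u : ℕ) (hu : u ∈ A) : ∃ f : ℕ → ℕ,
    Set.InjOn f (Set.Iio A.card) ∧ (range A.card).image f = A ∧ f 0 = u := by
  have hn : 0 < A.card := card_pos.2 ⟨u, hu⟩
  let φ := A.equivFin
  let ψ := (Equiv.swap (φ ⟨u, hu⟩) ⟨0, hn⟩)
  let f : ℕ → ℕ := fun i => if h : i < A.card then (φ.symm (ψ ⟨i, h⟩) : ℕ) else 0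
  have hinj : Set.InjOn f (Set.Iio A.card) := by
    intro i hi i' hi' h
    simp only [Set.mem_Iio] at hi hi'
    simp only [f, hi, hi', dif_pos] at h
    have := ψ.injective (φ.symm.injective (Subtype.ext h))
    simpa using this
  refine ⟨f, hinj, ?_, ?_⟩
  · apply Finset.eq_of_subset_of_card_le
    · intro x hx
      obtain ⟨i, hi, rfl⟩ := mem_image.1 hx
      have hi := mem_range.1 hi
      simp only [f, hi, dif_pos]
      exact (φ.symm _).2
    · rw [card_image_of_injOn (by simpa using hinj)]; simp
  · simp only [f, hn, dif_pos, ψ]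
    rw [Equiv.swap_apply_right]; simp

theorem LP.toSeq {E : Set (Finset ℕ)} {k : ℕ} (hk : 2 ≤ k) (hE : ∀ e ∈ E, e.card = k) {u v : ℕ}
    {S : Finset ℕ} (h : LP E u v S) : ∃ (l : ℕ) (σ : ℕ → ℕ),
      Set.InjOn σ (Set.Iio (l * (k - 1) + 1)) ∧
      (range (l * (k - 1) + 1)).image σ = insert v S ∧ σ 0 = u ∧ σ (l * (k - 1)) = v ∧
      ∀ i < l, (range k).image (fun r => σ (i * (k - 1) + r)) ∈ E := by
  induction h with
  | nil v => 
    refine ⟨0, fun _ => v, ?_, ?_, rfl, rfl, by simp⟩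
    · intro a ha b hb _
      simp at ha hb; omega
    · simp
  | @cons u w v e S he hu hw huw h hd ih =>
    obtain ⟨l, σ, h1, h2, h3, h4, h5⟩ := ih
    obtain ⟨f, f1, f2, f3⟩ := exists_enum (e.erase w) u (mem_erase.2 ⟨huw, hu⟩)
    have hc : (e.erase w).card = k - 1 := by rw [card_erase_of_mem hw, hE _ he]
    rw [hc] at f1 f2
    obtain ⟨q, rfl⟩ : ∃ q, k = q + 2 := ⟨k - 2, by omega⟩
    simp only [show q + 2 - 1 = q + 1 by omega] at *
    have hfm : ∀ i < q + 1, f i ∈ e.erase w := fun i hi => by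
      rw [← f2]; exact mem_image_of_mem _ (mem_range.2 hi)
    have hsm : ∀ i < l * (q + 1) + 1, σ i ∈ insert v S := fun i hi => by
      rw [← h2]; exact mem_image_of_mem _ (mem_range.2 hi)
    have hdis : ∀ x ∈ e.erase w, x ∉ insert v S := Finset.disjoint_left.1 hd
    let τ : ℕ → ℕ := fun i => if i < q + 1 then f i else σ (i - (q + 1))
    have τ1 : ∀ i < q + 1, τ i = f i := fun i hi => by simp only [τ, if_pos hi]
    have τ2 : ∀ i, τ (i + (q + 1)) = σ i := fun i => by
      simp only [τ]; rw [if_neg (by omega)]; congr 1; omega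
    refine ⟨l + 1, τ, ?_, ?_, ?_, ?_, ?_⟩
    · intro a ha b hb hab
      simp only [Set.mem_Iio] at ha hb
      have hl : (l + 1) * (q + 1) = l * (q + 1) + (q + 1) := by ring
      rcases lt_or_ge a (q + 1) with ha' | ha' <;> rcases lt_or_ge b (q + 1) with hb' | hb'
      · rw [τ1 a ha', τ1 b hb'] at hab
        exact f1 ha' hb' hab
      · obtain ⟨b, rfl⟩ := Nat.exists_eq_add_of_le' hb'
        rw [τ1 a ha', τ2 b] at hab
        exact absurd (hab ▸ hsm b (by omega)) (hdis _ (hfm a ha'))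
      · obtain ⟨a, rfl⟩ := Nat.exists_eq_add_of_le' ha'
        rw [τ1 b hb', τ2 a] at hab
        exact absurd (hab ▸ hsm a (by omega)) (hdis _ (hfm b hb'))
      · obtain ⟨a, rfl⟩ := Nat.exists_eq_add_of_le' ha'
        obtain ⟨b, rfl⟩ := Nat.exists_eq_add_of_le' hb'
        rw [τ2, τ2] at hab
        have := h1 (by simp only [Set.mem_Iio]; omega) (by simp only [Set.mem_Iio]; omega) hab
        omega
    · ext x
      constructor
      · intro hx
        obtain ⟨i, hi, rfl⟩ := mem_image.1 hx
        have hi := mem_range.1 hi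
        have hl : (l + 1) * (q + 1) = l * (q + 1) + (q + 1) := by ring
        rcases lt_or_ge i (q + 1) with hi' | hi'
        · rw [τ1 i hi']
          exact mem_insert_of_mem (mem_union_left _ (hfm i hi'))
        · obtain ⟨i, rfl⟩ := Nat.exists_eq_add_of_le' hi'
          rw [τ2]
          have := hsm i (by omega)
          rcases mem_insert.1 this with h | h
          · rw [h]; exact mem_insert_self _ _
          · exact mem_insert_of_mem (mem_union_right _ h)
      · intro hx
        have hl : (l + 1) * (q + 1) = l * (q + 1) + (q + 1) := by ring
        have hx' : x ∈ e.erase w ∨ x ∈ insert v S := by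
          rcases mem_insert.1 hx with h | h
          · right; rw [h]; exact mem_insert_self _ _
          · rcases mem_union.1 h with h | h
            · left; exact h
            · right; exact mem_insert_of_mem h
        rcases hx' with h | h
        · rw [← f2] at h
          obtain ⟨i, hi, rfl⟩ := mem_image.1 h
          have hi := mem_range.1 hi
          exact mem_image.2 ⟨i, mem_range.2 (by omega), τ1 i hi⟩
        · rw [← h2] at h
          obtain ⟨i, hi, rfl⟩ := mem_image.1 h
          have hi := mem_range.1 hi
          exact mem_image.2 ⟨i + (q + 1), mem_range.2 (by omega), τ2 i⟩
    · rw [τ1 0 (by omega), f3]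
    · rw [show (l + 1) * (q + 1) = l * (q + 1) + (q + 1) by ring, τ2, h4]
    · intro i hi
      rcases Nat.eq_zero_or_pos i with rfl | hi0
      · convert he using 1
        rw [Finset.range_add_one, image_insert]
        have a1 : (range (q + 1)).image (fun r => τ (0 * (q + 1) + r)) = e.erase w := by
          rw [← f2]
          apply image_congr
          intro r hr
          simp only [zero_mul, zero_add]
          exact τ1 r (by simpa using hr)
        rw [a1]
        have a2 : τ (0 * (q + 1) + (q + 1)) = w := by
          rw [zero_mul, τ2, h3]
        rw [a2, insert_erase hw]
      · obtain ⟨i, rfl⟩ : ∃ i', i = i' + 1 := ⟨i - 1, by omega⟩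
        convert h5 i (by omega) using 2
        ext r
        rw [← τ2]; congr 1; ring

theorem LP.toLoosePath {k : ℕ} (hk : 2 ≤ k) {G : HGraph k} {E : Set (Finset ℕ)}
    (hE : E ⊆ {e | e ∈ G.edges}) {u v : ℕ} {S : Finset ℕ} (h : LP E u v S)
    (hS : insert v S ⊆ G.verts) : ∃ (l : ℕ) (P : LoosePath k l G),
      S.card = l * (k - 1) ∧ P.verts = insert v S ∧ P.endA = u ∧ P.endB = v ∧
      ∀ e ∈ P.edgeSet, e ∈ E := by
  have hEk : ∀ e ∈ E, e.card = k := fun e he => G.edge_card e (hE he)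
  obtain ⟨l, σ, h1, h2, h3, h4, h5⟩ := LP.toSeq hk hEk h
  refine ⟨l, ⟨σ, h1, ?_, fun i hi => hE (h5 i hi)⟩, ?_, h2, h3, h4, ?_⟩
  · intro r hr
    apply hS
    rw [← h2]
    exact mem_image_of_mem _ (mem_range.2 hr)
  · have := congrArg Finset.card h2
    rw [card_image_of_injOn (by simpa using h1), card_insert_of_notMem h.end_notMem, card_range] at this
    omega
  · intro e he
    obtain ⟨i, hi, rfl⟩ := mem_image.1 he
    exact h5 i (mem_range.1 hi)

/-! ### Walks in a pattern -/

/-- walk in the pattern `F` from `y` to `z` with coverage `M` (excluding the last vertex). -/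
inductive WK (F : Set (Finset ℕ)) : ℕ → ℕ → Multiset ℕ → Prop
  | nil (y : ℕ) : WK F y y 0
  | cons {y w z : ℕ} {e : Finset ℕ} {M : Multiset ℕ} : e ∈ F → y ∈ e → w ∈ e → y ≠ w →
      WK F w z M → WK F y z ((e.erase w).val + M)

theorem WK.append {F : Set (Finset ℕ)} {y z w : ℕ} {M M' : Multiset ℕ} (h : WK F y z M)
    (h' : WK F z w M') : WK F y w (M + M') := by
  induction h with
  | nil y => simpa using h'
  | cons he hy hw hyw h ih => rw [add_assoc]; exact WK.cons he hy hw hyw (ih h')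

theorem WK.mono {F F' : Set (Finset ℕ)} {y z : ℕ} {M : Multiset ℕ} (h : WK F y z M)
    (hF : F ⊆ F') : WK F' y z M := by
  induction h with
  | nil y => exact WK.nil y
  | cons he hy hw hyw h ih => exact WK.cons (hF he) hy hw hyw ih

theorem WK.start_mem {F : Set (Finset ℕ)} {y z : ℕ} {M : Multiset ℕ} (h : WK F y z M) :
    M = 0 ∧ y = z ∨ y ∈ M := by
  cases h with
  | nil y => left; simp
  | cons he hy hw hyw h => exact Or.inr (Multiset.mem_add.2 (Or.inl (Finset.mem_erase.2 ⟨hyw, hy⟩)))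

theorem WK.card {F : Set (Finset ℕ)} {k : ℕ} (hF : ∀ e ∈ F, e.card = k) {y z : ℕ}
    {M : Multiset ℕ} (h : WK F y z M) : (k - 1) ∣ M.card := by
  induction h with
  | nil y => simp
  | cons he hy hw hyw h ih =>
    rw [Multiset.card_add, card_val, card_erase_of_mem hw, hF _ he]
    exact (Nat.dvd_add_right (dvd_refl _)).2 ih

theorem WK.edge {F : Set (Finset ℕ)} {y w : ℕ} {e : Finset ℕ} (he : e ∈ F) (hy : y ∈ e)
    (hw : w ∈ e) (hyw : y ≠ w) : WK F y w (e.erase w).val := by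
  simpa using WK.cons he hy hw hyw (WK.nil (F := F) w)

/-- closed walks can be concatenated. -/
theorem WK.closed_list {F : Set (Finset ℕ)} {z : ℕ} (L : List (Multiset ℕ))
    (hL : ∀ M ∈ L, WK F z z M) : WK F z z L.sum := by
  induction L with
  | nil => simpa using WK.nil z
  | cons M L ih =>
    rw [List.sum_cons]
    exact (hL M (by simp)).append (ih fun M' h => hL M' (by simp [h]))

/-- lifting a walk to a blow-up -/
theorem WK.lift {F E : Set (Finset ℕ)} {p : ℕ → ℕ} {Γ : Finset ℕ}
    (hlift : ∀ e ⊆ Γ, Set.InjOn p e → e.image p ∈ F → e ∈ E) {y z : ℕ} {M : Multiset ℕ}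
    (h : WK F y z M) : ∀ (u v : ℕ) (D : Finset ℕ), insert v D ⊆ Γ → p u = y → p v = z → v ∉ D →
      D.val.map p = M → (u ∈ D ∨ (M = 0 ∧ u = v)) → LP E u v D := by
  induction h with
  | nil y =>
    intro u v D hD hu hv hvD hM huD
    have : D = ∅ := by
      have := congrArg Multiset.card hM
      simpa using this
    subst this
    rcases huD with h | ⟨_, rfl⟩
    · simp at h
    · exact LP.nil _
  | @cons y w z e M he hy hw hyw h ih =>
    intro u v D hD hu hv hvD hM huD
    have huD : u ∈ D := by
      rcases huD with h | ⟨h, _⟩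
      · exact h
      · exfalso
        have h1 : y ∈ (e.erase w).val + M :=
          Multiset.mem_add.2 (Or.inl (Finset.mem_erase.2 ⟨hyw, hy⟩))
        rw [h] at h1; simp at h1
    -- choose D1
    have hsec : ∀ x ∈ e.erase w, ∃ d ∈ D, p d = x := by
      intro x hx
      have : x ∈ D.val.map p := by rw [hM]; exact Multiset.mem_add.2 (Or.inl hx)
      obtain ⟨d, hd, rfl⟩ := Multiset.mem_map.1 this
      exact ⟨d, hd, rfl⟩
    choose! c hc1 hc2 using hsec
    let c' : ℕ → ℕ := fun x => if x = y then u else c x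
    have c1 : ∀ x ∈ e.erase w, c' x ∈ D := by
      intro x hx; simp only [c']; split_ifs
      · exact huD
      · exact hc1 x hx
    have c2 : ∀ x ∈ e.erase w, p (c' x) = x := by
      intro x hx; simp only [c']; split_ifs with h
      · rw [hu, h]
      · exact hc2 x hx
    have cinj : Set.InjOn c' (e.erase w) := by
      intro a ha b hb hab
      rw [← c2 a ha, ← c2 b hb, hab]
    set D1 := (e.erase w).image c' with hD1
    have hD1D : D1 ⊆ D := by
      intro x hx
      obtain ⟨a, ha, rfl⟩ := mem_image.1 hx
      exact c1 a ha
    have huD1 : u ∈ D1 := mem_image.2 ⟨y, mem_erase.2 ⟨hyw, hy⟩, by simp [c']⟩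
    have hD1p : D1.val.map p = (e.erase w).val := by
      rw [hD1, image_val_of_injOn cinj, Multiset.map_map]
      conv_rhs => rw [← Multiset.map_id (e.erase w).val]
      exact Multiset.map_congr rfl (fun x hx => c2 x hx)
    have hsplit : D.val = D1.val + (D \ D1).val := by
      rw [sdiff_val, add_tsub_cancel_of_le (val_le_iff.2 hD1D)]
    have hD2p : (D \ D1).val.map p = M := by
      rw [hsplit, Multiset.map_add, hD1p] at hM
      exact add_left_cancel hM
    have hu2 : ∃ u2, p u2 = w ∧ (u2 ∈ D \ D1 ∨ (M = 0 ∧ u2 = v)) := by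
      rcases h.start_mem with ⟨h0, hwz⟩ | h0
      · exact ⟨v, by rw [hv, hwz], Or.inr ⟨h0, rfl⟩⟩
      · rw [← hD2p] at h0
        obtain ⟨d, hd, hd'⟩ := Multiset.mem_map.1 h0
        exact ⟨d, hd', Or.inl hd⟩
    obtain ⟨u2, hu2w, hu2⟩ := hu2
    have hrec := ih u2 v (D \ D1) ((insert_subset_insert _ sdiff_subset).trans hD) hu2w hv
      (fun h => hvD (mem_sdiff.1 h).1) hD2p hu2
    have hu2D1 : u2 ∉ D1 := by
      rcases hu2 with h | ⟨_, rfl⟩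
      · exact (mem_sdiff.1 h).2
      · exact fun h => hvD (hD1D h)
    have hu2Γ : u2 ∈ Γ := by
      apply hD
      rcases hu2 with h | ⟨_, rfl⟩
      · exact mem_insert_of_mem (mem_sdiff.1 h).1
      · exact mem_insert_self _ _
    have himg : (insert u2 D1).image p = e := by
      rw [image_insert, hu2w]
      have : D1.image p = e.erase w := by
        rw [hD1, image_image]
        conv_rhs => rw [← image_id (s := e.erase w)]
        exact image_congr (fun x hx => c2 x hx)
      rw [this, insert_erase hw]
    have hEe : insert u2 D1 ∈ E := by
      apply hlift
      · apply insert_subset hu2Γ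
        exact hD1D.trans ((subset_insert _ _).trans hD)
      · apply Finset.injOn_of_card_image_eq
        rw [himg, card_insert_of_notMem hu2D1, hD1, card_image_of_injOn cinj, card_erase_add_one hw]
      · rw [himg]; exact he
    have := LP.cons hEe (mem_insert_of_mem huD1) (mem_insert_self _ _)
      (fun h => hu2D1 (h ▸ huD1)) hrec ?_
    · rw [erase_insert hu2D1, union_sdiff_of_subset hD1D] at this
      exact this
    · rw [erase_insert hu2D1, Finset.disjoint_left]
      intro x hx hx'
      rcases mem_insert.1 hx' with rfl | hx'
      · exact hvD (hD1D hx)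
      · exact (mem_sdiff.1 hx').2 hx

/-- realise a multiset of types -/
theorem exists_realise {p : ℕ → ℕ} {Γ : Finset ℕ} (M : Multiset ℕ)
    (h : ∀ z ∈ M, M.card ≤ (Γ.filter fun x => p x = z).card) :
    ∃ D ⊆ Γ, D.val.map p = M := by
  induction M using Multiset.induction_on with
  | empty => exact ⟨∅, by simp⟩
  | cons z M ih =>
    obtain ⟨D, hD, hM⟩ := ih (fun z' hz' => by
      have := h z' (Multiset.mem_cons_of_mem hz'); rw [Multiset.card_cons] at this; omega)
    have h1 := h z (Multiset.mem_cons_self _ _)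
    have h2 : D.card = M.card := by rw [← hM]; simp
    obtain ⟨x, hx, hxD⟩ : ∃ x ∈ Γ.filter (fun x => p x = z), x ∉ D := by
      apply exists_mem_notMem_of_card_lt_card
      rw [Multiset.card_cons] at h1; omega
    refine ⟨insert x D, insert_subset (mem_filter.1 hx).1 hD, ?_⟩
    rw [insert_val_of_notMem hxD, Multiset.map_cons, hM, (mem_filter.1 hx).2]

theorem thr_nonneg (j k : ℕ) : 0 ≤ looseHamThreshold j k :=
  Real.sInf_nonneg fun _ h => h.1

theorem degOn_le {k : ℕ} (G : HGraph k) (Q : Finset ℕ) :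
    G.degOn Q ≤ G.verts.card ^ (k - Q.card) := by
  have h1 : (G.edges.filter fun e => Q ⊆ e).card ≤
      (powersetCard (k - Q.card) G.verts).card := by
    apply card_le_card_of_injOn (fun e => e \ Q)
    · intro e he
      have he := mem_filter.1 he
      have : e \ Q ∈ powersetCard (k - Q.card) G.verts := by
        rw [mem_powersetCard]
        exact ⟨sdiff_subset.trans (G.edge_sub e he.1), by
          rw [card_sdiff_of_subset he.2, G.edge_card e he.1]⟩
      exact this
    · intro e he f hf h
      have he := (mem_filter.1 he).2
      have hf := (mem_filter.1 hf).2
      have h : e \ Q = f \ Q := h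
      rw [← sdiff_union_of_subset he, ← sdiff_union_of_subset hf, h]
  rw [card_powersetCard] at h1
  exact h1.trans (Nat.choose_le_pow _ _)

theorem BB {j k : ℕ} (hj : 1 ≤ j) (ε : ℝ) (hε : 0 < ε) :
    ∃ n₀ : ℕ, ∀ G : HGraph k, n₀ ≤ G.verts.card → (k - 1) ∣ G.verts.card →
      G.MinDegGe j ((looseHamThreshold j k + ε) * (G.verts.card : ℝ) ^ (k - j)) →
      Nonempty (LooseHamCycle k G) := by
  have hne : {δ : ℝ | 0 ≤ δ ∧ ∀ ε : ℝ, 0 < ε → ∃ n₀ : ℕ, ∀ n : ℕ, n₀ ≤ n → (k - 1) ∣ n →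
    ∀ G : HGraph k, G.verts.card = n →
      G.MinDegGe j ((δ + ε) * (n : ℝ) ^ (k - j)) → Nonempty (LooseHamCycle k G)}.Nonempty := by
    refine ⟨1, zero_le_one, fun ε hε => ⟨j, fun n hn hd G hG hdeg => ?_⟩⟩
    exfalso
    obtain ⟨Q, hQ, hQc⟩ := exists_subset_card_eq (s := G.verts) (n := j) (by omega)
    have h1 := hdeg Q hQ hQc
    have h2 := degOn_le G Q
    rw [hQc, hG] at h2
    have h3 : (G.degOn Q : ℝ) ≤ (n : ℝ) ^ (k - j) := by exact_mod_cast h2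
    have h4 : (0 : ℝ) < (n : ℝ) ^ (k - j) := by
      apply pow_pos; exact_mod_cast (by omega : 0 < n)
    nlinarith
  obtain ⟨d, ⟨hd0, hd⟩, hlt⟩ := exists_lt_of_csInf_lt hne
    (show looseHamThreshold j k < looseHamThreshold j k + ε / 2 by linarith)
  obtain ⟨n0, h0⟩ := hd (ε / 2) (by linarith)
  refine ⟨n0, fun G hG hdv hdeg => h0 _ hG hdv G rfl ?_⟩
  intro T hT hTc
  refine le_trans ?_ (hdeg T hT hTc)
  apply mul_le_mul_of_nonneg_right _ (by positivity)
  linarith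

theorem mod_inj {n c x y : ℕ} (hx : c ≤ x ∧ x < c + n) (hy : c ≤ y ∧ y < c + n)
    (h : x % n = y % n) : x = y := by
  wlog hxy : x ≤ y generalizing x y
  · exact (this hy hx h.symm (by omega)).symm
  have h1 : n ∣ y - x := (Nat.modEq_iff_dvd' hxy).1 h
  have h2 := Nat.eq_zero_of_dvd_of_lt h1 (by omega)
  omega

/-- cyclic sequence structure of a loose Hamilton cycle -/
structure CS (k p : ℕ) (E : Set (Finset ℕ)) (V : Finset ℕ) (τ : ℕ → ℕ) : Prop where
  inj : ∀ c, Set.InjOn τ (Set.Ico c (c + p * (k - 1)))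
  img : ∀ c, (Ico c (c + p * (k - 1))).image τ = V
  edge : ∀ i, (Ico (i * (k - 1)) ((i + 1) * (k - 1) + 1)).image τ ∈ E
  per : ∀ x, τ (x + p * (k - 1)) = τ x

theorem mod_fix {p i k r : ℕ} : (i % p * (k - 1) + r) % (p * (k - 1)) =
      (i * (k - 1) + r) % (p * (k - 1)) := by
  conv_rhs => rw [← Nat.div_add_mod i p]
  have : (p * (i / p) + i % p) * (k - 1) + r =
    (i % p * (k - 1) + r) + (p * (k - 1)) * (i / p) := by ring
  rw [this, Nat.add_mul_mod_self_left]

theorem ham_CS {k p : ℕ} (hk : 2 ≤ k) (hp : 2 ≤ p) {G : HGraph k} (H : LooseHamCycle k G)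
    (hn : G.verts.card = p * (k - 1)) : ∃ τ, CS k p {e | e ∈ G.edges} G.verts τ := by
  have hn0 : 0 < p * (k - 1) := Nat.mul_pos (by omega) (by omega)
  have hinj : ∀ c, Set.InjOn (fun x => H.σ (x % (p * (k - 1)))) (Set.Ico c (c + p * (k - 1))) := by
    intro c x hx y hy h
    have hi := H.injOn
    rw [hn] at hi
    exact mod_inj hx hy (hi (Nat.mod_lt _ hn0) (Nat.mod_lt _ hn0) h)
  refine ⟨fun x => H.σ (x % (p * (k - 1))), hinj, fun c => ?_, fun i => ?_, fun x => by simp⟩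
  · apply eq_of_subset_of_card_le
    · intro y hy
      obtain ⟨x, hx, rfl⟩ := mem_image.1 hy
      rw [← H.image_eq]
      apply mem_image_of_mem
      rw [hn]
      exact mem_range.2 (Nat.mod_lt _ hn0)
    · rw [card_image_of_injOn (by simpa using hinj c)]
      simp [hn]
  · have h1 := H.edges_mem (i % p) (by
      rw [numE, hn, Nat.mul_div_cancel _ (by omega)]; exact Nat.mod_lt _ (by omega))
    rw [hn] at h1
    have h2 : (Ico (i * (k - 1)) ((i + 1) * (k - 1) + 1)) =
        (range k).image (fun r => i * (k - 1) + r) := by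
      ext x
      have : (i + 1) * (k - 1) + 1 = i * (k - 1) + k := by
        rw [add_mul]; omega
      rw [this]
      simp only [mem_Ico, mem_image, mem_range]
      constructor
      · intro h; exact ⟨x - i * (k - 1), by omega, by omega⟩
      · rintro ⟨r, hr, rfl⟩; omega
    rw [h2, image_image]
    have h3 : ((fun x => H.σ (x % (p * (k - 1)))) ∘ fun r => i * (k - 1) + r) =
        (fun r => H.σ ((i % p * (k - 1) + r) % (p * (k - 1)))) := by
      funext r
      simp only [Function.comp]
      rw [mod_fix]
    rw [h3]
    exact h1

theorem CS.erase {k p : ℕ} (hk : 2 ≤ k) (hp : 2 ≤ p) {E V τ} (h : CS k p E V τ) (i : ℕ) :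
    ((Ico (i * (k - 1)) ((i + 1) * (k - 1) + 1)).image τ).erase (τ ((i + 1) * (k - 1))) =
      (Ico (i * (k - 1)) ((i + 1) * (k - 1))).image τ ∧
    τ (i * (k - 1)) ≠ τ ((i + 1) * (k - 1)) := by
  have hlt : (i + 1) * (k - 1) = i * (k - 1) + (k - 1) := by ring
  have h2 : 2 * (k - 1) ≤ p * (k - 1) := Nat.mul_le_mul_right _ hp
  have hne : ∀ x, i * (k - 1) ≤ x → x < (i + 1) * (k - 1) → τ x ≠ τ ((i + 1) * (k - 1)) := by
    intro x h1 h3 h4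
    have := h.inj (i * (k - 1)) (show x ∈ Set.Ico _ _ from ⟨h1, by omega⟩)
      (show (i + 1) * (k - 1) ∈ Set.Ico _ _ from ⟨by omega, by omega⟩) h4
    omega
  refine ⟨?_, hne _ le_rfl (by omega)⟩
  ext y
  simp only [mem_erase, mem_image, mem_Ico]
  constructor
  · rintro ⟨h1, x, hx, rfl⟩
    refine ⟨x, ⟨hx.1, ?_⟩, rfl⟩
    by_contra hc
    exact h1 (by rw [show x = (i + 1) * (k - 1) by omega])
  · rintro ⟨x, hx, rfl⟩
    exact ⟨hne x hx.1 hx.2, x, ⟨hx.1, by omega⟩, rfl⟩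

theorem CS.WK {k p : ℕ} (hk : 2 ≤ k) (hp : 2 ≤ p) {E V τ} (h : CS k p E V τ) (l : ℕ) :
    ∀ a, WK E (τ (a * (k - 1))) (τ ((a + l) * (k - 1)))
      ((Ico (a * (k - 1)) ((a + l) * (k - 1))).val.map τ) := by
  induction l with
  | zero => intro a; simpa using WK.nil _
  | succ l ih =>
    intro a
    obtain ⟨h1, h2⟩ := h.erase hk hp a
    have hlt : (a + 1) * (k - 1) = a * (k - 1) + (k - 1) := by ring
    have hle : (a + 1) * (k - 1) ≤ (a + (l + 1)) * (k - 1) := Nat.mul_le_mul_right _ (by omega)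
    have h3 := _root_.WK.cons (h.edge a) (mem_image_of_mem τ (mem_Ico.2 ⟨le_rfl, by omega⟩))
      (mem_image_of_mem τ (mem_Ico.2 ⟨by omega, by omega⟩)) h2 (ih (a + 1))
    rw [h1, show a + 1 + l = a + (l + 1) by ring] at h3
    convert h3 using 1
    rw [image_val_of_injOn, ← Multiset.map_add]
    · congr 1
      rw [← disjUnion_val (Ico (a * (k - 1)) ((a + 1) * (k - 1))) _
        (by simpa using Ico_disjoint_Ico_consecutive _ _ _)]
      rw [disjUnion_eq_union, Ico_union_Ico_eq_Ico (by omega) hle]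
    · apply (h.inj (a * (k - 1))).mono
      intro x hx
      have hx := mem_Ico.1 (mem_coe.1 hx)
      have h2 : 2 * (k - 1) ≤ p * (k - 1) := Nat.mul_le_mul_right _ hp
      exact ⟨hx.1, by omega⟩

theorem CS.LP {k p : ℕ} (hk : 2 ≤ k) (hp : 2 ≤ p) {E V τ} (h : CS k p E V τ) (l : ℕ) :
    ∀ a, l + 1 ≤ p → LP E (τ (a * (k - 1))) (τ ((a + l) * (k - 1)))
      ((Ico (a * (k - 1)) ((a + l) * (k - 1))).image τ) := by
  induction l with
  | zero => intro a _; simpa using LP.nil _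
  | succ l ih =>
    intro a hl
    obtain ⟨h1, h2⟩ := h.erase hk hp a
    have hlt : (a + 1) * (k - 1) = a * (k - 1) + (k - 1) := by ring
    have hle : (a + 1) * (k - 1) ≤ (a + (l + 1)) * (k - 1) := Nat.mul_le_mul_right _ (by omega)
    have hle2 : (l + 1 + 1) * (k - 1) ≤ p * (k - 1) := Nat.mul_le_mul_right _ hl
    have e1 : (a + (l + 1)) * (k - 1) = a * (k - 1) + (l + 1) * (k - 1) := by ring
    have e2 : (l + 1 + 1) * (k - 1) = (l + 1) * (k - 1) + (k - 1) := by ring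
    have h3 := _root_.LP.cons (h.edge a) (mem_image_of_mem τ (mem_Ico.2 ⟨le_rfl, by omega⟩))
      (mem_image_of_mem τ (mem_Ico.2 ⟨by omega, by omega⟩)) h2 (ih (a + 1) (by omega)) ?_
    · rw [h1, show a + 1 + l = a + (l + 1) by ring] at h3
      rwa [← image_union, Ico_union_Ico_eq_Ico (by omega) hle] at h3
    · rw [h1, show a + 1 + l = a + (l + 1) by ring, ← image_insert, Finset.disjoint_left]
      rintro y hy hy2
      obtain ⟨x, hx, rfl⟩ := mem_image.1 hy
      obtain ⟨z, hz, hzx⟩ := mem_image.1 hy2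
      have hx := mem_Ico.1 hx
      have hz : (a + 1) * (k - 1) ≤ z ∧ z ≤ (a + (l + 1)) * (k - 1) := by
        rcases mem_insert.1 hz with rfl | hz
        · exact ⟨hle, le_rfl⟩
        · have := mem_Ico.1 hz; omega
      have := h.inj (a * (k - 1)) (show z ∈ Set.Ico _ _ from ⟨by omega, by omega⟩)
        (show x ∈ Set.Ico _ _ from ⟨by omega, by omega⟩) hzx
      omega

/-- the full cycle as a closed walk based at any link -/
theorem CS.closed {k p : ℕ} (hk : 2 ≤ k) (hp : 2 ≤ p) {E V τ} (h : CS k p E V τ) (a : ℕ) :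
    _root_.WK E (τ (a * (k - 1))) (τ (a * (k - 1))) V.val := by
  have h1 := h.WK hk hp p a
  rw [add_mul, h.per] at h1
  rw [← image_val_of_injOn (by simpa using h.inj (a * (k - 1))), h.img] at h1
  exact h1

theorem mcd {α : Type} [Fintype α] [Nonempty α] (c : ℝ) (hc0 : 0 ≤ c) (hc1 : c ≤ 1) (N : ℕ) :
    ∀ (f : (Fin N → α) → ℝ), (∀ x i a, |f (Function.update x i a) - f x| ≤ c) → ∀ μ : ℝ,
      μ * (Fintype.card α : ℝ) ^ N = ∑ x, f x →
      ∑ x, Real.exp (μ - f x) ≤ (Fintype.card α : ℝ) ^ N * Real.exp (N * c ^ 2) := by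
  have hα : (0 : ℝ) < Fintype.card α := by exact_mod_cast Fintype.card_pos
  induction N with
  | zero =>
    intro f _ μ hμ
    simp at hμ ⊢
    simp [hμ]
  | succ N ih =>
    intro f hf μ hμ
    set n : ℝ := ((Fintype.card α : ℕ) : ℝ) with hn
    have hsplit : ∀ g : (Fin (N + 1) → α) → ℝ, ∑ x, g x = ∑ a, ∑ y, g (Fin.cons a y) := by
      intro g
      rw [← Fintype.sum_prod_type' (f := fun a y => g (Fin.cons a y))]
      exact (Fintype.sum_equiv (Fin.consEquiv fun _ => α) _ _ (fun x => rfl)).symm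
    let m : α → ℝ := fun a => (∑ y : Fin N → α, f (Fin.cons a y)) / n ^ N
    have hnN : (0 : ℝ) < n ^ N := by positivity
    have hm : ∀ a, m a * n ^ N = ∑ y : Fin N → α, f (Fin.cons a y) := fun a => by
      simp only [m]; field_simp
    have hab : ∀ a b, m a - m b ≤ c := by
      intro a b
      have h1 : (m a - m b) * n ^ N ≤ c * n ^ N := by
        rw [sub_mul, hm, hm, ← sum_sub_distrib]
        calc _ ≤ ∑ y : Fin N → α, c := by
              apply sum_le_sum
              intro y _
              have := hf (Fin.cons b y) 0 a
              rw [Fin.update_cons_zero] at this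
              exact (le_abs_self _).trans this
          _ = c * n ^ N := by simp [hn]; ring
      exact le_of_mul_le_mul_right h1 hnN
    have hμm : μ * n = ∑ a, m a := by
      have : (μ * n) * n ^ N = (∑ a, m a) * n ^ N := by
        rw [sum_mul, mul_assoc, ← pow_succ', hμ, hsplit]
        exact sum_congr rfl fun a _ => (hm a).symm
      exact mul_right_cancel₀ hnN.ne' this
    have hd : ∀ a, |μ - m a| ≤ c := by
      intro a
      rw [abs_le]
      constructor
      · have : (m a - μ) * n ≤ c * n := by
          rw [sub_mul, hμm]
          calc _ = ∑ b, (m a - m b) := by simp [sum_sub_distrib, hn]; ring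
            _ ≤ ∑ b : α, c := sum_le_sum fun b _ => hab a b
            _ = _ := by simp [hn]; ring
        have := le_of_mul_le_mul_right this hα
        linarith
      · have : (μ - m a) * n ≤ c * n := by
          rw [sub_mul, hμm]
          calc _ = ∑ b, (m b - m a) := by simp [sum_sub_distrib, hn]; ring
            _ ≤ ∑ b : α, c := sum_le_sum fun b _ => hab b a
            _ = _ := by simp [hn]; ring
        exact le_of_mul_le_mul_right this hα
    have hstep : ∀ a, ∑ y : Fin N → α, Real.exp (m a - f (Fin.cons a y)) ≤
        n ^ N * Real.exp (N * c ^ 2) := by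
      intro a
      apply ih _ _ _ (hm a)
      intro x i b
      have := hf (Fin.cons a x) i.succ b
      rwa [← Fin.cons_update] at this
    have hsum : ∑ a, Real.exp (μ - m a) ≤ n * Real.exp (c ^ 2) := by
      calc _ ≤ ∑ a, (1 + (μ - m a) + c ^ 2) := by
            apply sum_le_sum
            intro a _
            have h1 := Real.abs_exp_sub_one_sub_id_le ((hd a).trans hc1)
            have h2 := (abs_le.1 h1).2
            have h3 : (μ - m a) ^ 2 ≤ c ^ 2 := sq_le_sq.2 (by rw [abs_of_nonneg hc0]; exact hd a)
            linarith
        _ = n * (1 + c ^ 2) := by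
            rw [sum_add_distrib, sum_add_distrib, sum_sub_distrib, ← hμm]
            simp [hn]; ring
        _ ≤ _ := by
            apply mul_le_mul_of_nonneg_left _ hα.le
            linarith [Real.add_one_le_exp (c ^ 2)]
    rw [hsplit]
    calc _ = ∑ a, Real.exp (μ - m a) * ∑ y : Fin N → α, Real.exp (m a - f (Fin.cons a y)) := by
          apply sum_congr rfl
          intro a _
          rw [mul_sum]
          apply sum_congr rfl
          intro y _
          rw [← Real.exp_add]
          congr 1; ring
      _ ≤ ∑ a, Real.exp (μ - m a) * (n ^ N * Real.exp (N * c ^ 2)) :=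
          sum_le_sum fun a _ => mul_le_mul_of_nonneg_left (hstep a) (Real.exp_pos _).le
      _ = (∑ a, Real.exp (μ - m a)) * (n ^ N * Real.exp (N * c ^ 2)) := by rw [sum_mul]
      _ ≤ (n * Real.exp (c ^ 2)) * (n ^ N * Real.exp (N * c ^ 2)) :=
          mul_le_mul_of_nonneg_right hsum (by positivity)
      _ = n ^ (N + 1) * Real.exp ((N + 1 : ℕ) * c ^ 2) := by
          rw [show ((N + 1 : ℕ) : ℝ) * c ^ 2 = c ^ 2 + N * c ^ 2 by push_cast; ring, Real.exp_add]
          ring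

theorem mcd_tail {α : Type} [Fintype α] [Nonempty α] (N : ℕ) (f : (Fin N → α) → ℝ) (C s μ l : ℝ)
    (hC : 0 ≤ C) (hs : 0 ≤ s) (hsC : s * C ≤ 1)
    (hf : ∀ x i a, |f (Function.update x i a) - f x| ≤ C)
    (hμ : μ * (Fintype.card α : ℝ) ^ N ≤ ∑ x, f x) :
    ((univ.filter fun x => f x ≤ μ - l).card : ℝ) ≤
      (Fintype.card α : ℝ) ^ N * Real.exp (N * (s * C) ^ 2 - s * l) := by
  have hα : (0 : ℝ) < Fintype.card α := by exact_mod_cast Fintype.card_pos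
  have hN : (0 : ℝ) < (Fintype.card α : ℝ) ^ N := by positivity
  set μ' := (∑ x, f x) / (Fintype.card α : ℝ) ^ N with hμ'
  have hμμ : μ ≤ μ' := by rw [hμ', le_div_iff₀ hN]; exact hμ
  have h := mcd (s * C) (by positivity) hsC N (fun x => s * f x) (by
    intro x i a
    rw [← mul_sub, abs_mul, abs_of_nonneg hs]
    exact mul_le_mul_of_nonneg_left (hf x i a) hs) (s * μ') (by
    rw [← mul_sum, hμ']; field_simp)
  have h2 : ((univ.filter fun x => f x ≤ μ - l).card : ℝ) * Real.exp (s * l) ≤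
      ∑ x, Real.exp (s * μ' - s * f x) := by
    rw [← nsmul_eq_mul, ← sum_const]
    calc _ ≤ ∑ x ∈ univ.filter fun x => f x ≤ μ - l, Real.exp (s * μ' - s * f x) := by
          apply sum_le_sum
          intro x hx
          have hx := (mem_filter.1 hx).2
          apply Real.exp_le_exp.2
          rw [← mul_sub]
          exact mul_le_mul_of_nonneg_left (by linarith) hs
      _ ≤ _ := sum_le_sum_of_subset_of_nonneg (filter_subset _ _)
          fun x _ _ => (Real.exp_pos _).le
  rw [Real.exp_sub, ← mul_div_assoc, le_div_iff₀ (Real.exp_pos _)]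
  exact h2.trans h

theorem asym (A B C a b : ℝ) (r : ℕ) (hr : 1 ≤ r) (hAB : B < A) :
    ∃ N0 : ℕ, ∀ N : ℕ, N0 ≤ N →
      B * ((N : ℝ) + b) ^ r + C * ((N : ℝ) + b) ^ (r - 1) ≤ A * ((N : ℝ) - a) ^ r := by
  have t1 : ∀ z : ℝ, Filter.Tendsto (fun N : ℕ => z / (N : ℝ)) Filter.atTop (nhds 0) :=
    fun z => tendsto_const_div_atTop_nhds_zero_nat z
  have hL : Filter.Tendsto (fun N : ℕ => B * (1 + b / (N : ℝ)) ^ r +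
      C / (N : ℝ) * (1 + b / (N : ℝ)) ^ (r - 1)) Filter.atTop
      (nhds (B * (1 + 0) ^ r + 0 * (1 + 0) ^ (r - 1))) :=
    ((((t1 b).const_add 1).pow r).const_mul B).add
      ((t1 C).mul (((t1 b).const_add 1).pow (r - 1)))
  have hR : Filter.Tendsto (fun N : ℕ => A * (1 - a / (N : ℝ)) ^ r) Filter.atTop
      (nhds (A * (1 - 0) ^ r)) :=
    (((t1 a).const_sub 1).pow r).const_mul A
  have h := hL.eventually_lt hR (by simpa using hAB)
  obtain ⟨N0, h0⟩ := Filter.eventually_atTop.1 h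
  refine ⟨max N0 1, fun N hN => ?_⟩
  have h1 := (h0 N (le_trans (le_max_left _ _) hN)).le
  have hNp : (0 : ℝ) < N := by exact_mod_cast (le_trans (le_max_right _ _) hN)
  have h2 := mul_le_mul_of_nonneg_right h1 (pow_pos hNp r).le
  have e1 : (N : ℝ) + b = N * (1 + b / N) := by field_simp
  have e2 : (N : ℝ) - a = N * (1 - a / N) := by field_simp
  rw [e1, e2, mul_pow, mul_pow, mul_pow]
  obtain ⟨q, rfl⟩ : ∃ q, r = q + 1 := ⟨r - 1, by omega⟩
  have e3 : C / (N : ℝ) * N ^ (q + 1) = C * N ^ q := by rw [pow_succ]; field_simp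
  simp only [Nat.add_sub_cancel] at h2 ⊢
  calc _ = (B * (1 + b / (N : ℝ)) ^ (q + 1)) * N ^ (q + 1) +
        (C * N ^ q) * (1 + b / (N : ℝ)) ^ q := by ring
    _ = _ := by rw [← e3]; ring
    _ ≤ _ := h2
    _ = _ := by ring

theorem exp_beats (K c : ℝ) (j : ℕ) (hc : 0 < c) : ∃ N0 : ℕ, ∀ N : ℕ, N0 ≤ N →
    K * ((N : ℝ) + 1) ^ j * Real.exp (-(2 * c * N)) ≤ Real.exp (-(c * N)) := by
  have h := (Real.tendsto_pow_mul_exp_neg_atTop_nhds_zero j)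
  have h1 : Filter.Tendsto (fun N : ℕ => c * ((N : ℝ) + 1)) Filter.atTop Filter.atTop :=
    (Filter.tendsto_atTop_add_const_right _ _ tendsto_natCast_atTop_atTop).const_mul_atTop hc
  have h2 := (h.comp h1).const_mul (K / c ^ j * Real.exp c)
  have h3 := h2.eventually_lt_const (u := 1) (by rw [mul_zero]; exact one_pos)
  obtain ⟨N0, h0⟩ := Filter.eventually_atTop.1 h3
  refine ⟨N0, fun N hN => ?_⟩
  have h4 := (h0 N hN).le
  simp only [Function.comp] at h4
  have e1 : -(2 * c * (N : ℝ)) = -(c * N) + -(c * N) := by ring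
  have e2 : K / c ^ j * Real.exp c * ((c * ((N : ℝ) + 1)) ^ j * Real.exp (-(c * (N + 1)))) =
      K * ((N : ℝ) + 1) ^ j * Real.exp (-(c * N)) := by
    rw [show -(c * ((N : ℝ) + 1)) = -(c * N) - c by ring, Real.exp_sub, mul_pow]
    have := Real.exp_pos c
    field_simp
  rw [e2] at h4
  rw [e1, Real.exp_add, ← mul_assoc]
  have := Real.exp_pos (-(c * (N : ℝ)))
  nlinarith

/-- number of index sets `A` of size `r` for which `Q ∪ x(A)` is an edge -/
def fcnt {W : Finset ℕ} {N : ℕ} (E : Finset (Finset ℕ)) (r : ℕ) (Q : Finset ℕ) (x : Fin N → W) :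
    ℕ :=
  ((powersetCard r (univ : Finset (Fin N))).filter fun A =>
    Q ∪ A.image (fun i => (x i : ℕ)) ∈ E).card

theorem card_touch {N r : ℕ} (hr : 1 ≤ r) (P : Finset (Fin N)) :
    ((powersetCard r (univ : Finset (Fin N))).filter fun A => ¬ Disjoint A P).card ≤
      P.card * N ^ (r - 1) := by
  have h1 : (powersetCard r (univ : Finset (Fin N))).filter (fun A => ¬ Disjoint A P) ⊆
      P.biUnion fun i => (powersetCard (r - 1) (univ : Finset (Fin N))).image (insert i) := by
    intro A hA
    obtain ⟨hA, hd⟩ := mem_filter.1 hA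
    obtain ⟨i, hiA, hiP⟩ := not_disjoint_iff.1 hd
    rw [mem_biUnion]
    refine ⟨i, hiP, mem_image.2 ⟨A.erase i, ?_, insert_erase hiA⟩⟩
    rw [mem_powersetCard] at hA ⊢
    exact ⟨subset_univ _, by rw [card_erase_of_mem hiA, hA.2]⟩
  refine (card_le_card h1).trans (card_biUnion_le_card_mul _ _ _ fun i _ => ?_)
  refine card_image_le.trans ?_
  rw [card_powersetCard, card_univ, Fintype.card_fin]
  exact Nat.choose_le_pow _ _

theorem fcnt_diff {W : Finset ℕ} {N : ℕ} (E : Finset (Finset ℕ)) {r : ℕ} (hr : 1 ≤ r)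
    (Q : Finset ℕ) (x y : Fin N → W) (P : Finset (Fin N)) (h : ∀ i ∉ P, x i = y i) :
    fcnt E r Q x ≤ fcnt E r Q y + P.card * N ^ (r - 1) := by
  refine le_trans ?_ (Nat.add_le_add_left (card_touch hr P) _)
  refine le_trans (card_le_card ?_) (card_union_le _ _)
  intro A hA
  obtain ⟨hA, hE⟩ := mem_filter.1 hA
  rw [mem_union]
  by_cases hd : Disjoint A P
  · left
    refine mem_filter.2 ⟨hA, ?_⟩
    rwa [image_congr (g := fun i => (x i : ℕ)) (f := fun i => (y i : ℕ))]
    intro i hi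
    have := h i (disjoint_left.1 hd hi)
    simp [this]
  · right
    exact mem_filter.2 ⟨hA, hd⟩

theorem count_image {W : Finset ℕ} {N : ℕ} (A : Finset (Fin N)) (D : Finset ℕ) (hD : D ⊆ W)
    (hAD : A.card = D.card) :
    A.card.factorial * W.card ^ (N - A.card) ≤
      (univ.filter fun x : Fin N → W => A.image (fun i => (x i : ℕ)) = D).card := by
  have h1 : Fintype.card ((A ≃ D) × ({i // i ∉ A} → W)) =
      A.card.factorial * W.card ^ (N - A.card) := by
    rw [Fintype.card_prod, Fintype.card_equiv (Fintype.equivOfCardEq (by simpa using hAD)),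
      Fintype.card_fun, Fintype.card_coe, Fintype.card_coe, Fintype.card_subtype_compl]
    simp
  rw [← h1, ← Finset.card_univ]
  apply card_le_card_of_injOn (fun q : (A ≃ D) × ({i // i ∉ A} → W) => fun i : Fin N =>
    if h : i ∈ A then (⟨(q.1 ⟨i, h⟩ : ℕ), hD (q.1 ⟨i, h⟩).2⟩ : W) else q.2 ⟨i, h⟩)
  · rintro ⟨φ, w⟩ _
    apply mem_coe.2
    refine mem_filter.2 ⟨mem_univ _, ?_⟩
    ext d
    simp only [mem_image]
    constructor
    · rintro ⟨i, hi, rfl⟩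
      simp [hi]
    · intro hd
      refine ⟨φ.symm ⟨d, hd⟩, (φ.symm ⟨d, hd⟩).2, ?_⟩
      simp
  · rintro ⟨φ, w⟩ _ ⟨φ', w'⟩ _ h
    have h : ∀ i, _ := fun i => congrFun h i
    ext1
    · ext ⟨i, hi⟩
      have := h i
      simpa [hi] using this
    · funext ⟨i, hi⟩
      have := h i
      simpa [hi] using this

theorem fcnt_sum {W : Finset ℕ} {k j N : ℕ} (hjk : j < k) (G : HGraph k) (Q : Finset ℕ)
    (hQ : Q.card = j) (hN : k - j ≤ N) :
    (N.descFactorial (k - j)) * (G.degIn Q W) * W.card ^ (N - (k - j)) ≤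
      ∑ x : Fin N → W, fcnt G.edges (k - j) Q x := by
  have h1 : ∑ x : Fin N → W, fcnt G.edges (k - j) Q x =
      ∑ A ∈ powersetCard (k - j) (univ : Finset (Fin N)),
        (univ.filter fun x : Fin N → W => Q ∪ A.image (fun i => (x i : ℕ)) ∈ G.edges).card := by
    simp only [fcnt, card_filter]
    rw [sum_comm]
  rw [h1, Nat.descFactorial_eq_factorial_mul_choose]
  have h2 : ∀ A ∈ powersetCard (k - j) (univ : Finset (Fin N)),
      (k - j).factorial * (G.degIn Q W) * W.card ^ (N - (k - j)) ≤
      (univ.filter fun x : Fin N → W => Q ∪ A.image (fun i => (x i : ℕ)) ∈ G.edges).card := by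
    intro A hA
    have hAc := (mem_powersetCard.1 hA).2
    have h3 : ((G.edges.filter fun e => Q ⊆ e ∧ e \ Q ⊆ W).biUnion fun e =>
        univ.filter fun x : Fin N → W => A.image (fun i => (x i : ℕ)) = e \ Q) ⊆
        (univ.filter fun x : Fin N → W => Q ∪ A.image (fun i => (x i : ℕ)) ∈ G.edges) := by
      intro x hx
      obtain ⟨e, he, hx⟩ := mem_biUnion.1 hx
      obtain ⟨he, hQe, _⟩ := mem_filter.1 he
      refine mem_filter.2 ⟨mem_univ _, ?_⟩
      rw [(mem_filter.1 hx).2, union_sdiff_of_subset hQe]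
      exact he
    refine le_trans ?_ (card_le_card h3)
    rw [card_biUnion]
    · calc _ = ∑ e ∈ G.edges.filter fun e => Q ⊆ e ∧ e \ Q ⊆ W,
            (k - j).factorial * W.card ^ (N - (k - j)) := by
            rw [sum_const, smul_eq_mul, HGraph.degIn]; ring
        _ ≤ _ := by
            apply sum_le_sum
            intro e he
            obtain ⟨he, hQe, hW⟩ := mem_filter.1 he
            have := count_image A (e \ Q) hW (by
              rw [card_sdiff_of_subset hQe, hAc, G.edge_card e he, hQ])
            rwa [hAc] at this
    · intro e he e' he' hne
      rw [Function.onFun, disjoint_left]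
      intro x hx hx'
      apply hne
      obtain ⟨he, hQe, hW⟩ := mem_filter.1 (mem_coe.1 he)
      obtain ⟨he', hQe', hW'⟩ := mem_filter.1 (mem_coe.1 he')
      have h := (mem_filter.1 hx).2.symm.trans (mem_filter.1 hx').2
      rw [← union_sdiff_of_subset hQe, ← union_sdiff_of_subset hQe', h]
  calc _ = ∑ A ∈ powersetCard (k - j) (univ : Finset (Fin N)),
        (k - j).factorial * (G.degIn Q W) * W.card ^ (N - (k - j)) := by
        rw [sum_const, card_powersetCard, smul_eq_mul, card_univ, Fintype.card_fin]; ring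
    _ ≤ _ := sum_le_sum h2

theorem fcnt_tail {k j : ℕ} (hjk : j < k) (β γ : ℝ) (hβ : 0 ≤ β) (hγ : 0 < γ) (hγ1 : γ ≤ 1) :
    ∃ N0 : ℕ, ∀ N : ℕ, N0 ≤ N → ∀ (G : HGraph k) (W Q : Finset ℕ), W.Nonempty → Q.card = j →
      (β + γ) * (W.card : ℝ) ^ (k - j) ≤ G.degIn Q W →
      ((univ.filter fun x : Fin N → W => (fcnt G.edges (k - j) Q x : ℝ) <
        β * (N : ℝ) ^ (k - j) + j * (N : ℝ) ^ (k - j - 1)).card : ℝ) ≤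
        (W.card : ℝ) ^ N * Real.exp (-(2 * (γ ^ 2 / 32) * N)) := by
  obtain ⟨r, hr⟩ : ∃ r, k - j = r := ⟨_, rfl⟩
  rw [hr]
  have hr1 : 1 ≤ r := by omega
  obtain ⟨N1, h1⟩ := asym (β + γ) (β + 3 * γ / 4) 0 r 0 r hr1 (by linarith)
  obtain ⟨N2, h2⟩ := asym (β + γ / 4) β j 0 0 r hr1 (by linarith)
  refine ⟨max (max N1 N2) (r + 1), fun N hN G W Q hW hQ hdeg => ?_⟩
  have hN1 := h1 N (by omega)
  have hN2 := h2 N (by omega)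
  simp only [add_zero, sub_zero, zero_mul] at hN1 hN2
  have hNr : r ≤ N := by omega
  have hNpos : (0 : ℝ) < N := by exact_mod_cast (by omega : 0 < N)
  have : Nonempty W := hW.to_subtype
  have hcard : Fintype.card W = W.card := Fintype.card_coe _
  have hdf : ((N : ℝ) - r) ^ r ≤ (N.descFactorial r : ℝ) := by
    have h := Nat.pow_sub_le_descFactorial N r
    have h' : (N - r) ^ r ≤ N.descFactorial r :=
      (Nat.pow_le_pow_left (by omega) r).trans h
    have h'' : (((N - r) ^ r : ℕ) : ℝ) ≤ (N.descFactorial r : ℝ) := by exact_mod_cast h'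
    rw [Nat.cast_pow, Nat.cast_sub hNr] at h''
    exact h''
  have hP : (0 : ℝ) < (N : ℝ) ^ (r - 1) := by positivity
  have hPr : (N : ℝ) ^ r = N * (N : ℝ) ^ (r - 1) := by
    rw [← pow_succ']; congr 1; omega
  have h := mcd_tail (α := W) N (fun x => (fcnt G.edges r Q x : ℝ)) ((N : ℝ) ^ (r - 1))
    (γ / 4 / (N : ℝ) ^ (r - 1)) ((β + 3 * γ / 4) * (N : ℝ) ^ r) (γ / 2 * (N : ℝ) ^ r)
    hP.le (by positivity) (by rw [div_mul_cancel₀ _ hP.ne']; linarith) (by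
      intro x i a
      have a1 := fcnt_diff G.edges hr1 Q (Function.update x i a) x {i} (by
        intro i' hi'
        rw [Function.update_of_ne (by simpa using hi')])
      have a2 := fcnt_diff G.edges hr1 Q x (Function.update x i a) {i} (by
        intro i' hi'
        rw [Function.update_of_ne (by simpa using hi')])
      rw [card_singleton, one_mul] at a1 a2
      have a1 : (fcnt G.edges r Q (Function.update x i a) : ℝ) ≤
        fcnt G.edges r Q x + (N : ℝ) ^ (r - 1) := by exact_mod_cast a1
      have a2 : (fcnt G.edges r Q x : ℝ) ≤
        fcnt G.edges r Q (Function.update x i a) + (N : ℝ) ^ (r - 1) := by exact_mod_cast a2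
      rw [abs_le]; constructor <;> linarith) (by
      have h3 := fcnt_sum (W := W) hjk G Q hQ (hr ▸ hNr)
      rw [hr] at h3
      have h3 : (N.descFactorial r : ℝ) * (G.degIn Q W) * (W.card : ℝ) ^ (N - r) ≤
        ∑ x : Fin N → W, (fcnt G.edges r Q x : ℝ) := by exact_mod_cast h3
      refine le_trans ?_ h3
      rw [hcard]
      calc (β + 3 * γ / 4) * (N : ℝ) ^ r * (W.card : ℝ) ^ N
          ≤ ((β + γ) * ((N : ℝ) - r) ^ r) * (W.card : ℝ) ^ N :=
            mul_le_mul_of_nonneg_right hN1 (by positivity)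
        _ ≤ ((β + γ) * (N.descFactorial r : ℝ)) * (W.card : ℝ) ^ N :=
            mul_le_mul_of_nonneg_right (mul_le_mul_of_nonneg_left hdf (by linarith))
              (by positivity)
        _ = (N.descFactorial r : ℝ) * ((β + γ) * (W.card : ℝ) ^ r) * (W.card : ℝ) ^ (N - r) := by
            rw [← Nat.add_sub_cancel' hNr, pow_add]
            simp only [Nat.add_sub_cancel_left]
            ring
        _ ≤ _ := by
            apply mul_le_mul_of_nonneg_right _ (by positivity)
            exact mul_le_mul_of_nonneg_left hdeg (by positivity))
  rw [hcard] at h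
  refine le_trans ?_ (h.trans (le_of_eq ?_))
  · apply Nat.cast_le.2
    apply card_le_card
    intro x hx
    rw [mem_filter] at hx ⊢
    refine ⟨hx.1, ?_⟩
    have := hx.2
    linarith
  · congr 2
    rw [div_mul_cancel₀ _ hP.ne', hPr]
    field_simp
    ring

/-- bad events for positions `P` and fixed part `Q0` -/
theorem fcnt_cond {k j : ℕ} (hjk : j < k) (β γ : ℝ) (hβ : 0 ≤ β) (hγ : 0 < γ) (hγ1 : γ ≤ 1) :
    ∃ N0 : ℕ, ∀ N : ℕ, N0 ≤ N → ∀ (G : HGraph k) (W : Finset ℕ), W.Nonempty → W ⊆ G.verts →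
      (∀ Q ⊆ G.verts, Q.card = j → (β + γ) * (W.card : ℝ) ^ (k - j) ≤ G.degIn Q W) →
      ∀ (Q0 : Finset ℕ) (P : Finset (Fin N)), Q0 ⊆ G.verts → P.card ≤ j →
      ((univ.filter fun x : Fin N → W => (Q0 ∪ P.image (fun i => (x i : ℕ))).card = j ∧
        (fcnt G.edges (k - j) (Q0 ∪ P.image (fun i => (x i : ℕ))) x : ℝ) <
        β * (N : ℝ) ^ (k - j)).card : ℝ) ≤
        (W.card : ℝ) ^ N * Real.exp (-(2 * (γ ^ 2 / 32) * N)) := by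
  obtain ⟨N0, h0⟩ := fcnt_tail hjk β γ hβ hγ hγ1
  refine ⟨N0, fun N hN G W hW hWv hdeg Q0 P hQ0 hP => ?_⟩
  set Bd := univ.filter fun x : Fin N → W => (Q0 ∪ P.image (fun i => (x i : ℕ))).card = j ∧
        (fcnt G.edges (k - j) (Q0 ∪ P.image (fun i => (x i : ℕ))) x : ℝ) <
        β * (N : ℝ) ^ (k - j) with hBd
  have hWp : (0 : ℝ) < (W.card : ℝ) ^ N := by
    have := hW.card_pos; positivity
  let T : (Fin N → W) → Finset (Fin N → W) := fun w => univ.filter fun x : Fin N → W =>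
    (Q0 ∪ P.image (fun i => (w i : ℕ))).card = j ∧
      (fcnt G.edges (k - j) (Q0 ∪ P.image (fun i => (w i : ℕ))) x : ℝ) <
        β * (N : ℝ) ^ (k - j) + j * (N : ℝ) ^ (k - j - 1)
  have hT : ∀ w, ((T w).card : ℝ) ≤ (W.card : ℝ) ^ N * Real.exp (-(2 * (γ ^ 2 / 32) * N)) := by
    intro w
    by_cases hc : (Q0 ∪ P.image (fun i => (w i : ℕ))).card = j
    · refine le_trans (Nat.cast_le.2 (card_le_card ?_)) (h0 N hN G W
        (Q0 ∪ P.image (fun i => (w i : ℕ))) hW hc (hdeg _ ?_ hc))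
      · intro x hx
        exact mem_filter.2 ⟨mem_univ _, (mem_filter.1 hx).2.2⟩
      · apply union_subset hQ0
        intro y hy
        obtain ⟨i, _, rfl⟩ := mem_image.1 hy
        exact hWv (w i).2
    · have : T w = ∅ := by
        ext x; simp [T, hc]
      rw [this]; simp; positivity
  have hinj : Bd.card * W.card ^ N ≤ ∑ w, (T w).card := by
    have e1 : W.card ^ N = (univ : Finset (Fin N → W)).card := by simp
    rw [e1, ← card_product, ← card_sigma]
    apply card_le_card_of_injOn (fun q : (Fin N → W) × (Fin N → W) =>
      (⟨P.piecewise q.1 q.2, P.piecewise q.2 q.1⟩ : Σ _ : Fin N → W, (Fin N → W)))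
    · rintro ⟨x, w⟩ hq
      have hx := (mem_filter.1 (mem_product.1 (mem_coe.1 hq)).1).2
      apply mem_coe.2
      rw [mem_sigma]
      refine ⟨mem_univ _, mem_filter.2 ⟨mem_univ _, ?_⟩⟩
      have himg : P.image (fun i => ((P.piecewise x w i : W) : ℕ)) =
          P.image (fun i => (x i : ℕ)) := by
        apply image_congr
        intro i hi
        simp [piecewise_eq_of_mem _ _ _ (mem_coe.1 hi)]
      simp only [himg]
      refine ⟨hx.1, ?_⟩
      have hd := fcnt_diff G.edges (r := k - j) (by omega)
        (Q0 ∪ P.image (fun i => (x i : ℕ))) (P.piecewise w x) x P (fun i hi => by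
          simp [hi])
      have hd' : (fcnt G.edges (k - j) (Q0 ∪ P.image (fun i => (x i : ℕ)))
          (P.piecewise w x) : ℝ) ≤ fcnt G.edges (k - j) (Q0 ∪ P.image (fun i => (x i : ℕ))) x +
          P.card * (N : ℝ) ^ (k - j - 1) := by exact_mod_cast hd
      have hPj : (P.card : ℝ) * (N : ℝ) ^ (k - j - 1) ≤ j * (N : ℝ) ^ (k - j - 1) :=
        mul_le_mul_of_nonneg_right (by exact_mod_cast hP) (by positivity)
      linarith [hx.2]
    · rintro ⟨x, w⟩ _ ⟨x', w'⟩ _ h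
      have h1 : P.piecewise x w = P.piecewise x' w' := congrArg Sigma.fst h
      have h2 : P.piecewise w x = P.piecewise w' x' := by
        have := h
        simp only [Sigma.mk.injEq, heq_eq_eq] at this
        exact this.2
      ext1
      · funext i
        by_cases hi : i ∈ P
        · simpa [hi] using congrFun h1 i
        · simpa [hi] using congrFun h2 i
      · funext i
        by_cases hi : i ∈ P
        · simpa [hi] using congrFun h2 i
        · simpa [hi] using congrFun h1 i
  have hfin : (Bd.card : ℝ) * (W.card : ℝ) ^ N ≤
      ((W.card : ℝ) ^ N * Real.exp (-(2 * (γ ^ 2 / 32) * N))) * (W.card : ℝ) ^ N := by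
    calc (Bd.card : ℝ) * (W.card : ℝ) ^ N ≤ ∑ w, ((T w).card : ℝ) := by exact_mod_cast hinj
      _ ≤ ∑ w : Fin N → W, ((W.card : ℝ) ^ N * Real.exp (-(2 * (γ ^ 2 / 32) * N))) :=
          sum_le_sum fun w _ => hT w
      _ = _ := by rw [sum_const, nsmul_eq_mul]; simp; ring
  exact le_of_mul_le_mul_right hfin hWp

/-- the set of bad samples -/
def badS {k : ℕ} (G : HGraph k) (j N : ℕ) (W F : Finset ℕ) (d : ℝ) : Finset (Fin N → W) :=
  univ.filter fun x => Function.Injective x ∧ (∀ i, (x i : ℕ) ∉ F) ∧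
    ¬ G.MinDegOnGe j (F ∪ univ.image (fun i => (x i : ℕ))) d

theorem sampling {k j : ℕ} (hjk : j < k) (β γ : ℝ) (hβ : 0 ≤ β) (hγ : 0 < γ) (hγ1 : γ ≤ 1)
    (f0 : ℕ) :
    ∃ c : ℝ, 0 < c ∧ ∃ N0 : ℕ, ∀ N : ℕ, N0 ≤ N → ∀ (G : HGraph k) (W : Finset ℕ), W.Nonempty →
      W ⊆ G.verts →
      (∀ Q ⊆ G.verts, Q.card = j → (β + γ) * (W.card : ℝ) ^ (k - j) ≤ G.degIn Q W) →
      ∀ F ⊆ G.verts, F.card ≤ f0 →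
      ((badS G j N W F (β * (N : ℝ) ^ (k - j))).card : ℝ) ≤
        Real.exp (-(c * N)) * (W.card : ℝ) ^ N := by
  obtain ⟨N0, h0⟩ := fcnt_cond hjk β γ hβ hγ hγ1
  obtain ⟨N1, h1⟩ := exp_beats (2 ^ f0 * (j + 1)) (γ ^ 2 / 32) j (by positivity)
  refine ⟨γ ^ 2 / 32, by positivity, max N0 N1, fun N hN G W hW hWv hdeg F hF hFc => ?_⟩
  have h0 := h0 N (by omega) G W hW hWv hdeg
  have h1 := h1 N (by omega)
  set Ps := (range (j + 1)).biUnion fun s => powersetCard s (univ : Finset (Fin N)) with hPs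
  have hPsc : Ps.card ≤ (j + 1) * (N + 1) ^ j := by
    have := card_biUnion_le_card_mul (range (j + 1))
      (fun s => powersetCard s (univ : Finset (Fin N))) ((N + 1) ^ j) (fun s hs => by
        rw [card_powersetCard, card_univ, Fintype.card_fin]
        have hs := mem_range.1 hs
        refine (Nat.choose_le_pow _ _).trans ?_
        exact (Nat.pow_le_pow_left (by omega) s).trans (Nat.pow_le_pow_right (by omega) (by omega)))
    simpa using this
  let Bd : Finset ℕ × Finset (Fin N) → Finset (Fin N → W) := fun q =>
    univ.filter fun x : Fin N → W => (q.1 ∪ q.2.image (fun i => (x i : ℕ))).card = j ∧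
        (fcnt G.edges (k - j) (q.1 ∪ q.2.image (fun i => (x i : ℕ))) x : ℝ) <
        β * (N : ℝ) ^ (k - j)
  have hsub : badS G j N W F (β * (N : ℝ) ^ (k - j)) ⊆ (F.powerset ×ˢ Ps).biUnion Bd := by
    intro x hx
    obtain ⟨-, hinj, hav, hbad⟩ := mem_filter.1 hx
    unfold HGraph.MinDegOnGe at hbad
    push Not at hbad
    obtain ⟨T, hT, hTc, hlt⟩ := hbad
    set P := univ.filter fun i : Fin N => (x i : ℕ) ∈ T with hPdef
    have hTeq : T ∩ F ∪ P.image (fun i => (x i : ℕ)) = T := by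
      ext y
      simp only [mem_union, mem_inter, mem_image, hPdef, mem_filter, mem_univ, true_and]
      constructor
      · rintro (h | ⟨i, hi, rfl⟩)
        · exact h.1
        · exact hi
      · intro hy
        rcases mem_union.1 (hT hy) with h | h
        · exact Or.inl ⟨hy, h⟩
        · obtain ⟨i, _, rfl⟩ := mem_image.1 h
          exact Or.inr ⟨i, hy, rfl⟩
    have hxinj : Function.Injective (fun i => (x i : ℕ)) := Subtype.val_injective.comp hinj
    have hPc : P.card ≤ j := by
      rw [← hTc, ← card_image_of_injective P hxinj]
      apply card_le_card
      conv_rhs => rw [← hTeq]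
      exact subset_union_right
    refine mem_biUnion.2 ⟨(T ∩ F, P), mem_product.2 ⟨mem_powerset.2 inter_subset_right, ?_⟩, ?_⟩
    · exact mem_biUnion.2 ⟨P.card, mem_range.2 (by omega), mem_powersetCard.2 ⟨subset_univ _, rfl⟩⟩
    · refine mem_filter.2 ⟨mem_univ _, ?_⟩
      simp only [hTeq]
      refine ⟨hTc, lt_of_le_of_lt (Nat.cast_le.2 ?_) hlt⟩
      apply card_le_card_of_injOn (fun A => T ∪ A.image (fun i => (x i : ℕ)))
      · intro A hA
        obtain ⟨hA, hE⟩ := mem_filter.1 (mem_coe.1 hA)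
        apply mem_coe.2
        refine mem_filter.2 ⟨mem_filter.2 ⟨hE, ?_⟩, subset_union_left⟩
        apply union_subset hT
        exact (image_subset_image (subset_univ _)).trans subset_union_right
      · intro A hA A' hA' h
        obtain ⟨hA, hE⟩ := mem_filter.1 (mem_coe.1 hA)
        obtain ⟨hA', hE'⟩ := mem_filter.1 (mem_coe.1 hA')
        have key : ∀ A ∈ powersetCard (k - j) (univ : Finset (Fin N)),
            T ∪ A.image (fun i => (x i : ℕ)) ∈ G.edges →
            Disjoint T (A.image (fun i => (x i : ℕ))) := by
          intro A hA hE
          have hc := G.edge_card _ hE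
          rw [← card_union_eq_card_add_card, hc, card_image_of_injective _ hxinj,
            (mem_powersetCard.1 hA).2]
          omega
        have h : T ∪ A.image (fun i => (x i : ℕ)) = T ∪ A'.image (fun i => (x i : ℕ)) := h
        have h2 : A.image (fun i => (x i : ℕ)) = A'.image (fun i => (x i : ℕ)) := by
          rw [← union_sdiff_cancel_left (key A hA hE), h,
            union_sdiff_cancel_left (key A' hA' hE')]
        exact image_injective hxinj h2
  have hb : ∀ q ∈ F.powerset ×ˢ Ps, ((Bd q).card : ℝ) ≤
      (W.card : ℝ) ^ N * Real.exp (-(2 * (γ ^ 2 / 32) * N)) := by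
    intro q hq
    obtain ⟨hq1, hq2⟩ := mem_product.1 hq
    obtain ⟨s, hs, hq2⟩ := mem_biUnion.1 hq2
    exact h0 q.1 q.2 ((mem_powerset.1 hq1).trans hF) (by
      rw [(mem_powersetCard.1 hq2).2]; have := mem_range.1 hs; omega)
  have hexp := Real.exp_pos (-(2 * (γ ^ 2 / 32) * (N : ℝ)))
  calc ((badS G j N W F (β * (N : ℝ) ^ (k - j))).card : ℝ)
      ≤ ((F.powerset ×ˢ Ps).biUnion Bd).card := Nat.cast_le.2 (card_le_card hsub)
    _ ≤ ∑ q ∈ F.powerset ×ˢ Ps, ((Bd q).card : ℝ) := by exact_mod_cast card_biUnion_le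
    _ ≤ ∑ q ∈ F.powerset ×ˢ Ps, (W.card : ℝ) ^ N * Real.exp (-(2 * (γ ^ 2 / 32) * N)) :=
        sum_le_sum hb
    _ = ((F.powerset ×ˢ Ps).card : ℝ) *
        ((W.card : ℝ) ^ N * Real.exp (-(2 * (γ ^ 2 / 32) * N))) := by
        rw [sum_const, nsmul_eq_mul]
    _ ≤ (2 ^ f0 * ((j + 1) * ((N : ℝ) + 1) ^ j)) *
        ((W.card : ℝ) ^ N * Real.exp (-(2 * (γ ^ 2 / 32) * N))) := by
        apply mul_le_mul_of_nonneg_right _ (by positivity)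
        rw [card_product, card_powerset, Nat.cast_mul]
        apply mul_le_mul _ (by exact_mod_cast hPsc) (by positivity) (by positivity)
        exact_mod_cast Nat.pow_le_pow_right (by norm_num) hFc
    _ = (2 ^ f0 * (j + 1) * ((N : ℝ) + 1) ^ j * Real.exp (-(2 * (γ ^ 2 / 32) * N))) *
        (W.card : ℝ) ^ N := by ring
    _ ≤ _ := mul_le_mul_of_nonneg_right h1 (by positivity)

theorem touch_le {k : ℕ} (G : HGraph k) (T U X : Finset ℕ) (hT : T.card < k) :
    (G.edges.filter fun e => T ⊆ e ∧ e \ T ⊆ U ∧ ¬ Disjoint (e \ T) X).card ≤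
      X.card * U.card ^ (k - T.card - 1) := by
  have h1 : (G.edges.filter fun e => T ⊆ e ∧ e \ T ⊆ U ∧ ¬ Disjoint (e \ T) X) ⊆
      X.biUnion fun z => (powersetCard (k - T.card - 1) U).image fun D => T ∪ insert z D := by
    intro e he
    obtain ⟨he, hTe, hU, hd⟩ := mem_filter.1 he
    obtain ⟨z, hze, hzX⟩ := not_disjoint_iff.1 hd
    refine mem_biUnion.2 ⟨z, hzX, mem_image.2 ⟨(e \ T).erase z, ?_, ?_⟩⟩
    · rw [mem_powersetCard]
      exact ⟨(erase_subset _ _).trans hU, by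
        rw [card_erase_of_mem hze, card_sdiff_of_subset hTe, G.edge_card e he]⟩
    · rw [insert_erase hze, union_sdiff_of_subset hTe]
  refine (card_le_card h1).trans (card_biUnion_le_card_mul _ _ _ fun z _ => ?_)
  refine card_image_le.trans ?_
  rw [card_powersetCard]
  exact Nat.choose_le_pow _ _

theorem MinDegOn_del {k j : ℕ} (hjk : j < k) (G : HGraph k) (U X : Finset ℕ) (d : ℝ)
    (h : G.MinDegOnGe j U d) :
    G.MinDegOnGe j (U \ X) (d - X.card * (U.card : ℝ) ^ (k - j - 1)) := by
  intro T hT hTc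
  have h1 := h T (hT.trans sdiff_subset) hTc
  have h2 := touch_le G T U X (by omega)
  rw [hTc] at h2
  have h3 : ((G.inducedEdges U).filter fun e => T ⊆ e).card ≤
      ((G.inducedEdges (U \ X)).filter fun e => T ⊆ e).card +
      (G.edges.filter fun e => T ⊆ e ∧ e \ T ⊆ U ∧ ¬ Disjoint (e \ T) X).card := by
    refine le_trans (card_le_card ?_) (card_union_le _ _)
    intro e he
    obtain ⟨he, hTe⟩ := mem_filter.1 he
    obtain ⟨he, heU⟩ := mem_filter.1 he
    rw [mem_union]
    by_cases hd : Disjoint (e \ T) X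
    · left
      refine mem_filter.2 ⟨mem_filter.2 ⟨he, ?_⟩, hTe⟩
      intro y hy
      by_cases hyT : y ∈ T
      · exact hT hyT
      · exact mem_sdiff.2 ⟨heU hy, disjoint_left.1 hd (mem_sdiff.2 ⟨hy, hyT⟩)⟩
    · right
      exact mem_filter.2 ⟨he, hTe, sdiff_subset.trans heU, hd⟩
  have h4 : (((G.inducedEdges U).filter fun e => T ⊆ e).card : ℝ) ≤
      ((G.inducedEdges (U \ X)).filter fun e => T ⊆ e).card +
      X.card * (U.card : ℝ) ^ (k - j - 1) := by
    exact_mod_cast h3.trans (Nat.add_le_add_left h2 _)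
  linarith

theorem degIn_ge {k : ℕ} (G : HGraph k) (Q X : Finset ℕ) (hQ : Q.card < k) :
    (G.degOn Q : ℝ) - X.card * (G.verts.card : ℝ) ^ (k - Q.card - 1) ≤
      G.degIn Q (G.verts \ X) := by
  have h2 := touch_le G Q G.verts X hQ
  have h3 : G.degOn Q ≤ G.degIn Q (G.verts \ X) +
      (G.edges.filter fun e => Q ⊆ e ∧ e \ Q ⊆ G.verts ∧ ¬ Disjoint (e \ Q) X).card := by
    refine le_trans (card_le_card ?_) (card_union_le _ _)
    intro e he
    obtain ⟨he, hTe⟩ := mem_filter.1 he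
    rw [mem_union]
    have hs : e \ Q ⊆ G.verts := sdiff_subset.trans (G.edge_sub e he)
    by_cases hd : Disjoint (e \ Q) X
    · left
      exact mem_filter.2 ⟨he, hTe, subset_sdiff.2 ⟨hs, hd⟩⟩
    · right
      exact mem_filter.2 ⟨he, hTe, hs, hd⟩
  have h4 : (G.degOn Q : ℝ) ≤ G.degIn Q (G.verts \ X) +
      X.card * (G.verts.card : ℝ) ^ (k - Q.card - 1) := by
    exact_mod_cast h3.trans (Nat.add_le_add_left h2 _)
  linarith

/-- Erdos' theorem: dense partite structures contain complete blow-ups -/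
theorem blowup (g : ℕ) (N : ℕ) : ∀ c : ℝ, 0 < c → ∃ n0 : ℕ, ∀ (α : Type) [Fintype α],
    n0 ≤ Fintype.card α → ∀ S : Finset (Fin N → α),
      c * (Fintype.card α : ℝ) ^ N ≤ S.card →
      ∃ A : Fin N → Finset α, (∀ i, (A i).card = g) ∧ ∀ x, (∀ i, x i ∈ A i) → x ∈ S := by
  induction N with
  | zero =>
    intro c hc
    refine ⟨0, fun α _ _ S hS => ⟨fun _ => ∅, fun i => i.elim0, fun x _ => ?_⟩⟩
    have : 0 < S.card := by
      have h : (0 : ℝ) < S.card := by simp at hS; linarith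
      exact_mod_cast h
    obtain ⟨y, hy⟩ := card_pos.1 this
    rwa [Subsingleton.elim x y]
  | succ N ih =>
    intro c hc
    obtain ⟨n1, h1⟩ := ih (c / 2 * (c / 4) ^ g) (by positivity)
    obtain ⟨n2, hn2⟩ := exists_nat_ge (4 * (g : ℝ) / c)
    refine ⟨max (max n1 n2) (g + 1), fun α _ hα S hS => ?_⟩
    set n := Fintype.card α with hn
    have hnp : (0 : ℝ) < n := by exact_mod_cast (by omega : 0 < n)
    have hgn : (g : ℝ) ≤ c / 4 * n := by
      have : 4 * (g : ℝ) / c ≤ n := hn2.trans (by exact_mod_cast (by omega : n2 ≤ n))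
      rw [div_le_iff₀ hc] at this
      linarith
    let L : (Fin N → α) → Finset α := fun y => univ.filter fun a => (Fin.cons a y : Fin (N+1) → α) ∈ S
    have hL : ∑ y, (L y).card = S.card := by
      rw [← card_sigma]
      apply card_bij (fun (q : Σ _ : Fin N → α, α) _ => (Fin.cons q.2 q.1 : Fin (N+1) → α))
      · intro q hq
        exact (mem_filter.1 (mem_sigma.1 hq).2).2
      · rintro ⟨y, a⟩ _ ⟨y', a'⟩ _ h
        obtain ⟨rfl, rfl⟩ := Fin.cons_inj.1 h
        rfl
      · intro x hx
        refine ⟨⟨Fin.tail x, x 0⟩, ?_, ?_⟩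
        · refine mem_sigma.2 ⟨mem_univ _, mem_filter.2 ⟨mem_univ _, ?_⟩⟩
          simpa using hx
        · simp
    let Y := univ.filter fun y : Fin N → α => c / 2 * n ≤ (L y).card
    have hY : c / 2 * (n : ℝ) ^ N ≤ Y.card := by
      have h2 : (S.card : ℝ) ≤ Y.card * n + c / 2 * n * (n : ℝ) ^ N := by
        rw [← hL, Nat.cast_sum, ← sum_filter_add_sum_filter_not univ
          (fun y : Fin N → α => c / 2 * n ≤ (L y).card)]
        apply add_le_add
        · rw [← nsmul_eq_mul]
          apply sum_le_card_nsmul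
          intro y _
          exact_mod_cast (card_le_univ _)
        · calc _ ≤ ((univ.filter fun y : Fin N → α => ¬ c / 2 * n ≤ (L y).card).card : ℝ) *
                (c / 2 * n) := by
                rw [← nsmul_eq_mul]
                apply sum_le_card_nsmul
                intro y hy
                exact (not_le.1 (mem_filter.1 hy).2).le
            _ ≤ (n : ℝ) ^ N * (c / 2 * n) := by
                apply mul_le_mul_of_nonneg_right _ (by positivity)
                have := card_le_univ (univ.filter fun y : Fin N → α => ¬ c / 2 * n ≤ (L y).card)
                rw [Fintype.card_fun, Fintype.card_fin] at this
                exact_mod_cast this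
            _ = _ := by ring
      have h3 : c / 2 * (n : ℝ) ^ N * n ≤ Y.card * n := by
        have := hS.trans h2
        rw [pow_succ] at this
        linarith
      exact le_of_mul_le_mul_right h3 hnp
    let SS : Finset α → Finset (Fin N → α) := fun D =>
      univ.filter fun y => D ⊆ L y
    have hsum : ∑ D ∈ powersetCard g (univ : Finset α), (SS D).card =
        ∑ y, ((L y).card).choose g := by
      simp only [SS, card_filter]
      rw [sum_comm]
      apply sum_congr rfl
      intro y _
      rw [← card_filter, ← card_powersetCard]
      congr 1
      ext D
      simp only [mem_filter, mem_powersetCard, subset_univ, true_and]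
      tauto
    have hex : ∃ D ∈ powersetCard g (univ : Finset α),
        c / 2 * (c / 4) ^ g * (n : ℝ) ^ N ≤ ((SS D).card : ℝ) := by
      apply exists_le_of_sum_le
      · apply powersetCard_nonempty.2
        rw [card_univ]; omega
      · have e : ∑ D ∈ powersetCard g (univ : Finset α), ((SS D).card : ℝ) =
          ∑ y, (((L y).card).choose g : ℝ) := by exact_mod_cast hsum
        rw [e, sum_const, card_powersetCard, card_univ, nsmul_eq_mul]
        have hgf : (0 : ℝ) < (g.factorial : ℝ) := by exact_mod_cast g.factorial_pos
        calc ((n.choose g : ℕ) : ℝ) * (c / 2 * (c / 4) ^ g * (n : ℝ) ^ N)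
            ≤ ((n : ℝ) ^ g / g.factorial) * (c / 2 * (c / 4) ^ g * (n : ℝ) ^ N) :=
              mul_le_mul_of_nonneg_right (Nat.choose_le_pow_div g n) (by positivity)
          _ = (c / 2 * (n : ℝ) ^ N) * ((c / 4 * n) ^ g / g.factorial) := by
              rw [mul_pow]; ring
          _ ≤ Y.card * ((c / 4 * n) ^ g / g.factorial) :=
              mul_le_mul_of_nonneg_right hY (by positivity)
          _ = ∑ y ∈ Y, ((c / 4 * n) ^ g / g.factorial) := by rw [sum_const, nsmul_eq_mul]
          _ ≤ ∑ y ∈ Y, (((L y).card).choose g : ℝ) := by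
              apply sum_le_sum
              intro y hy
              have hy := (mem_filter.1 hy).2
              rw [div_le_iff₀ hgf]
              have h5 : ((((L y).card + 1 - g : ℕ) ^ g : ℕ) : ℝ) ≤
                  ((L y).card).choose g * g.factorial := by
                have := Nat.pow_sub_le_descFactorial (L y).card g
                rw [Nat.descFactorial_eq_factorial_mul_choose, mul_comm] at this
                exact_mod_cast this
              refine le_trans ?_ h5
              rw [Nat.cast_pow]
              apply pow_le_pow_left₀ (by positivity)
              have hle : g ≤ (L y).card + 1 := by
                have : (g : ℝ) ≤ (L y).card := by
                  have : 0 ≤ c / 4 * n := by positivity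
                  linarith
                have : g ≤ (L y).card := by exact_mod_cast this
                omega
              rw [Nat.cast_sub hle]
              push_cast
              linarith
          _ ≤ _ := sum_le_sum_of_subset_of_nonneg (subset_univ _) fun _ _ _ => by positivity
    obtain ⟨D, hD, hDc⟩ := hex
    obtain ⟨A, hA, hA2⟩ := h1 α (by omega) (SS D) hDc
    refine ⟨Fin.cons D A, ?_, ?_⟩
    · intro i
      refine Fin.cases ?_ ?_ i
      · simpa using (mem_powersetCard.1 hD).2
      · intro i; simpa using hA i
    · intro x hx
      have h6 := hA2 (Fin.tail x) (fun i => by simpa [Fin.tail] using hx i.succ)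
      have h7 := (mem_filter.1 h6).2 (by simpa using hx 0)
      have h8 := (mem_filter.1 h7).2
      simpa using h8

/-- `u` can robustly be attached to `Γ`. -/
def Att (E : Set (Finset ℕ)) (k : ℕ) (Γ : Finset ℕ) (z : ℕ) (u : ℕ) : Prop :=
  ∀ Z : Finset ℕ, Z.card ≤ z → ∃ D ⊆ Γ, Disjoint D Z ∧ D.card = k - 1 ∧ insert u D ∈ E

/-- the properties of the absorbing blow-up -/
structure Absb (E : Set (Finset ℕ)) (k : ℕ) (Γ : Finset ℕ) (z K : ℕ) : Prop where
  join : ∀ γ ∈ Γ, ∀ γ' ∈ Γ, γ ≠ γ' → ∀ Z : Finset ℕ, Z.card ≤ z → γ ∉ Z →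
    ∃ D ⊆ Γ, γ ∈ D ∧ γ' ∉ D ∧ Disjoint D Z ∧ D.card ≤ K ∧ LP E γ γ' D
  fin : ∀ D ⊆ Γ, (Γ \ D).card ≤ z → ∀ γ ∈ D, ∀ v ∈ Γ \ D, (k - 1) ∣ D.card → LP E γ v D

/-- current state of the construction -/
def StA (E : Set (Finset ℕ)) (Γ : Finset ℕ) (a : ℕ) (C : Finset ℕ) (s : ℕ) : Prop :=
  ∃ γ ∈ Γ, ∃ S, LP E a γ S ∧ S \ Γ = C ∧ (S ∩ Γ).card ≤ s

theorem edge_start {E : Set (Finset ℕ)} {u v : ℕ} {D : Finset ℕ} (he : insert u D ∈ E)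
    (hv : v ∈ D) (hu : u ∉ D) : LP E u v (insert u (D.erase v)) := by
  have huv : u ≠ v := fun h => hu (h ▸ hv)
  have := LP.edge he (mem_insert_self u D) (mem_insert_of_mem hv) huv
  rwa [erase_insert_of_ne huv] at this

theorem edge_end {E : Set (Finset ℕ)} {u v : ℕ} {D : Finset ℕ} (he : insert u D ∈ E)
    (hv : v ∈ D) (hu : u ∉ D) : LP E v u D := by
  have huv : u ≠ v := fun h => hu (h ▸ hv)
  have := LP.edge he (mem_insert_of_mem hv) (mem_insert_self u D) huv.symm
  rwa [erase_insert hu] at this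

theorem stA_init {E : Set (Finset ℕ)} {k : ℕ} (hk : 2 ≤ k) {Γ : Finset ℕ} {z : ℕ} {a : ℕ}
    (ha : Att E k Γ z a) (haΓ : a ∉ Γ) : StA E Γ a {a} k := by
  obtain ⟨D, hD, -, hDc, hE⟩ := ha ∅ (by simp)
  obtain ⟨γ, hγ⟩ : D.Nonempty := card_pos.1 (by omega)
  have haD : a ∉ D := fun h => haΓ (hD h)
  refine ⟨γ, hD hγ, _, edge_start hE hγ haD, ?_, ?_⟩
  · ext y
    simp only [mem_sdiff, mem_insert, mem_erase, mem_singleton]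
    constructor
    · rintro ⟨h | h, h2⟩
      · exact h
      · exact absurd (hD h.2) h2
    · rintro rfl; exact ⟨Or.inl rfl, haΓ⟩
  · refine (card_le_card inter_subset_left).trans ((card_insert_le _ _).trans ?_)
    rw [card_erase_of_mem hγ]; omega

theorem stA_step {E : Set (Finset ℕ)} {k : ℕ} (hk : 2 ≤ k) {Γ : Finset ℕ} {z K : ℕ}
    (hA : Absb E k Γ z K) {a : ℕ} {C : Finset ℕ} {s : ℕ} (h : StA E Γ a C s)
    {u u' : ℕ} {I : Finset ℕ} (hI : LP E u u' I) (hIΓ : Disjoint (insert u' I) Γ)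
    (hIC : Disjoint (insert u' I) C) (hu : Att E k Γ z u) (hu' : Att E k Γ z u')
    (hs : s + K + 2 * k ≤ z) : StA E Γ a (C ∪ insert u' I) (s + (K + 2 * k)) := by
  obtain ⟨γ, hγ, S, hS, hSC, hSs⟩ := h
  have hγS : γ ∉ S := hS.end_notMem
  have huI : u ∈ insert u' I := hI.start_mem
  have huΓ : u ∉ Γ := disjoint_left.1 hIΓ huI
  have huΓ' : u' ∉ Γ := disjoint_left.1 hIΓ (mem_insert_self _ _)
  have hSd : ∀ y ∈ insert u' I, y ∉ S := by
    intro y hy hyS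
    exact disjoint_left.1 hIC hy (hSC ▸ mem_sdiff.2 ⟨hyS, disjoint_left.1 hIΓ hy⟩)
  -- attach u
  obtain ⟨D1, hD1, hD1Z, hD1c, hE1⟩ := hu (insert γ (S ∩ Γ))
    ((card_insert_le _ _).trans (by omega))
  obtain ⟨γ1, hγ1⟩ : D1.Nonempty := card_pos.1 (by omega)
  have hD1S : ∀ y ∈ D1, y ∉ S := fun y hy hyS =>
    disjoint_left.1 hD1Z hy (mem_insert_of_mem (mem_inter.2 ⟨hyS, hD1 hy⟩))
  have hγD1 : γ ∉ D1 := fun h => disjoint_left.1 hD1Z h (mem_insert_self _ _)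
  obtain ⟨J, hJ, hγJ, hγ1J, hJZ, hJc, hJP⟩ := hA.join γ hγ γ1 (hD1 hγ1)
    (fun h => hγD1 (h ▸ hγ1)) (S ∩ Γ ∪ D1) ((card_union_le _ _).trans (by omega)) (by
      rw [mem_union, mem_inter]; tauto)
  have hJS : ∀ y ∈ J, y ∉ S := fun y hy hyS =>
    disjoint_left.1 hJZ hy (mem_union_left _ (mem_inter.2 ⟨hyS, hJ hy⟩))
  have hJD1 : ∀ y ∈ J, y ∉ D1 := fun y hy hyS =>
    disjoint_left.1 hJZ hy (mem_union_right _ hyS)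
  obtain ⟨D2, hD2, hD2Z, hD2c, hE2⟩ := hu' (S ∩ Γ ∪ D1 ∪ J)
    ((card_union_le _ _).trans ((Nat.add_le_add_right (card_union_le _ _) _).trans (by omega)))
  obtain ⟨γ2, hγ2⟩ : D2.Nonempty := card_pos.1 (by omega)
  have hD2S : ∀ y ∈ D2, y ∉ S := fun y hy hyS =>
    disjoint_left.1 hD2Z hy (mem_union_left _ (mem_union_left _ (mem_inter.2 ⟨hyS, hD2 hy⟩)))
  have hD2D1 : ∀ y ∈ D2, y ∉ D1 := fun y hy hyS =>
    disjoint_left.1 hD2Z hy (mem_union_left _ (mem_union_right _ hyS))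
  have hD2J : ∀ y ∈ D2, y ∉ J := fun y hy hyS =>
    disjoint_left.1 hD2Z hy (mem_union_right _ hyS)
  have hIG : ∀ y ∈ insert u' I, y ∉ Γ := fun y hy => disjoint_left.1 hIΓ hy
  have huI' : u' ∉ I := hI.end_notMem
  -- paths
  have p4 := edge_start hE2 hγ2 (fun h => huΓ' (hD2 h))
  have p34 := hI.append p4 (by
    rw [disjoint_left]
    intro y hy
    simp only [mem_insert, mem_erase, not_or]
    refine ⟨?_, ?_, ?_⟩
    · rintro rfl; exact hIG _ (mem_insert_of_mem hy) (hD2 hγ2)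
    · rintro rfl; exact huI' hy
    · rintro ⟨_, h⟩; exact hIG _ (mem_insert_of_mem hy) (hD2 h))
  have p2 := edge_end hE1 hγ1 (fun h => huΓ (hD1 h))
  have p234 := p2.append p34 (by
    rw [disjoint_left]
    intro y hy
    have hyΓ := hD1 hy
    simp only [mem_insert, mem_erase, mem_union, not_or]
    refine ⟨?_, ?_, ?_, ?_⟩
    · rintro rfl; exact hD2D1 _ hγ2 hy
    · intro h; exact hIG _ (mem_insert_of_mem h) hyΓ
    · rintro rfl; exact huΓ' hyΓ
    · rintro ⟨_, h⟩; exact hD2D1 _ h hy)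
  have p1234 := hJP.append p234 (by
    rw [disjoint_left]
    intro y hy
    have hyΓ := hJ hy
    simp only [mem_insert, mem_erase, mem_union, not_or]
    refine ⟨?_, ?_, ?_, ?_, ?_⟩
    · rintro rfl; exact hD2J _ hγ2 hy
    · exact hJD1 _ hy
    · intro h; exact hIG _ (mem_insert_of_mem h) hyΓ
    · rintro rfl; exact huΓ' hyΓ
    · rintro ⟨_, h⟩; exact hD2J _ h hy)
  have p := hS.append p1234 (by
    rw [disjoint_left]
    intro y hy
    simp only [mem_insert, mem_erase, mem_union, not_or]
    refine ⟨?_, ?_, ?_, ?_, ?_, ?_⟩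
    · rintro rfl; exact hD2S _ hγ2 hy
    · intro h; exact hJS _ h hy
    · intro h; exact hD1S _ h hy
    · intro h; exact hSd _ (mem_insert_of_mem h) hy
    · rintro rfl; exact hSd _ (mem_insert_self _ _) hy
    · rintro ⟨_, h⟩; exact hD2S _ h hy)
  refine ⟨γ2, hD2 hγ2, _, p, ?_, ?_⟩
  · rw [← hSC]
    ext y
    simp only [mem_sdiff, mem_union, mem_insert, mem_erase]
    constructor
    · rintro ⟨h | h | h | h | h | h, hy⟩
      · exact Or.inl ⟨h, hy⟩
      · exact absurd (hJ h) hy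
      · exact absurd (hD1 h) hy
      · exact Or.inr (Or.inr h)
      · exact Or.inr (Or.inl h)
      · exact absurd (hD2 h.2) hy
    · rintro (h | h | h)
      · exact ⟨Or.inl h.1, h.2⟩
      · subst h; exact ⟨by simp, huΓ'⟩
      · exact ⟨by simp [h], hIG _ (mem_insert_of_mem h)⟩
  · have : (S ∪ (J ∪ (D1 ∪ (I ∪ insert u' (D2.erase γ2))))) ∩ Γ ⊆ (S ∩ Γ) ∪ (J ∪ (D1 ∪ D2)) := by
      intro y
      simp only [mem_inter, mem_union, mem_insert, mem_erase]
      rintro ⟨h | h | h | h | h | h, hy⟩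
      · exact Or.inl ⟨h, hy⟩
      · exact Or.inr (Or.inl h)
      · exact Or.inr (Or.inr (Or.inl h))
      · exact absurd hy (hIG _ (mem_insert_of_mem h))
      · subst h; exact absurd hy huΓ'
      · exact Or.inr (Or.inr (Or.inr h.2))
    refine (card_le_card this).trans ?_
    have b1 := card_union_le (S ∩ Γ) (J ∪ (D1 ∪ D2))
    have b2 := card_union_le J (D1 ∪ D2)
    have b3 := card_union_le D1 D2
    omega

theorem stA_good {E : Set (Finset ℕ)} {k : ℕ} (hk : 2 ≤ k) {Γ R : Finset ℕ} {z K zr : ℕ}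
    (hA : Absb E k Γ z K) (hRΓ : Disjoint R Γ) (hR : ∀ r ∈ R, Att E k Γ z r)
    {a : ℕ} {C : Finset ℕ} {s : ℕ} (h : StA E Γ a C s)
    {u u' : ℕ} {I : Finset ℕ} (hI : LP E u u' I) (hIΓ : Disjoint (insert u' I) Γ)
    (hIC : Disjoint (insert u' I) C) (hIR : Disjoint (insert u' I) R)
    (hu : Att E k R zr u) (hu' : Att E k R zr u')
    (hs : s + K + 2 * k ≤ z) (hC : (C ∩ R).card + k ≤ zr) :
    ∃ R' ⊆ R, (R' ∩ R).card ≤ 2 * k ∧ Disjoint R' C ∧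
      StA E Γ a (C ∪ (insert u' I ∪ R')) (s + (K + 2 * k)) := by
  have huI : u ∈ insert u' I := hI.start_mem
  have huR : u ∉ R := disjoint_left.1 hIR huI
  have huR' : u' ∉ R := disjoint_left.1 hIR (mem_insert_self _ _)
  have hIG : ∀ y ∈ insert u' I, y ∉ R := fun y hy => disjoint_left.1 hIR hy
  have huI' : u' ∉ I := hI.end_notMem
  obtain ⟨D1, hD1, hD1Z, hD1c, hE1⟩ := hu (C ∩ R) (by omega)
  obtain ⟨γ1, hγ1⟩ : D1.Nonempty := card_pos.1 (by omega)
  obtain ⟨D2, hD2, hD2Z, hD2c, hE2⟩ := hu' (C ∩ R ∪ D1)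
    ((card_union_le _ _).trans (by omega))
  obtain ⟨γ2, hγ2⟩ : D2.Nonempty := card_pos.1 (by omega)
  have hD2D1 : ∀ y ∈ D2, y ∉ D1 := fun y hy hyS =>
    disjoint_left.1 hD2Z hy (mem_union_right _ hyS)
  have hD1C : ∀ y ∈ D1, y ∉ C := fun y hy hyS =>
    disjoint_left.1 hD1Z hy (mem_inter.2 ⟨hyS, hD1 hy⟩)
  have hD2C : ∀ y ∈ D2, y ∉ C := fun y hy hyS =>
    disjoint_left.1 hD2Z hy (mem_union_left _ (mem_inter.2 ⟨hyS, hD2 hy⟩))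
  have p4 := edge_start hE2 hγ2 (fun h => huR' (hD2 h))
  have p34 := hI.append p4 (by
    rw [disjoint_left]
    intro y hy
    simp only [mem_insert, mem_erase, not_or]
    refine ⟨?_, ?_, ?_⟩
    · rintro rfl; exact hIG _ (mem_insert_of_mem hy) (hD2 hγ2)
    · rintro rfl; exact huI' hy
    · rintro ⟨_, h⟩; exact hIG _ (mem_insert_of_mem hy) (hD2 h))
  have p2 := edge_end hE1 hγ1 (fun h => huR (hD1 h))
  have p234 := p2.append p34 (by
    rw [disjoint_left]
    intro y hy
    have hyΓ := hD1 hy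
    simp only [mem_insert, mem_erase, mem_union, not_or]
    refine ⟨?_, ?_, ?_, ?_⟩
    · rintro rfl; exact hD2D1 _ hγ2 hy
    · intro h; exact hIG _ (mem_insert_of_mem h) hyΓ
    · rintro rfl; exact huR' hyΓ
    · rintro ⟨_, h⟩; exact hD2D1 _ h hy)
  have heq : insert γ2 (D1 ∪ (I ∪ insert u' (D2.erase γ2))) = insert u' I ∪ (D1 ∪ D2) := by
    ext y
    by_cases hy : y = γ2
    · subst hy
      simp [hγ2]
    · simp only [mem_union, mem_insert, mem_erase, hy]
      tauto
  have hRG : ∀ y ∈ R, y ∉ Γ := fun y hy => disjoint_left.1 hRΓ hy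
  refine ⟨D1 ∪ D2, union_subset hD1 hD2, ?_, ?_, ?_⟩
  · refine (card_le_card inter_subset_left).trans ((card_union_le _ _).trans (by omega))
  · rw [disjoint_left]
    intro y hy
    rcases mem_union.1 hy with h | h
    · exact hD1C y h
    · exact hD2C y h
  · rw [← heq]
    apply stA_step hk hA h p234 _ _ (hR _ (hD1 hγ1)) (hR _ (hD2 hγ2)) hs
    · rw [heq, disjoint_left]
      intro y hy
      rcases mem_union.1 hy with h | h
      · exact disjoint_left.1 hIΓ h
      · rcases mem_union.1 h with h | h
        · exact hRG y (hD1 h)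
        · exact hRG y (hD2 h)
    · rw [heq, disjoint_left]
      intro y hy
      rcases mem_union.1 hy with h | h
      · exact disjoint_left.1 hIC h
      · rcases mem_union.1 h with h | h
        · exact hD1C y h
        · exact hD2C y h

/-- absorbing many good single vertices -/
theorem stA_goods {E : Set (Finset ℕ)} {k : ℕ} (hk : 2 ≤ k) {Γ R : Finset ℕ} {z K zr : ℕ}
    (hA : Absb E k Γ z K) (hRΓ : Disjoint R Γ) (hR : ∀ r ∈ R, Att E k Γ z r)
    {a : ℕ} {C : Finset ℕ} {s : ℕ} (h : StA E Γ a C s) (X : Finset ℕ) :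
    Disjoint X Γ → Disjoint X C → Disjoint X R → (∀ u ∈ X, Att E k R zr u) →
    s + X.card * (K + 2 * k) ≤ z → (C ∩ R).card + X.card * (2 * k) ≤ zr →
    ∃ R' ⊆ R, Disjoint R' C ∧ (R' ∩ R).card ≤ X.card * (2 * k) ∧
      StA E Γ a (C ∪ (X ∪ R')) (s + X.card * (K + 2 * k)) := by
  induction X using Finset.induction_on with
  | empty => intro _ _ _ _ _ _; exact ⟨∅, by simp, by simp, by simp, by simpa using h⟩
  | insert u X huX ih =>
    intro h1 h2 h3 h4 h5 h6
    rw [card_insert_of_notMem huX] at h5 h6 ⊢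
    have e5 : (X.card + 1) * (K + 2 * k) = X.card * (K + 2 * k) + (K + 2 * k) := by ring
    have e6 : (X.card + 1) * (2 * k) = X.card * (2 * k) + 2 * k := by ring
    obtain ⟨R', hR', hRC, hRc, hSt⟩ := ih (h1.mono_left (subset_insert _ _))
      (h2.mono_left (subset_insert _ _)) (h3.mono_left (subset_insert _ _))
      (fun u hu => h4 u (mem_insert_of_mem hu)) (by omega) (by omega)
    have hu1 : u ∉ Γ := disjoint_left.1 h1 (mem_insert_self _ _)
    have hu2 : u ∉ C := disjoint_left.1 h2 (mem_insert_self _ _)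
    have hu3 : u ∉ R := disjoint_left.1 h3 (mem_insert_self _ _)
    have hXR : ∀ y ∈ X, y ∉ R := fun y hy => disjoint_left.1 h3 (mem_insert_of_mem hy)
    obtain ⟨R'', hR'', hRc'', hRd, hSt''⟩ := stA_good hk hA hRΓ hR hSt (LP.nil u)
      (by simpa using hu1) (by
        simp only [insert_empty_eq, disjoint_singleton_left, mem_union, not_or]
        exact ⟨hu2, huX, fun h => hu3 (hR' h)⟩) (by simpa using hu3)
      (h4 u (mem_insert_self _ _)) (h4 u (mem_insert_self _ _)) (by omega) (by
        have : (C ∪ (X ∪ R')) ∩ R ⊆ (C ∩ R) ∪ (R' ∩ R) := by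
          intro y
          have := hXR y
          simp only [mem_inter, mem_union]
          tauto
        have := (card_le_card this).trans (card_union_le _ _)
        omega)
    refine ⟨R' ∪ R'', union_subset hR' hR'', ?_, ?_, ?_⟩
    · rw [disjoint_union_left]
      exact ⟨hRC, hRd.mono_right subset_union_left⟩
    · rw [union_inter_distrib_right]
      have := card_union_le (R' ∩ R) (R'' ∩ R)
      omega
    · rw [e5, ← add_assoc]
      convert hSt'' using 1
      ext y
      simp only [mem_union, mem_insert]
      tauto

/-- absorbing many directly attachable vertices -/
theorem stA_direct {E : Set (Finset ℕ)} {k : ℕ} (hk : 2 ≤ k) {Γ : Finset ℕ} {z K : ℕ}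
    (hA : Absb E k Γ z K)
    {a : ℕ} {C : Finset ℕ} {s : ℕ} (h : StA E Γ a C s) (X : Finset ℕ) :
    Disjoint X Γ → Disjoint X C → (∀ u ∈ X, Att E k Γ z u) →
    s + X.card * (K + 2 * k) ≤ z →
      StA E Γ a (C ∪ X) (s + X.card * (K + 2 * k)) := by
  induction X using Finset.induction_on with
  | empty => intro _ _ _ _; simpa using h
  | insert u X huX ih =>
    intro h1 h2 h4 h5
    rw [card_insert_of_notMem huX] at h5 ⊢
    have e5 : (X.card + 1) * (K + 2 * k) = X.card * (K + 2 * k) + (K + 2 * k) := by ring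
    have hSt := ih (h1.mono_left (subset_insert _ _))
      (h2.mono_left (subset_insert _ _))
      (fun u hu => h4 u (mem_insert_of_mem hu)) (by omega)
    have hu1 : u ∉ Γ := disjoint_left.1 h1 (mem_insert_self _ _)
    have hu2 : u ∉ C := disjoint_left.1 h2 (mem_insert_self _ _)
    have := stA_step hk hA hSt (LP.nil u)
      (by simpa using hu1) (by
        simp only [insert_empty_eq, disjoint_singleton_left, mem_union, not_or]
        exact ⟨hu2, huX⟩)
      (h4 u (mem_insert_self _ _)) (h4 u (mem_insert_self _ _)) (by omega)
    rw [e5, ← add_assoc]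
    convert this using 1
    ext y
    simp only [mem_union, mem_insert, notMem_empty, or_false]
    tauto

theorem stA_final {E : Set (Finset ℕ)} {k : ℕ} (hk : 2 ≤ k) (hE : ∀ e ∈ E, e.card = k)
    {Γ : Finset ℕ} {z K : ℕ} (hA : Absb E k Γ z K)
    {a b : ℕ} {C : Finset ℕ} {s : ℕ} (h : StA E Γ a C s) (hb : Att E k Γ z b)
    (hbΓ : b ∉ Γ) (hbC : b ∉ C) (hs : s + k ≤ z) (hdiv : (k - 1) ∣ (C ∪ Γ).card) :
    LP E a b (C ∪ Γ) := by
  obtain ⟨γ, hγ, S, hS, hSC, hSs⟩ := h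
  have hγS : γ ∉ S := hS.end_notMem
  have hbS : b ∉ S := fun h => hbC (hSC ▸ mem_sdiff.2 ⟨h, hbΓ⟩)
  obtain ⟨D1, hD1, hD1Z, hD1c, hE1⟩ := hb (insert γ (S ∩ Γ))
    ((card_insert_le _ _).trans (by omega))
  obtain ⟨γ1, hγ1⟩ : D1.Nonempty := card_pos.1 (by omega)
  have hD1S : ∀ y ∈ D1, y ∉ S := fun y hy hyS =>
    disjoint_left.1 hD1Z hy (mem_insert_of_mem (mem_inter.2 ⟨hyS, hD1 hy⟩))
  have hγD1 : γ ∉ D1 := fun h => disjoint_left.1 hD1Z h (mem_insert_self _ _)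
  set D := Γ \ (S ∪ D1) with hD
  have hun : S ∪ (D ∪ D1) = C ∪ Γ := by
    rw [← hSC]
    ext y
    have := @hD1 y
    simp only [hD, mem_union, mem_sdiff]
    tauto
  have hd1 : Disjoint D D1 := by
    rw [disjoint_left]; intro y hy h
    exact (mem_sdiff.1 hy).2 (mem_union_right _ h)
  have hd2 : Disjoint S (D ∪ D1) := by
    rw [disjoint_left]; intro y hy h
    rcases mem_union.1 h with h | h
    · exact (mem_sdiff.1 h).2 (mem_union_left _ hy)
    · exact hD1S y h hy
  have hcard : (k - 1) ∣ D.card := by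
    obtain ⟨l, hl⟩ := hS.card hE
    rw [← hun, card_union_of_disjoint hd2, card_union_of_disjoint hd1, hl, hD1c] at hdiv
    have h1 : (k - 1) ∣ D.card + (k - 1) := (Nat.dvd_add_right (Dvd.intro_left l rfl)).1 hdiv
    exact (Nat.dvd_add_left (dvd_refl _)).1 h1
  have hΓD : Γ \ D = (S ∩ Γ) ∪ D1 := by
    ext y
    have := @hD1 y
    simp only [hD, mem_union, mem_sdiff, mem_inter]
    tauto
  have p2 := hA.fin D sdiff_subset (by
      rw [hΓD]; exact (card_union_le _ _).trans (by omega)) γ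
    (mem_sdiff.2 ⟨hγ, by rw [mem_union]; tauto⟩) γ1 (by rw [hΓD]; exact mem_union_right _ hγ1) hcard
  have p3 := edge_end hE1 hγ1 (fun h => hbΓ (hD1 h))
  have p23 := p2.append p3 (by
    rw [disjoint_insert_right]
    exact ⟨fun h => hbΓ (sdiff_subset h), hd1⟩)
  have p := hS.append p23 (by
    rw [disjoint_insert_right]
    exact ⟨hbS, hd2⟩)
  rwa [hun] at p

theorem CS.conn {k p : ℕ} (hk : 2 ≤ k) (hp : 2 ≤ p) {E V τ} (h : CS k p E V τ) {y y' : ℕ}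
    (hy : y ∈ V) (hy' : y' ∈ V) (hE : ∀ e ∈ E, e.card = k) :
    ∃ M, _root_.WK E y y' M ∧ M.card ≤ 4 * (p * (k - 1)) ∧ M ≠ 0 := by
  have hk1 : 0 < k - 1 := by omega
  have hpk : 2 * (k - 1) ≤ p * (k - 1) := Nat.mul_le_mul_right _ hp
  rw [← h.img 0, mem_image] at hy
  obtain ⟨x, hx, rfl⟩ := hy
  rw [← h.img (p * (k - 1)), mem_image] at hy'
  obtain ⟨x', hx', rfl⟩ := hy'
  rw [mem_Ico] at hx hx'
  obtain ⟨a, ha⟩ : ∃ a, a = x / (k - 1) := ⟨_, rfl⟩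
  obtain ⟨a', ha'⟩ : ∃ a', a' = x' / (k - 1) := ⟨_, rfl⟩
  have e1 : a * (k - 1) ≤ x := by rw [ha]; exact Nat.div_mul_le_self _ _
  have e2 : x < (a + 1) * (k - 1) := by
    rw [ha, mul_comm]; exact Nat.lt_mul_div_succ _ hk1
  have e3 : a' * (k - 1) ≤ x' := by rw [ha']; exact Nat.div_mul_le_self _ _
  have e4 : x' < (a' + 1) * (k - 1) := by
    rw [ha', mul_comm]; exact Nat.lt_mul_div_succ _ hk1
  have e5 : (a + 1) * (k - 1) = a * (k - 1) + (k - 1) := by ring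
  have e6 : (a' + 1) * (k - 1) = a' * (k - 1) + (k - 1) := by ring
  have hap : a < p := by
    by_contra hc
    have := Nat.mul_le_mul_right (k - 1) (not_lt.1 hc)
    omega
  have hap' : p ≤ a' := by
    by_contra hc
    have := Nat.mul_le_mul_right (k - 1) (show a' + 1 ≤ p by omega)
    omega
  have hap'' : a' < 2 * p := by
    by_contra hc
    have := Nat.mul_le_mul_right (k - 1) (not_lt.1 hc)
    rw [mul_assoc] at this
    omega
  -- first step
  have hne : τ x ≠ τ ((a + 1) * (k - 1)) := by
    intro hc
    have := h.inj (a * (k - 1)) (show x ∈ Set.Ico _ _ from ⟨e1, by omega⟩)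
      (show (a + 1) * (k - 1) ∈ Set.Ico _ _ from ⟨by omega, by omega⟩) hc
    omega
  have w1 := _root_.WK.edge (h.edge a) (y := τ x) (w := τ ((a + 1) * (k - 1)))
    (mem_image_of_mem _ (mem_Ico.2 ⟨e1, by omega⟩))
    (mem_image_of_mem _ (mem_Ico.2 ⟨by omega, by omega⟩)) hne
  have c1 : ((((Ico (a * (k - 1)) ((a + 1) * (k - 1) + 1)).image τ).erase
      (τ ((a + 1) * (k - 1)))).val).card = k - 1 := by
    rw [card_val, card_erase_of_mem (mem_image_of_mem _ (mem_Ico.2 ⟨by omega, by omega⟩)),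
      hE _ (h.edge a)]
  have w2 := h.WK hk hp (a' - (a + 1)) (a + 1)
  have c2 : ((Ico ((a + 1) * (k - 1)) ((a + 1 + (a' - (a + 1))) * (k - 1))).val.map τ).card ≤
      2 * (p * (k - 1)) := by
    rw [Multiset.card_map, card_val, Nat.card_Ico]
    have := Nat.mul_le_mul_right (k - 1) (show a + 1 + (a' - (a + 1)) ≤ 2 * p by omega)
    rw [mul_assoc 2] at this
    omega
  have ea : a + 1 + (a' - (a + 1)) = a' := by omega
  rw [ea] at w2 c2
  have w12 := w1.append w2
  by_cases hxx : x' = a' * (k - 1)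
  · rw [hxx]
    refine ⟨_, w12, ?_, ?_⟩
    · rw [Multiset.card_add, c1]; omega
    · intro h0
      have := congrArg Multiset.card h0
      rw [Multiset.card_add, c1, Multiset.card_zero] at this
      omega
  · have hne' : τ (a' * (k - 1)) ≠ τ x' := by
      intro hc
      have := h.inj (a' * (k - 1)) (show a' * (k - 1) ∈ Set.Ico _ _ from ⟨le_rfl, by omega⟩)
        (show x' ∈ Set.Ico _ _ from ⟨by omega, by omega⟩) hc
      omega
    have m1 : τ x' ∈ (Ico (a' * (k - 1)) ((a' + 1) * (k - 1) + 1)).image τ :=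
      mem_image_of_mem _ (mem_Ico.2 ⟨by omega, by omega⟩)
    have w3 := _root_.WK.edge (h.edge a') (y := τ (a' * (k - 1))) (w := τ x')
      (mem_image_of_mem _ (mem_Ico.2 ⟨by omega, by omega⟩)) m1 hne'
    have c3 : (((Ico (a' * (k - 1)) ((a' + 1) * (k - 1) + 1)).image τ).erase (τ x')).val.card
        = k - 1 := by
      rw [card_val, card_erase_of_mem m1, hE _ (h.edge a')]
    refine ⟨_, w12.append w3, ?_, ?_⟩
    · rw [Multiset.card_add, Multiset.card_add, c1, c3]; omega
    · intro h0
      have := congrArg Multiset.card h0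
      rw [Multiset.card_add, Multiset.card_add, c1, Multiset.card_zero] at this
      omega

theorem WK.supp {F : Set (Finset ℕ)} {R : Finset ℕ} (hF : ∀ e ∈ F, e ⊆ R) {y z : ℕ}
    {M : Multiset ℕ} (h : WK F y z M) : ∀ i ∈ M, i ∈ R := by
  induction h with
  | nil y => simp
  | cons he hy hw hyw h ih =>
    intro i hi
    rcases Multiset.mem_add.1 hi with h1 | h1
    · exact hF _ he (mem_of_mem_erase h1)
    · exact ih i h1

theorem visit {F : Set (Finset ℕ)} {R : Finset ℕ} {c : ℕ}
    (hc : ∀ y ∈ R, ∀ y' ∈ R, ∃ M, WK F y y' M ∧ M.card ≤ c) (X : Finset ℕ) :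
    ∀ y ∈ R, ∀ y' ∈ R, X ⊆ R → ∃ M0 : Multiset ℕ, M0.card ≤ (X.card + 1) * c ∧
      ∀ C : ℕ → Multiset ℕ, (∀ z ∈ X, WK F z z (C z)) → WK F y y' (M0 + ∑ z ∈ X, C z) := by
  induction X using Finset.induction_on with
  | empty =>
    intro y hy y' hy' _
    obtain ⟨M, hM, hMc⟩ := hc y hy y' hy'
    exact ⟨M, by simpa using hMc, fun C _ => by simpa using hM⟩
  | insert x X hx ih =>
    intro y hy y' hy' hX
    have hxR : x ∈ R := hX (mem_insert_self _ _)
    obtain ⟨M, hM, hMc⟩ := hc y hy x hxR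
    obtain ⟨M0, hM0c, hM0⟩ := ih x hxR y' hy' ((subset_insert _ _).trans hX)
    refine ⟨M + M0, ?_, ?_⟩
    · rw [Multiset.card_add, card_insert_of_notMem hx]
      have : (X.card + 1 + 1) * c = (X.card + 1) * c + c := by ring
      omega
    · intro C hC
      rw [sum_insert hx]
      have w1 := (hM.append (hC x (mem_insert_self _ _))).append
        (hM0 C fun z hz => hC z (mem_insert_of_mem hz))
      convert w1 using 1
      abel

theorem hubs {F : Set (Finset ℕ)} {R : Finset ℕ} (L : List (Finset ℕ))
    (hL : ∀ Y ∈ L, ∃ z ∈ R, WK F z z Y.val) :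
    ∃ C : ℕ → Multiset ℕ, (∀ z ∈ R, WK F z z (C z)) ∧
      ∑ z ∈ R, C z = (L.map Finset.val).sum := by
  induction L with
  | nil => exact ⟨fun _ => 0, fun z _ => WK.nil z, by simp⟩
  | cons Y L ih =>
    obtain ⟨C, hC, hs⟩ := ih (fun Y hY => hL Y (List.mem_cons_of_mem _ hY))
    obtain ⟨z, hz, hw⟩ := hL Y (by simp)
    refine ⟨fun x => (if x = z then Y.val else 0) + C x, ?_, ?_⟩
    · intro x hx
      by_cases hxz : x = z
      · subst hxz; simpa using hw.append (hC x hx)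
      · simpa [hxz] using hC x hx
    · rw [sum_add_distrib, hs]
      simp [hz]

theorem deco (R : Finset ℕ) (r : ℕ) (p : ℕ) : ∀ d : ℕ → ℕ, (∀ i ∈ R, d i ≤ p) →
    ∑ i ∈ R, d i = r * p → ∃ Ds : List (Finset ℕ), Ds.length = p ∧
      (∀ D ∈ Ds, D ⊆ R ∧ D.card = r) ∧
      ∀ i ∈ R, (Ds.map Finset.val).sum.count i = d i := by
  induction p with
  | zero =>
    intro d hd _
    exact ⟨[], rfl, by simp, fun i hi => by have := hd i hi; simp; omega⟩
  | succ p ih =>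
    intro d hd hs
    have hA : (R.filter fun i => d i = p + 1).card ≤ r := by
      have h1 : (R.filter fun i => d i = p + 1).card * (p + 1) ≤ ∑ i ∈ R, d i := by
        calc _ = ∑ i ∈ R.filter (fun i => d i = p + 1), d i := by
              rw [sum_congr rfl (g := fun _ => p + 1) (fun i hi => (mem_filter.1 hi).2)]; simp
          _ ≤ _ := sum_le_sum_of_subset (filter_subset _ _)
      rw [hs] at h1
      exact Nat.le_of_mul_le_mul_right h1 (by omega)
    have hB : r ≤ (R.filter fun i => 0 < d i).card := by
      have h1 : ∑ i ∈ R, d i ≤ (R.filter fun i => 0 < d i).card * (p + 1) := by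
        calc ∑ i ∈ R, d i = ∑ i ∈ R.filter (fun i => 0 < d i), d i := by
              rw [sum_filter]
              exact sum_congr rfl fun i _ => by split_ifs <;> omega
          _ ≤ _ := by
              refine (sum_le_card_nsmul _ _ (p + 1) fun i hi => hd i (mem_filter.1 hi).1).trans ?_
              rw [smul_eq_mul]
      rw [hs] at h1
      exact Nat.le_of_mul_le_mul_right h1 (by omega)
    obtain ⟨D, hAD, hDB, hDr⟩ := exists_subsuperset_card_eq
      (s := R.filter fun i => d i = p + 1) (t := R.filter fun i => 0 < d i)
      (fun i hi => by rw [mem_filter] at hi ⊢; exact ⟨hi.1, by omega⟩) hA hB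
    have hDR : D ⊆ R := hDB.trans (filter_subset _ _)
    have hDpos : ∀ i ∈ D, 0 < d i := fun i hi => (mem_filter.1 (hDB hi)).2
    obtain ⟨Ds, hl, hD, hc⟩ := ih (fun i => d i - if i ∈ D then 1 else 0) (by
      intro i hi
      have := hd i hi
      by_cases hiD : i ∈ D
      · simp only [hiD, if_true]; omega
      · have : d i ≠ p + 1 := fun h => hiD (hAD (mem_filter.2 ⟨hi, h⟩))
        simp only [hiD, if_false]; omega) (by
      have h1 : ∑ i ∈ R, (d i - if i ∈ D then 1 else 0) + ∑ i ∈ R, (if i ∈ D then 1 else 0) =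
          ∑ i ∈ R, d i := by
        rw [← sum_add_distrib]
        refine sum_congr rfl fun i _ => ?_
        by_cases hiD : i ∈ D
        · have := hDpos i hiD
          simp only [hiD, if_true]; omega
        · simp [hiD]
      have h2 : ∑ i ∈ R, (if i ∈ D then 1 else 0) = r := by
        rw [sum_ite_mem, inter_eq_right.2 hDR]; simp [hDr]
      rw [h2, hs] at h1
      have : r * (p + 1) = r * p + r := by ring
      omega)
    refine ⟨D :: Ds, by simp [hl], ?_, ?_⟩
    · intro D' hD'
      rcases List.mem_cons.1 hD' with rfl | h
      · exact ⟨hDR, hDr⟩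
      · exact hD _ h
    · intro i hi
      rw [List.map_cons, List.sum_cons, Multiset.count_add, hc i hi]
      by_cases hiD : i ∈ D
      · have := hDpos i hiD
        rw [Multiset.count_eq_one_of_mem D.nodup hiD]
        simp only [hiD, if_true]; omega
      · rw [Multiset.count_eq_zero_of_notMem hiD]
        simp [hiD]

theorem compl_count (R : Finset ℕ) (Ds : List (Finset ℕ)) (i : ℕ) (hi : i ∈ R) :
    ((Ds.map (fun D => R \ D)).map Finset.val).sum.count i + (Ds.map Finset.val).sum.count i
      = Ds.length := by
  induction Ds with
  | nil => simp
  | cons D Ds ih =>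
    simp only [List.map_cons, List.sum_cons, Multiset.count_add, List.length_cons]
    have : (R \ D).val.count i + D.val.count i = 1 := by
      by_cases hiD : i ∈ D
      · rw [Multiset.count_eq_one_of_mem D.nodup hiD, Multiset.count_eq_zero_of_notMem]
        rw [mem_val, mem_sdiff]; tauto
      · rw [Multiset.count_eq_zero_of_notMem hiD, Multiset.count_eq_one_of_mem (nodup _)]
        rw [mem_val, mem_sdiff]; tauto
    omega

/-- admissible pattern -/
structure Pat (k N : ℕ) (F : Set (Finset ℕ)) : Prop where
  hk : 2 ≤ k
  dvd : (k - 1) ∣ N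
  big : 2 * (k - 1) ≤ N
  sub : ∀ e ∈ F, e ⊆ range N
  card : ∀ e ∈ F, e.card = k
  full : ∃ p τ, 2 ≤ p ∧ CS k p F (range N) τ
  del : ∀ D ⊆ range N, D.card = k - 1 → ∃ p τ, 2 ≤ p ∧ CS k p F (range N \ D) τ

theorem Pat.conn {k N : ℕ} {F : Set (Finset ℕ)} (h : Pat k N F) {y y' : ℕ}
    (hy : y ∈ range N) (hy' : y' ∈ range N) : ∃ M, WK F y y' M ∧ M.card ≤ 4 * N ∧ M ≠ 0 := by
  obtain ⟨p, τ, hp, hc⟩ := h.full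
  obtain ⟨M, h1, h2, h3⟩ := hc.conn h.hk hp hy hy' h.card
  refine ⟨M, h1, ?_, h3⟩
  have : N = p * (k - 1) := by
    have e1 := congrArg Finset.card (hc.img 0)
    rw [card_image_of_injOn (by rw [coe_Ico]; exact hc.inj 0), Nat.card_Ico, card_range] at e1
    omega
  rw [this]; exact h2

theorem CS.hub {k p : ℕ} (hk : 2 ≤ k) (hp : 2 ≤ p) {E V τ} (h : CS k p E V τ) :
    ∃ z ∈ V, _root_.WK E z z V.val := by
  refine ⟨_, ?_, h.closed hk hp 0⟩
  rw [← h.img 0]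
  apply mem_image_of_mem
  rw [mem_Ico]
  have : 0 < p * (k - 1) := Nat.mul_pos (by omega) (by omega)
  omega

theorem Pat.finM {k N : ℕ} {F : Set (Finset ℕ)} (h : Pat k N F) (z g : ℕ)
    (hg : 2 * (z + (N + 1) * (4 * N)) * N ≤ g) {y y' : ℕ}
    (hy : y ∈ range N) (hy' : y' ∈ range N) (Ω : Multiset ℕ) (hΩ : ∀ i ∈ Ω, i ∈ range N)
    (h1 : ∀ i ∈ range N, Ω.count i ≤ g) (h2 : ∀ i ∈ range N, g ≤ Ω.count i + z)
    (hd : (k - 1) ∣ Ω.card) : WK F y y' Ω := by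
  have hk1 : 0 < k - 1 := by have := h.hk; omega
  obtain ⟨M0, hM0c, hM0⟩ := visit (F := F) (R := range N) (c := 4 * N)
    (fun y hy y' hy' => by obtain ⟨M, a, b, _⟩ := h.conn hy hy'; exact ⟨M, a, b⟩)
    (range N) y hy y' hy' (Subset.refl _)
  rw [card_range] at hM0c
  set K := z + (N + 1) * (4 * N) with hK
  have hM0w : WK F y y' M0 := by simpa using hM0 (fun _ => 0) fun z _ => WK.nil z
  have hM0d := hM0w.card h.card
  have hM0s := hM0w.supp h.sub
  obtain ⟨q, hq⟩ : ∃ q, q = g + K := ⟨_, rfl⟩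
  have hM0i : ∀ i, M0.count i ≤ (N + 1) * (4 * N) := fun i =>
    (Multiset.count_le_card _ _).trans hM0c
  obtain ⟨d, hdd⟩ : ∃ d : ℕ → ℕ, ∀ i, d i = q + M0.count i - Ω.count i := ⟨_, fun _ => rfl⟩
  have hd1 : ∀ i ∈ range N, d i ≤ 2 * K := by
    intro i hi; have := h2 i hi; have := hM0i i; rw [hdd]; omega
  have hd2 : ∀ i ∈ range N, K ≤ d i := by
    intro i hi; have := h1 i hi; rw [hdd]; omega
  have hsum : ∑ i ∈ range N, d i + Ω.card = N * q + M0.card := by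
    have e1 : ∑ i ∈ range N, Ω.count i = Ω.card := by
      rw [Multiset.sum_count_eq_card hΩ]
    have e2 : ∑ i ∈ range N, M0.count i = M0.card := by
      rw [Multiset.sum_count_eq_card hM0s]
    rw [← e1, ← e2, ← sum_add_distrib]
    have : N * q = ∑ i ∈ range N, q := by simp
    rw [this, ← sum_add_distrib]
    refine sum_congr rfl fun i hi => ?_
    have := h1 i hi
    rw [hdd]; omega
  have hdiv : (k - 1) ∣ ∑ i ∈ range N, d i := by
    have : (k - 1) ∣ ∑ i ∈ range N, d i + Ω.card := by
      rw [hsum]; exact dvd_add (h.dvd.mul_right _) hM0d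
    exact (Nat.dvd_add_left hd).1 this
  obtain ⟨p, hp⟩ := hdiv
  have hp1 : 2 * K ≤ p := by
    have : (k - 1) * (2 * K) ≤ (k - 1) * p := by
      rw [← hp]
      calc (k - 1) * (2 * K) = 2 * (k - 1) * K := by ring
        _ ≤ N * K := Nat.mul_le_mul_right _ h.big
        _ = ∑ i ∈ range N, K := by simp
        _ ≤ _ := sum_le_sum hd2
    exact Nat.le_of_mul_le_mul_left this hk1
  have hp2 : p ≤ q := by
    have : p ≤ (k - 1) * p := Nat.le_mul_of_pos_left _ hk1
    rw [← hp] at this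
    have h3 : ∑ i ∈ range N, d i ≤ ∑ i ∈ range N, 2 * K := sum_le_sum hd1
    have h4 : ∑ i ∈ range N, 2 * K = 2 * K * N := by simp; ring
    omega
  obtain ⟨Ds, hl, hD, hc⟩ := deco (range N) (k - 1) p d (fun i hi => (hd1 i hi).trans hp1) hp
  obtain ⟨C, hC, hCs⟩ := hubs (F := F) (R := range N)
    (Ds.map (fun D => range N \ D) ++ List.replicate (q - p) (range N)) (by
      intro Y hY
      rcases List.mem_append.1 hY with hY | hY
      · obtain ⟨D, hD', rfl⟩ := List.mem_map.1 hY
        obtain ⟨p, τ, hp, hcs⟩ := h.del D (hD D hD').1 (hD D hD').2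
        obtain ⟨z, hz, hw⟩ := hcs.hub h.hk hp
        exact ⟨z, sdiff_subset hz, hw⟩
      · rw [List.eq_of_mem_replicate hY]
        obtain ⟨p, τ, hp, hcs⟩ := h.full
        exact hcs.hub h.hk hp)
  have := hM0 C hC
  rw [hCs] at this
  convert this using 1
  ext i
  rw [List.map_append, List.sum_append, Multiset.count_add, Multiset.count_add]
  by_cases hi : i ∈ range N
  · have e1 := compl_count (range N) Ds i hi
    rw [hc i hi, hl] at e1
    have e2 : ((List.replicate (q - p) (range N)).map Finset.val).sum.count i = q - p := by
      rw [List.map_replicate, List.sum_replicate, Multiset.count_nsmul,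
        Multiset.count_eq_one_of_mem (nodup _) hi, mul_one]
    rw [e2]
    have := hdd i
    have := h1 i hi
    have := hd1 i hi
    omega
  · have z1 : Ω.count i = 0 := Multiset.count_eq_zero_of_notMem fun h => hi (hΩ i h)
    have z2 : M0.count i = 0 := Multiset.count_eq_zero_of_notMem fun h => hi (hM0s i h)
    rw [z1, z2]
    have w := this.supp h.sub
    have : i ∉ M0 + ((Ds.map (fun D => range N \ D) ++
      List.replicate (q - p) (range N)).map Finset.val).sum := fun h => hi (w i h)
    have := Multiset.count_eq_zero_of_notMem this
    rw [List.map_append, List.sum_append, Multiset.count_add, Multiset.count_add] at this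
    omega

theorem Pat.absb {k N : ℕ} {F : Set (Finset ℕ)} (h : Pat k N F) (z g : ℕ)
    (hg : 2 * (z + (N + 1) * (4 * N)) * N ≤ g) (hg2 : 4 * N + z + 2 ≤ g)
    {E : Set (Finset ℕ)} {Γ : Finset ℕ} {p : ℕ → ℕ} (hp : ∀ x ∈ Γ, p x ∈ range N)
    (hf : ∀ i ∈ range N, (Γ.filter fun x => p x = i).card = g)
    (hlift : ∀ e ⊆ Γ, Set.InjOn p e → e.image p ∈ F → e ∈ E) : Absb E k Γ z (4 * N) := by
  constructor
  · intro γ hγ γ' hγ' hne Z hZ hγZ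
    obtain ⟨M, hM, hMc, hM0⟩ := h.conn (hp γ hγ) (hp γ' hγ')
    have hγM : p γ ∈ M := by
      rcases hM.start_mem with h | h
      · exact absurd h.1 hM0
      · exact h
    obtain ⟨D, hD, hDM⟩ := exists_realise (p := p) (Γ := Γ \ insert γ' (insert γ Z))
      (M.erase (p γ)) (by
        intro i hi
        have hiM := Multiset.mem_of_mem_erase hi
        have := hf i (hM.supp h.sub i hiM)
        have h1 : (M.erase (p γ)).card ≤ M.card := Multiset.card_le_card (Multiset.erase_le _ _)
        have h2 : (Γ.filter fun x => p x = i) ⊆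
            ((Γ \ insert γ' (insert γ Z)).filter fun x => p x = i) ∪ insert γ' (insert γ Z) := by
          intro x hx
          rw [mem_filter] at hx
          rw [mem_union, mem_filter, mem_sdiff]
          tauto
        have h3 := (card_le_card h2).trans (card_union_le _ _)
        have h4 : (insert γ' (insert γ Z)).card ≤ z + 2 :=
          (card_insert_le _ _).trans (by have := card_insert_le γ Z; omega)
        omega)
    have hDn : ∀ x ∈ D, x ∈ Γ ∧ x ≠ γ' ∧ x ≠ γ ∧ x ∉ Z := by
      intro x hx
      have := hD hx
      simp only [mem_sdiff, mem_insert, not_or] at this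
      exact ⟨this.1, this.2.1, this.2.2.1, this.2.2.2⟩
    have hγD : γ ∉ D := fun h => (hDn γ h).2.2.1 rfl
    have hmap : (insert γ D).val.map p = M := by
      rw [insert_val_of_notMem hγD, Multiset.map_cons, hDM, Multiset.cons_erase hγM]
    have hsub : insert γ D ⊆ Γ := by
      intro x hx
      rcases mem_insert.1 hx with rfl | h
      · exact hγ
      · exact (hDn x h).1
    have hγ'D : γ' ∉ insert γ D := by
      rw [mem_insert, not_or]
      exact ⟨hne.symm, fun h => (hDn _ h).2.1 rfl⟩
    refine ⟨insert γ D, hsub, mem_insert_self _ _, hγ'D, ?_, ?_, ?_⟩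
    · rw [disjoint_insert_left]
      exact ⟨hγZ, disjoint_left.2 fun x hx => (hDn x hx).2.2.2⟩
    · rw [← card_val, ← Multiset.card_map p, hmap]; exact hMc
    · refine hM.lift hlift γ γ' _ ?_ rfl rfl hγ'D hmap (Or.inl (mem_insert_self _ _))
      intro x hx
      rcases mem_insert.1 hx with rfl | h
      · exact hγ'
      · exact hsub h
  · intro D hD hDz γ hγ v hv hdiv
    rw [mem_sdiff] at hv
    have hcnt : ∀ i, (D.val.map p).count i = (D.filter fun x => p x = i).card := by
      intro i
      rw [Multiset.count_map]
      simp only [eq_comm (a := i)]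
      rfl
    have w : WK F (p γ) (p v) (D.val.map p) := by
      refine h.finM z g hg (hp γ (hD hγ)) (hp v hv.1) _ ?_ ?_ ?_ ?_
      · intro i hi
        obtain ⟨x, hx, rfl⟩ := Multiset.mem_map.1 hi
        exact hp x (hD hx)
      · intro i hi
        rw [hcnt, ← hf i hi]
        exact card_le_card (filter_subset_filter _ hD)
      · intro i hi
        rw [hcnt, ← hf i hi]
        have h2 : (Γ.filter fun x => p x = i) ⊆ (D.filter fun x => p x = i) ∪ (Γ \ D) := by
          intro x hx
          rw [mem_filter] at hx
          rw [mem_union, mem_filter, mem_sdiff]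
          tauto
        have h3 := (card_le_card h2).trans (card_union_le _ _)
        omega
      · simpa using hdiv
    refine w.lift hlift γ v D ?_ rfl rfl hv.2 rfl (Or.inl hγ)
    intro x hx
    rcases mem_insert.1 hx with rfl | h
    · exact hv.1
    · exact hD h

theorem att_of {k N : ℕ} (z g : ℕ) (hg2 : k + z ≤ g)
    {E : Set (Finset ℕ)} {Γ : Finset ℕ} {p : ℕ → ℕ} 
    (hf : ∀ i ∈ range N, (Γ.filter fun x => p x = i).card = g) {u : ℕ} {T : Finset ℕ}
    (hT : T ⊆ range N) (hTc : T.card = k - 1)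
    (hlift : ∀ D ⊆ Γ, Set.InjOn p D → D.image p = T → insert u D ∈ E) : Att E k Γ z u := by
  intro Z hZ
  obtain ⟨D, hD, hDM⟩ := exists_realise (p := p) (Γ := Γ \ Z) T.val (by
    intro i hi
    have := hf i (hT hi)
    have h2 : (Γ.filter fun x => p x = i) ⊆ ((Γ \ Z).filter fun x => p x = i) ∪ Z := by
      intro x hx
      rw [mem_filter] at hx
      rw [mem_union, mem_filter, mem_sdiff]
      tauto
    have h3 := (card_le_card h2).trans (card_union_le _ _)
    rw [card_val]
    omega)
  have hDΓ : D ⊆ Γ := hD.trans sdiff_subset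
  refine ⟨D, hDΓ, disjoint_left.2 fun x hx => (mem_sdiff.1 (hD hx)).2, ?_, ?_⟩
  · rw [← hTc, ← card_val, ← card_val, ← hDM, Multiset.card_map]
  · apply hlift D hDΓ
    · intro x hx y hy hxy
      exact Multiset.inj_on_of_nodup_map (hDM ▸ T.nodup) x hx y hy hxy
    · ext i
      rw [mem_image, ← mem_val (s := T), ← hDM, Multiset.mem_map]
      rfl

theorem desc_ge (M s : ℕ) (h : 2 * s ^ 2 ≤ M) : M ^ s ≤ 2 * M.descFactorial s := by
  rcases Nat.eq_zero_or_pos s with rfl | hs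
  · simp
  have hM : 0 < M := lt_of_lt_of_le (by positivity) h
  have hsM : s ≤ M := by nlinarith
  have h1 := Nat.pow_sub_le_descFactorial M s
  have h2 : ((M : ℝ) - s) ^ s ≤ M.descFactorial s := by
    have h3 : ((M - s : ℕ) : ℝ) ^ s ≤ M.descFactorial s := by
      refine le_trans ?_ (Nat.cast_le.2 h1)
      push_cast
      gcongr
      omega
    rwa [Nat.cast_sub hsM] at h3
  have hM' : (0 : ℝ) < M := by exact_mod_cast hM
  have h' : 2 * (s : ℝ) ^ 2 ≤ M := by exact_mod_cast h
  have hsM' : (s : ℝ) ≤ M := by exact_mod_cast hsM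
  have h4 : (1 : ℝ) / 2 ≤ (1 + (-(s / M : ℝ))) ^ s := by
    have hle : (s : ℝ) / M ≤ 1 := (div_le_one hM').2 hsM'
    refine le_trans ?_ (one_add_mul_le_pow (by linarith) s)
    have : (s : ℝ) * (s / M) ≤ 1 / 2 := by
      rw [← mul_div_assoc, div_le_iff₀ hM']; nlinarith
    nlinarith
  have h5 : ((M : ℝ) - s) ^ s = M ^ s * (1 + (-(s / M : ℝ))) ^ s := by
    rw [← mul_pow]; congr 1; field_simp; ring
  have h6 : (M : ℝ) ^ s ≤ 2 * M.descFactorial s := by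
    have : (M : ℝ) ^ s * (1 / 2) ≤ M ^ s * (1 + (-(s / M : ℝ))) ^ s := by gcongr
    linarith
  exact_mod_cast h6

theorem inj_card (N : ℕ) (W : Finset ℕ) (h : 2 * N ^ 2 ≤ W.card) :
    W.card ^ N ≤ 2 * (univ.filter fun x : Fin N → W => Function.Injective x).card := by
  have h1 : (univ.filter fun x : Fin N → W => Function.Injective x).card =
      W.card.descFactorial N := by
    rw [← Fintype.card_subtype,
      Fintype.card_congr (Equiv.subtypeInjectiveEquivEmbedding (Fin N) W),
      Fintype.card_embedding_eq]
    simp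
  rw [h1]
  exact desc_ge _ _ h

theorem att_edge {k j : ℕ} (hj : 1 ≤ j) {G : HGraph k} {u : ℕ} {M : Finset ℕ} {d : ℝ} (hd : 0 < d)
    (h : G.MinDegOnGe j (insert u M) d) (hM : j ≤ M.card) (hu : u ∉ M) :
    ∃ D ⊆ M, D.card = k - 1 ∧ insert u D ∈ G.edges := by
  obtain ⟨T, hT, hTc⟩ := exists_subset_card_eq (show j - 1 ≤ M.card by omega)
  have h1 := h (insert u T) (insert_subset_insert _ hT) (by
    rw [card_insert_of_notMem (fun h => hu (hT h)), hTc]; omega)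
  have h2 : 0 < (((G.inducedEdges (insert u M)).filter fun e => insert u T ⊆ e).card : ℝ) := by
    linarith
  obtain ⟨e, he⟩ := card_pos.1 (Nat.cast_pos.1 h2)
  obtain ⟨he, hTe⟩ := mem_filter.1 he
  obtain ⟨he, heM⟩ := mem_filter.1 he
  have hue : u ∈ e := hTe (mem_insert_self _ _)
  refine ⟨e.erase u, ?_, ?_, ?_⟩
  · intro y hy
    rw [mem_erase] at hy
    exact (mem_insert.1 (heM hy.2)).resolve_left hy.1
  · rw [card_erase_of_mem hue, G.edge_card e he]
  · rwa [insert_erase hue]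

theorem degIn_big {k j : ℕ} (hjk : j < k) (α β : ℝ) (hβ : 0 ≤ β) (hαβ : β < α) (x0 : ℕ) :
    ∃ n0 : ℕ, ∀ G : HGraph k, n0 ≤ G.verts.card →
      G.MinDegGe j (α * (G.verts.card : ℝ) ^ (k - j)) → ∀ X : Finset ℕ, X.card ≤ x0 →
      ∀ Q ⊆ G.verts, Q.card = j →
      β * ((G.verts \ X).card : ℝ) ^ (k - j) ≤ G.degIn Q (G.verts \ X) := by
  obtain ⟨n0, h0⟩ := asym α β x0 0 0 (k - j) (by omega) hαβ
  refine ⟨n0, fun G hn hdeg X hX Q hQ hQc => ?_⟩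
  have h1 := degIn_ge G Q X (by omega)
  have h2 := h0 _ hn
  rw [add_zero, sub_zero] at h2
  have h3 := hdeg Q hQ hQc
  have h4 : ((G.verts \ X).card : ℝ) ≤ G.verts.card := by
    exact_mod_cast card_le_card sdiff_subset
  have h5 : β * ((G.verts \ X).card : ℝ) ^ (k - j) ≤ β * (G.verts.card : ℝ) ^ (k - j) := by
    gcongr
  have h6 : (X.card : ℝ) * (G.verts.card : ℝ) ^ (k - j - 1) ≤
      x0 * (G.verts.card : ℝ) ^ (k - j - 1) := by
    have : (X.card : ℝ) ≤ x0 := by exact_mod_cast hX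
    gcongr
  rw [hQc] at h1
  linarith

theorem reservoir {k j : ℕ} (hj : 1 ≤ j) (hjk : j < k) (ε η : ℝ) (hε : 0 < ε) (hη : 0 < η)
    (zr x0 : ℕ) : ∃ N n0 : ℕ, ∀ G : HGraph k, n0 ≤ G.verts.card →
      G.MinDegGe j (ε * (G.verts.card : ℝ) ^ (k - j)) → ∀ P : Finset ℕ, P.card ≤ x0 →
      ∃ R ⊆ G.verts \ P, R.card = N ∧
        (((G.verts \ R).filter fun u => ¬ Att {e | e ∈ G.edges} k R zr u).card : ℝ) ≤
          η * G.verts.card := by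
  obtain ⟨e', he', he1, hee⟩ : ∃ e' : ℝ, 0 < e' ∧ e' ≤ 1 ∧ e' ≤ ε :=
    ⟨min ε 1, lt_min hε one_pos, min_le_right _ _, min_le_left _ _⟩
  obtain ⟨c, hc, N0, hN0⟩ := sampling hjk (e' / 4) (e' / 4) (by positivity) (by positivity)
    (by linarith) 1
  obtain ⟨N1, hN1⟩ := asym (e' / 4) (e' / 8) zr 0 1 (k - j) (by omega) (by linarith)
  obtain ⟨n1, hn1⟩ := degIn_big hjk ε (e' / 4 + e' / 4) (by positivity) (by linarith) x0
  obtain ⟨N2, hN2⟩ : ∃ N2 : ℕ, ∀ N : ℕ, N2 ≤ N → 2 * Real.exp (-(c * N)) ≤ η := by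
    obtain ⟨N2, hN2⟩ := exists_nat_gt (-(Real.log (η / 2)) / c)
    refine ⟨N2, fun N hN => ?_⟩
    have h1 : -(c * N) ≤ Real.log (η / 2) := by
      rw [div_lt_iff₀ hc] at hN2
      have : (N2 : ℝ) ≤ N := by exact_mod_cast hN
      nlinarith
    have := (Real.exp_le_exp.2 h1)
    rw [Real.exp_log (by positivity)] at this
    linarith
  obtain ⟨N, hNdef⟩ : ∃ N, N = N0 + N1 + N2 + j + zr := ⟨_, rfl⟩
  refine ⟨N, n1 + 2 * N ^ 2 + x0 + 1, fun G hn hdeg P hP => ?_⟩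
  set W := G.verts \ P with hW
  have hWc : G.verts.card ≤ W.card + x0 := by
    have := le_card_sdiff P G.verts; rw [hW]; omega
  have hWne : W.Nonempty := card_pos.1 (by omega)
  have hWs : W ⊆ G.verts := sdiff_subset
  have hs := hN0 N (by omega) G W hWne hWs (hn1 G (by omega) hdeg P hP)
  have hinj := inj_card N W (by omega)
  set I := univ.filter fun x : Fin N → W => Function.Injective x with hI
  -- double counting
  have hdc : ∑ x ∈ I, ((G.verts.filter fun u =>
      x ∈ badS G j N W {u} (e' / 4 * (N : ℝ) ^ (k - j))).card : ℝ) ≤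
      ∑ x ∈ I, η * G.verts.card := by
    have e1 : ∑ x ∈ I, (G.verts.filter fun u =>
        x ∈ badS G j N W {u} (e' / 4 * (N : ℝ) ^ (k - j))).card ≤
        ∑ u ∈ G.verts, (badS G j N W {u} (e' / 4 * (N : ℝ) ^ (k - j))).card := by
      simp only [card_filter]
      rw [sum_comm]
      refine sum_le_sum fun u _ => ?_
      rw [← card_filter]
      exact card_le_card fun x hx => (mem_filter.1 hx).2
    have e2 : ∑ u ∈ G.verts, ((badS G j N W {u} (e' / 4 * (N : ℝ) ^ (k - j))).card : ℝ) ≤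
        ∑ u ∈ G.verts, Real.exp (-(c * N)) * (W.card : ℝ) ^ N :=
      sum_le_sum fun u hu => hs {u} (by simpa using hu) (by simp)
    rw [sum_const, nsmul_eq_mul] at e2
    rw [sum_const, nsmul_eq_mul]
    have e3 : ((W.card : ℝ)) ^ N ≤ 2 * I.card := by exact_mod_cast hinj
    have e4 := hN2 N (by omega)
    have e1' : ∑ x ∈ I, ((G.verts.filter fun u =>
        x ∈ badS G j N W {u} (e' / 4 * (N : ℝ) ^ (k - j))).card : ℝ) ≤
        ∑ u ∈ G.verts, ((badS G j N W {u} (e' / 4 * (N : ℝ) ^ (k - j))).card : ℝ) := by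
      exact_mod_cast e1
    refine e1'.trans (e2.trans ?_)
    calc (G.verts.card : ℝ) * (Real.exp (-(c * N)) * (W.card : ℝ) ^ N)
        ≤ G.verts.card * (Real.exp (-(c * N)) * (2 * I.card)) := by gcongr
      _ = (I.card * G.verts.card) * (2 * Real.exp (-(c * N))) := by ring
      _ ≤ (I.card * G.verts.card) * η := by gcongr
      _ = _ := by ring
  have hIne : I.Nonempty := by
    apply card_pos.1
    have : 0 < W.card ^ N := Nat.pow_pos (card_pos.2 hWne)
    omega
  obtain ⟨x, hxI, hx⟩ := exists_le_of_sum_le hIne hdc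
  have hxinj : Function.Injective x := (mem_filter.1 hxI).2
  set R := univ.image (fun i => (x i : ℕ)) with hR
  have hRc : R.card = N := by
    rw [hR, card_image_of_injective _ (show Function.Injective (fun i => ((x i : W) : ℕ)) from
      fun a b h => hxinj (Subtype.ext h))]; simp
  refine ⟨R, ?_, hRc, ?_⟩
  · intro y hy
    obtain ⟨i, -, rfl⟩ := mem_image.1 hy
    exact (x i).2
  refine le_trans ?_ hx
  apply Nat.cast_le.2
  apply card_le_card
  intro u hu
  obtain ⟨hu, hatt⟩ := mem_filter.1 hu
  obtain ⟨huv, huR⟩ := mem_sdiff.1 hu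
  refine mem_filter.2 ⟨huv, mem_filter.2 ⟨mem_univ _, hxinj, ?_, ?_⟩⟩
  · intro i hi
    rw [mem_singleton] at hi
    exact huR (hi ▸ mem_image_of_mem _ (mem_univ i))
  · intro hmd
    apply hatt
    intro Z hZ
    rw [← insert_eq] at hmd
    have h1 := MinDegOn_del hjk G _ (Z.erase u) _ hmd
    have h2 : insert u R \ Z.erase u = insert u (R \ Z) := by
      ext y
      simp only [mem_sdiff, mem_insert, mem_erase]
      by_cases hy : y = u
      · simp [hy]
      · simp [hy]
    rw [h2, card_insert_of_notMem huR, hRc] at h1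
    have h3 := hN1 N (by omega)
    rw [sub_zero] at h3
    have h4 : ((Z.erase u).card : ℝ) ≤ zr := by
      exact_mod_cast (card_le_card (erase_subset _ _)).trans hZ
    have h5 : ((Z.erase u).card : ℝ) * ((N + 1 : ℕ) : ℝ) ^ (k - j - 1) ≤
        zr * ((N : ℝ) + 1) ^ (k - j - 1) := by push_cast; gcongr
    have h6 : 0 < e' / 8 * ((N : ℝ) + 1) ^ (k - j) := by positivity
    obtain ⟨D, hD, hDc, hE⟩ := att_edge hj (by linarith) h1 (by
      have := le_card_sdiff Z R; omega) (fun h => huR (mem_sdiff.1 h).1)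
    exact ⟨D, hD.trans sdiff_subset, disjoint_left.2 fun y hy => (mem_sdiff.1 (hD hy)).2, hDc, hE⟩

theorem CS.mono' {k p : ℕ} {E E' : Set (Finset ℕ)} {V τ} (h : CS k p E V τ) (hE : E ⊆ E') :
    CS k p E' V τ := ⟨h.inj, h.img, fun i => hE (h.edge i), h.per⟩

theorem pat_CS {k j : ℕ} (hj : 1 ≤ j) (hk : 2 ≤ k) (ε : ℝ) (hε : 0 < ε) :
    ∃ n0 : ℕ, ∀ (G : HGraph k) (Y : Finset ℕ) (f : ℕ → ℕ), Set.InjOn f Y → n0 ≤ Y.card →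
      (k - 1) ∣ Y.card →
      G.MinDegOnGe j (Y.image f) ((looseHamThreshold j k + ε) * (Y.card : ℝ) ^ (k - j)) →
      ∃ p τ, 2 ≤ p ∧ Y.card = p * (k - 1) ∧
        CS k p {T | T ⊆ Y ∧ T.card = k ∧ T.image f ∈ G.edges} Y τ := by
  obtain ⟨n0, h0⟩ := BB (k := k) hj ε hε
  refine ⟨n0 + 2 * (k - 1), fun G Y f hf hn hdvd hdeg => ?_⟩
  obtain ⟨p, hp⟩ := hdvd
  let P : HGraph k :=
    { verts := Y
      edges := (powersetCard k Y).filter fun T => T.image f ∈ G.edges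
      edge_sub := fun e he => (mem_powersetCard.1 (mem_filter.1 he).1).1
      edge_card := fun e he => (mem_powersetCard.1 (mem_filter.1 he).1).2 }
  have hmd : P.MinDegGe j ((looseHamThreshold j k + ε) * (P.verts.card : ℝ) ^ (k - j)) := by
    intro T hT hTc
    refine (hdeg (T.image f) (image_subset_image hT) ?_).trans ?_
    · rw [card_image_of_injOn (hf.mono hT), hTc]
    · apply Nat.cast_le.2
      apply card_le_card_of_injOn (fun e => Y.filter fun y => f y ∈ e)
      · intro e he
        obtain ⟨he, hTe⟩ := mem_filter.1 he
        obtain ⟨he, heY⟩ := mem_filter.1 he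
        have him : (Y.filter fun y => f y ∈ e).image f = e := by
          ext y
          rw [mem_image]
          constructor
          · rintro ⟨x, hx, rfl⟩; exact (mem_filter.1 hx).2
          · intro hy
            obtain ⟨x, hx, rfl⟩ := mem_image.1 (heY hy)
            exact ⟨x, mem_filter.2 ⟨hx, hy⟩, rfl⟩
        refine mem_filter.2 ⟨mem_filter.2 ⟨mem_powersetCard.2 ⟨filter_subset _ _, ?_⟩, ?_⟩, ?_⟩
        · rw [← G.edge_card e he]
          conv_rhs => rw [← him]
          rw [card_image_of_injOn (hf.mono (filter_subset _ _))]
        · show ((Y.filter fun y => f y ∈ e).image f) ∈ G.edges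
          rw [him]; exact he
        · intro t ht
          exact mem_filter.2 ⟨hT ht, hTe (mem_image_of_mem _ ht)⟩
      · intro e he e' he' heq
        have heY := (mem_filter.1 (mem_filter.1 he).1).2
        have heY' := (mem_filter.1 (mem_filter.1 he').1).2
        simp only at heq
        have key : ∀ e e' : Finset ℕ, e ⊆ Y.image f →
            (Y.filter fun y => f y ∈ e) = (Y.filter fun y => f y ∈ e') → e ⊆ e' := by
          intro e e' h1 h2 y hy
          obtain ⟨x, hx, rfl⟩ := mem_image.1 (h1 hy)
          have : x ∈ Y.filter fun y => f y ∈ e := mem_filter.2 ⟨hx, hy⟩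
          rw [h2] at this
          exact (mem_filter.1 this).2
        exact Subset.antisymm (key _ _ heY heq) (key _ _ heY' heq.symm)
  obtain ⟨H⟩ := h0 P (show n0 ≤ Y.card by omega) ⟨p, hp⟩ hmd
  have hp2 : 2 ≤ p := by
    by_contra hc
    have : (k - 1) * p ≤ (k - 1) * 1 := Nat.mul_le_mul_left _ (by omega)
    omega
  rw [mul_comm] at hp
  obtain ⟨τ, hτ⟩ := ham_CS hk hp2 H hp
  refine ⟨p, τ, hp2, hp, hτ.mono' ?_⟩
  intro T hT
  obtain ⟨h1, h2⟩ := mem_filter.1 hT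
  obtain ⟨h1, h3⟩ := mem_powersetCard.1 h1
  exact ⟨h1, h3, h2⟩

/-- extension of a tuple by zero -/
def extT {N : ℕ} {W : Finset ℕ} (x : Fin N → W) (i : ℕ) : ℕ := if h : i < N then (x ⟨i, h⟩ : ℕ) else 0

theorem extT_inj {N : ℕ} {W : Finset ℕ} {x : Fin N → W} (hx : Function.Injective x) :
    Set.InjOn (extT x) (range N) := by
  intro a ha b hb hab
  simp only [coe_range, Set.mem_Iio] at ha hb
  simp only [extT, ha, hb, dif_pos] at hab
  have := hx (Subtype.ext hab)
  simpa using this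

theorem extT_image {N : ℕ} {W : Finset ℕ} (x : Fin N → W) :
    (range N).image (extT x) = univ.image (fun i => (x i : ℕ)) := by
  ext y
  simp only [mem_image, mem_range, mem_univ, true_and]
  constructor
  · rintro ⟨i, hi, rfl⟩; exact ⟨⟨i, hi⟩, by simp [extT, hi]⟩
  · rintro ⟨i, rfl⟩; exact ⟨i, i.2, by simp [extT]⟩

theorem box {N g : ℕ} (hg : 1 ≤ g) {W : Finset ℕ} (A : Fin N → Finset W)
    (hA : ∀ i, (A i).card = g) (S : Finset (Fin N → W)) (hS : ∀ x ∈ S, Function.Injective x)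
    (hAS : ∀ x, (∀ i, x i ∈ A i) → x ∈ S) :
    ∃ (Γ : Finset ℕ) (p : ℕ → ℕ), Γ ⊆ W ∧ Γ.card ≤ N * g ∧ (∀ x ∈ Γ, p x ∈ range N) ∧
      (∀ i ∈ range N, (Γ.filter fun x => p x = i).card = g) ∧
      ∀ e ⊆ Γ, Set.InjOn p e → ∃ x ∈ S, ∀ y ∈ e, extT x (p y) = y := by
  have hne : ∀ i, ∃ b, b ∈ A i := fun i => card_pos.1 (by rw [hA]; omega)
  choose b hb using hne
  have hdis : ∀ i i' y, y ∈ A i → y ∈ A i' → i = i' := by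
    intro i i' y hy hy'
    by_contra hne
    have := hS _ (hAS (fun l => if l = i ∨ l = i' then y else b l) (by
      intro l
      by_cases hl : l = i ∨ l = i'
      · simp only [hl, if_true]
        rcases hl with rfl | rfl
        · exact hy
        · exact hy'
      · simp only [hl, if_false]; exact hb l))
    exact hne (this (by simp))
  let Γ : Finset ℕ := univ.biUnion fun i => (A i).image Subtype.val
  let p : ℕ → ℕ := fun y => if h : ∃ i : Fin N, y ∈ (A i).image Subtype.val
    then (h.choose : ℕ) else 0
  have hp : ∀ y (i : Fin N), y ∈ (A i).image Subtype.val → p y = i := by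
    intro y i hy
    have hex : ∃ i : Fin N, y ∈ (A i).image Subtype.val := ⟨i, hy⟩
    have h1 := hex.choose_spec
    have h2 : p y = hex.choose := by simp only [p, dif_pos hex]
    rw [h2]
    obtain ⟨w, hw, hwy⟩ := mem_image.1 hy
    obtain ⟨w', hw', hwy'⟩ := mem_image.1 h1
    have : w = w' := Subtype.ext (hwy.trans hwy'.symm)
    subst this
    rw [hdis _ _ _ hw hw']
  have hΓ : ∀ y ∈ Γ, ∃ i : Fin N, y ∈ (A i).image Subtype.val := by
    intro y hy
    obtain ⟨i, -, hi⟩ := mem_biUnion.1 hy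
    exact ⟨i, hi⟩
  have hci : ∀ i, ((A i).image Subtype.val).card = g := by
    intro i
    rw [card_image_of_injective _ Subtype.val_injective, hA]
  refine ⟨Γ, p, ?_, ?_, ?_, ?_, ?_⟩
  · intro y hy
    obtain ⟨i, hi⟩ := hΓ y hy
    obtain ⟨w, -, rfl⟩ := mem_image.1 hi
    exact w.2
  · refine (card_biUnion_le_card_mul _ _ g fun i _ => (hci i).le).trans ?_
    simp
  · intro y hy
    obtain ⟨i, hi⟩ := hΓ y hy
    rw [hp y i hi, mem_range]; exact i.2
  · intro i hi
    rw [← hci ⟨i, mem_range.1 hi⟩]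
    congr 1
    ext y
    rw [mem_filter]
    constructor
    · rintro ⟨hy, hpy⟩
      obtain ⟨i', hi'⟩ := hΓ y hy
      have := hp y i' hi'
      have : i' = ⟨i, mem_range.1 hi⟩ := Fin.ext (by rw [← this, hpy])
      rwa [this] at hi'
    · intro hy
      exact ⟨mem_biUnion.2 ⟨_, mem_univ _, hy⟩, hp y _ hy⟩
  · intro e he hinj
    have hex : ∀ i : Fin N, ∃ w ∈ A i, ∀ y ∈ e, p y = i → (w : ℕ) = y := by
      intro i
      by_cases h : ∃ y ∈ e, p y = i
      · obtain ⟨y, hy, hpy⟩ := h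
        obtain ⟨i', hi'⟩ := hΓ y (he hy)
        have h1 := hp y i' hi'
        have : i' = i := Fin.ext (by rw [← h1, hpy])
        rw [this] at hi'
        obtain ⟨w, hw, hwy⟩ := mem_image.1 hi'
        refine ⟨w, hw, fun y' hy' hpy' => ?_⟩
        rw [hwy]
        exact hinj hy hy' (hpy.trans hpy'.symm)
      · exact ⟨b i, hb i, fun y hy hpy => absurd ⟨y, hy, hpy⟩ h⟩
    choose x hxA hx using hex
    refine ⟨x, hAS x hxA, fun y hy => ?_⟩
    obtain ⟨i, hi⟩ := hΓ y (he hy)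
    have h1 := hp y i hi
    rw [h1]
    simp only [extT, i.2, dif_pos]
    exact hx i y hy h1

/-- the pattern of a tuple -/
def patQ {k N : ℕ} (G : HGraph k) (Sp : Finset ℕ) {W : Finset ℕ} (x : Fin N → W) :
    Finset (Finset ℕ × Finset ℕ) :=
  (Sp.powerset ×ˢ (range N).powerset).filter fun q => q.1 ∪ q.2.image (extT x) ∈ G.edges

theorem good_pat {k j : ℕ} (hj : 1 ≤ j) (hjk : j < k) (hk : 2 ≤ k) (δ ε β : ℝ) (hδ : 0 ≤ δ)
    (hε : 0 < ε) {N f0 n1 : ℕ}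
    (hn1 : ∀ (G : HGraph k) (Y : Finset ℕ) (f : ℕ → ℕ), Set.InjOn f Y → n1 ≤ Y.card →
      (k - 1) ∣ Y.card →
      G.MinDegOnGe j (Y.image f) ((δ + ε) * (Y.card : ℝ) ^ (k - j)) →
      ∃ p τ, 2 ≤ p ∧ Y.card = p * (k - 1) ∧
        CS k p {T | T ⊆ Y ∧ T.card = k ∧ T.image f ∈ G.edges} Y τ)
    (hasym : (δ + ε) * ((N : ℝ) + f0) ^ (k - j) + ((f0 + k : ℕ) : ℝ) * ((N : ℝ) + f0) ^ (k - j - 1)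
      ≤ β * (N : ℝ) ^ (k - j)) (hN1 : n1 + (k - 1) ≤ N) (hN2 : 2 * (k - 1) ≤ N) (hNj : j ≤ N)
    (hNd : (k - 1) ∣ N) (G : HGraph k) {Sp W : Finset ℕ} (hSp : Sp.card ≤ f0)
    (x : Fin N → W) (hx : Function.Injective x) (hxS : ∀ i, (x i : ℕ) ∉ Sp)
    (hmd : G.MinDegOnGe j (Sp ∪ univ.image (fun i => (x i : ℕ))) (β * (N : ℝ) ^ (k - j))) :
    Pat k N {T | T ⊆ range N ∧ T.card = k ∧ T.image (extT x) ∈ G.edges} ∧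
    ∀ u ∈ Sp, ∃ T ⊆ range N, T.card = k - 1 ∧ {u} ∪ T.image (extT x) ∈ G.edges := by
  have hinj := extT_inj hx
  rw [← extT_image] at hmd
  have hxS' : ∀ i ∈ range N, extT x i ∉ Sp := by
    intro i hi
    have := hxS ⟨i, mem_range.1 hi⟩
    simpa [extT, mem_range.1 hi] using this
  set M := (range N).image (extT x) with hM
  have hMc : M.card = N := by rw [hM, card_image_of_injOn hinj, card_range]
  have hMS : ∀ y ∈ M, y ∉ Sp := by
    intro y hy
    obtain ⟨i, hi, rfl⟩ := mem_image.1 hy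
    exact hxS' i hi
  have hU : (Sp ∪ M).card ≤ N + f0 := (card_union_le _ _).trans (by omega)
  -- deletion
  have hdel : ∀ X : Finset ℕ, X.card ≤ f0 + k → G.MinDegOnGe j ((Sp ∪ M) \ X)
      ((δ + ε) * ((N : ℝ) + f0) ^ (k - j)) := by
    intro X hX T hT hTc
    refine le_trans ?_ (MinDegOn_del hjk G _ X _ hmd T hT hTc)
    have h1 : (X.card : ℝ) * ((Sp ∪ M).card : ℝ) ^ (k - j - 1) ≤
        ((f0 + k : ℕ) : ℝ) * ((N : ℝ) + f0) ^ (k - j - 1) := by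
      have e1 : (X.card : ℝ) ≤ ((f0 + k : ℕ) : ℝ) := by exact_mod_cast hX
      have e2 : ((Sp ∪ M).card : ℝ) ≤ (N : ℝ) + f0 := by exact_mod_cast hU
      gcongr
    linarith
  have hham : ∀ D ⊆ range N, D.card ≤ k - 1 → (k - 1) ∣ (range N \ D).card →
      ∃ p τ, 2 ≤ p ∧ CS k p {T | T ⊆ range N ∧ T.card = k ∧ T.image (extT x) ∈ G.edges}
        (range N \ D) τ := by
    intro D hD hDc hdvd
    have hc : (range N \ D).card ≤ N := by
      simpa using card_le_card (sdiff_subset (s := range N) (t := D))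
    have hc2 : N ≤ (range N \ D).card + (k - 1) := by
      have := le_card_sdiff D (range N); rw [card_range] at this; omega
    have heq : (range N \ D).image (extT x) = (Sp ∪ M) \ (Sp ∪ D.image (extT x)) := by
      ext y
      simp only [mem_image, mem_sdiff, mem_union, not_or]
      constructor
      · rintro ⟨i, ⟨hi, hiD⟩, rfl⟩
        refine ⟨Or.inr (mem_image_of_mem _ hi), hxS' i hi, ?_⟩
        rintro ⟨i', hi', h⟩
        exact hiD (hinj (hD hi') hi h ▸ hi')
      · rintro ⟨h | h, h1, h2⟩
        · exact absurd h h1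
        · obtain ⟨i, hi, rfl⟩ := mem_image.1 h
          exact ⟨i, ⟨hi, fun h => h2 ⟨i, h, rfl⟩⟩, rfl⟩
    obtain ⟨p, τ, hp, -, hcs⟩ := hn1 G (range N \ D) (extT x)
      (hinj.mono (by exact_mod_cast sdiff_subset)) (by omega) hdvd (by
        rw [heq]
        intro T hT hTc
        refine le_trans ?_ (hdel (Sp ∪ D.image (extT x)) ((card_union_le _ _).trans (by
          have := card_image_le (s := D) (f := extT x); omega)) T hT hTc)
        have : ((range N \ D).card : ℝ) ≤ (N : ℝ) + f0 := by
          exact_mod_cast hc.trans (Nat.le_add_right _ _)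
        gcongr)
    refine ⟨p, τ, hp, hcs.mono' ?_⟩
    rintro T ⟨h1, h2⟩
    exact ⟨h1.trans sdiff_subset, h2⟩
  refine ⟨⟨hk, hNd, hN2, fun e he => he.1, fun e he => he.2.1, ?_, ?_⟩, ?_⟩
  · have := hham ∅ (empty_subset _) (by simp) (by simpa using hNd)
    simpa using this
  · intro D hD hDc
    apply hham D hD hDc.le
    rw [card_sdiff_of_subset hD, card_range, hDc]
    exact Nat.dvd_sub hNd (dvd_refl _)
  · intro u hu
    have h1 := hdel (Sp.erase u) ((card_le_card (erase_subset _ _)).trans (by omega))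
    have h2 : (Sp ∪ M) \ Sp.erase u = insert u M := by
      ext y
      have := hMS y
      simp only [mem_sdiff, mem_union, mem_erase, mem_insert]
      by_cases hy : y = u
      · subst hy; simp [hu]
      · simp only [hy]; tauto
    rw [h2] at h1
    have hpos : 0 < (δ + ε) * ((N : ℝ) + f0) ^ (k - j) := by
      have : (0 : ℝ) < N := by
        have : 0 < N := by omega
        exact_mod_cast this
      positivity
    obtain ⟨D, hD, hDc, hE⟩ := att_edge hj hpos h1 (by omega) (fun h => hMS u h hu)
    refine ⟨(range N).filter fun i => extT x i ∈ D, filter_subset _ _, ?_, ?_⟩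
    · have : ((range N).filter fun i => extT x i ∈ D).image (extT x) = D := by
        ext y
        rw [mem_image]
        constructor
        · rintro ⟨i, hi, rfl⟩; exact (mem_filter.1 hi).2
        · intro hy
          obtain ⟨i, hi, rfl⟩ := mem_image.1 (hD hy)
          exact ⟨i, mem_filter.2 ⟨hi, hy⟩, rfl⟩
      rw [← hDc]
      conv_rhs => rw [← this]
      rw [card_image_of_injOn (hinj.mono (by exact_mod_cast filter_subset _ _))]
    · have : ((range N).filter fun i => extT x i ∈ D).image (extT x) = D := by
        ext y
        rw [mem_image]
        constructor
        · rintro ⟨i, hi, rfl⟩; exact (mem_filter.1 hi).2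
        · intro hy
          obtain ⟨i, hi, rfl⟩ := mem_image.1 (hD hy)
          exact ⟨i, mem_filter.2 ⟨hi, hy⟩, rfl⟩
      rw [this, ← insert_eq]
      exact hE

theorem exp_small (c η : ℝ) (hc : 0 < c) (hη : 0 < η) :
    ∃ N2 : ℕ, ∀ N : ℕ, N2 ≤ N → Real.exp (-(c * N)) ≤ η := by
  obtain ⟨N2, hN2⟩ := exists_nat_gt (-(Real.log η) / c)
  refine ⟨N2, fun N hN => ?_⟩
  have h1 : -(c * N) ≤ Real.log η := by
    rw [div_lt_iff₀ hc] at hN2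
    have : (N2 : ℝ) ≤ N := by exact_mod_cast hN
    nlinarith
  have := (Real.exp_le_exp.2 h1)
  rwa [Real.exp_log (by positivity)] at this

theorem gadget {k j : ℕ} (hj : 1 ≤ j) (hjk : j < k) (hk : 2 ≤ k) (ε : ℝ) (hε : 0 < ε) (f0 : ℕ) :
    ∃ N : ℕ, ∀ z : ℕ, ∃ q0 n0 : ℕ, ∀ G : HGraph k, n0 ≤ G.verts.card →
      G.MinDegGe j ((looseHamThreshold j k + ε) * (G.verts.card : ℝ) ^ (k - j)) →
      ∀ Sp ⊆ G.verts, Sp.card ≤ f0 →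
      ∃ Γ ⊆ G.verts \ Sp, Γ.card ≤ q0 ∧
        Absb {e | e ∈ G.edges ∧ (e ∩ Sp).card ≤ 1} k Γ z (4 * N) ∧
        ∀ u ∈ Sp, Att {e | e ∈ G.edges ∧ (e ∩ Sp).card ≤ 1} k Γ z u := by
  have hδ := thr_nonneg j k
  set δ := looseHamThreshold j k with hδdef
  obtain ⟨e', he', he1, hee⟩ : ∃ e' : ℝ, 0 < e' ∧ e' ≤ 1 ∧ e' ≤ ε :=
    ⟨min ε 1, lt_min hε one_pos, min_le_right _ _, min_le_left _ _⟩
  obtain ⟨c, hc, N0, hN0⟩ := sampling hjk (δ + ε / 2) (e' / 4) (by positivity) (by positivity)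
    (by linarith) f0
  obtain ⟨n1, hn1⟩ := pat_CS (k := k) hj hk (ε / 4) (by positivity)
  rw [← hδdef] at hn1
  obtain ⟨N1, hN1⟩ := asym (δ + ε / 2) (δ + ε / 4) ((f0 + k : ℕ) : ℝ) 0 f0 (k - j) (by omega)
    (by linarith)
  obtain ⟨N2, hN2⟩ := exp_small c (1 / 4) hc (by norm_num)
  obtain ⟨n2, hn2⟩ := degIn_big hjk (δ + ε) (δ + ε / 2 + e' / 4) (by positivity) (by linarith) f0
  obtain ⟨N, hN⟩ : ∃ N, N = (k - 1) * (N0 + n1 + N1 + N2 + j + 2 * k) := ⟨_, rfl⟩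
  have hNge : N0 + n1 + N1 + N2 + j + 2 * k ≤ N := by
    rw [hN]; exact Nat.le_mul_of_pos_left _ (by omega)
  have hNd : (k - 1) ∣ N := ⟨_, hN⟩
  refine ⟨N, fun z => ?_⟩
  obtain ⟨g, hg⟩ : ∃ g, g = 2 * (z + (N + 1) * (4 * N)) * N + (4 * N + z + 2) + k := ⟨_, rfl⟩
  have hCpos : (0 : ℝ) < 2 ^ (2 ^ f0 * 2 ^ N) := by positivity
  obtain ⟨n3, hn3⟩ := blowup g N (1 / 4 / 2 ^ (2 ^ f0 * 2 ^ N)) (by positivity)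
  refine ⟨N * g, n2 + n3 + 2 * N ^ 2 + f0 + 1, fun G hn hdeg Sp hSp hSpc => ?_⟩
  set W := G.verts \ Sp with hW
  have hWc : G.verts.card ≤ W.card + f0 := by
    have := le_card_sdiff Sp G.verts; rw [hW]; omega
  have hWne : W.Nonempty := card_pos.1 (by omega)
  have hs := hN0 N (by omega) G W hWne sdiff_subset (hn2 G (by omega) hdeg Sp hSpc) Sp hSp hSpc
  have hinj := inj_card N W (by omega)
  have hWS : ∀ w : W, (w : ℕ) ∉ Sp := fun w => (mem_sdiff.1 w.2).2
  set S0 := univ.filter fun x : Fin N → W => Function.Injective x ∧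
    G.MinDegOnGe j (Sp ∪ univ.image (fun i => (x i : ℕ))) ((δ + ε / 2) * (N : ℝ) ^ (k - j))
    with hS0
  have hS0c : (W.card : ℝ) ^ N / 4 ≤ S0.card := by
    have e1 : (univ.filter fun x : Fin N → W => Function.Injective x).card ≤ S0.card +
        (badS G j N W Sp ((δ + ε / 2) * (N : ℝ) ^ (k - j))).card := by
      refine le_trans (card_le_card ?_) (card_union_le _ _)
      intro x hx
      have hx := (mem_filter.1 hx).2
      rw [mem_union]
      by_cases h : G.MinDegOnGe j (Sp ∪ univ.image (fun i => (x i : ℕ)))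
        ((δ + ε / 2) * (N : ℝ) ^ (k - j))
      · exact Or.inl (mem_filter.2 ⟨mem_univ _, hx, h⟩)
      · exact Or.inr (mem_filter.2 ⟨mem_univ _, hx, fun i => hWS _, h⟩)
    have e2 : ((W.card : ℝ)) ^ N ≤ 2 *
      (univ.filter fun x : Fin N → W => Function.Injective x).card := by exact_mod_cast hinj
    have e3 : ((univ.filter fun x : Fin N → W => Function.Injective x).card : ℝ) ≤ S0.card +
        (badS G j N W Sp ((δ + ε / 2) * (N : ℝ) ^ (k - j))).card := by exact_mod_cast e1
    have e4 := hN2 N (by omega)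
    have e5 : Real.exp (-(c * N)) * (W.card : ℝ) ^ N ≤ 1 / 4 * (W.card : ℝ) ^ N := by gcongr
    linarith
  -- pigeonhole
  set Pt := (Sp.powerset ×ˢ (range N).powerset).powerset with hPt
  have hPtc : Pt.card ≤ 2 ^ (2 ^ f0 * 2 ^ N) := by
    rw [hPt, card_powerset, card_product, card_powerset, card_powerset, card_range]
    have : 2 ^ Sp.card ≤ 2 ^ f0 := Nat.pow_le_pow_right (by norm_num) hSpc
    exact Nat.pow_le_pow_right (by norm_num) (Nat.mul_le_mul_right _ this)
  obtain ⟨Q, -, hQ⟩ := exists_le_card_fiber_of_nsmul_le_card_of_maps_to (s := S0) (t := Pt)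
    (f := fun x => patQ G Sp x) (b := 1 / 4 / 2 ^ (2 ^ f0 * 2 ^ N) * (W.card : ℝ) ^ N)
    (fun x _ => mem_powerset.2 (filter_subset _ _)) ⟨∅, by simp [hPt]⟩ (by
      rw [nsmul_eq_mul]
      have e1 : (Pt.card : ℝ) ≤ 2 ^ (2 ^ f0 * 2 ^ N) := by exact_mod_cast hPtc
      calc (Pt.card : ℝ) * (1 / 4 / 2 ^ (2 ^ f0 * 2 ^ N) * (W.card : ℝ) ^ N)
          ≤ 2 ^ (2 ^ f0 * 2 ^ N) * (1 / 4 / 2 ^ (2 ^ f0 * 2 ^ N) * (W.card : ℝ) ^ N) := by gcongr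
        _ = (W.card : ℝ) ^ N / 4 := by field_simp
        _ ≤ _ := hS0c)
  obtain ⟨A, hA, hAS⟩ := hn3 W (by simp; omega) _ (by simpa using hQ)
  obtain ⟨Γ, p, hΓW, hΓc, hpΓ, hfib, hlift⟩ := box (by omega) A hA
    (S0.filter fun x => patQ G Sp x = Q) (fun x hx => (mem_filter.1 (mem_filter.1 hx).1).2.1)
    (fun x hx => by simpa using hAS x hx)
  have hSQ : ∀ x ∈ S0.filter (fun x => patQ G Sp x = Q), ∀ S ⊆ Sp, ∀ T ⊆ range N,
      ((S, T) ∈ Q ↔ S ∪ T.image (extT x) ∈ G.edges) := by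
    intro x hx S hS T hT
    rw [← (mem_filter.1 hx).2, patQ, mem_filter, mem_product, mem_powerset, mem_powerset]
    simp [hS, hT]
  have hL : ∀ e ⊆ Γ, Set.InjOn p e → ∀ S ⊆ Sp, (S, e.image p) ∈ Q → S ∪ e ∈ G.edges := by
    intro e he hinj S hS hSe
    obtain ⟨x, hx, hxe⟩ := hlift e he hinj
    rw [hSQ x hx S hS _ (by
      intro i hi
      obtain ⟨y, hy, rfl⟩ := mem_image.1 hi
      exact hpΓ y (he hy))] at hSe
    have : (e.image p).image (extT x) = e := by
      rw [image_image]
      conv_rhs => rw [← image_id (s := e)]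
      exact image_congr fun y hy => hxe y hy
    rwa [this] at hSe
  obtain ⟨x, hx, -⟩ := hlift ∅ (empty_subset _) (by simp)
  have hx0 := (mem_filter.1 (mem_filter.1 hx).1).2
  obtain ⟨hpat, hatt⟩ := good_pat hj hjk hk δ (ε / 4) (δ + ε / 2) hδ (by positivity) hn1
    (by have := hN1 N (by omega); simpa using this) (by omega) (by omega) (by omega) hNd G hSpc x
    hx0.1 (fun i => hWS _) hx0.2
  have hΓS : ∀ y ∈ Γ, y ∉ Sp := fun y hy => (mem_sdiff.1 (hΓW hy)).2
  refine ⟨Γ, hΓW, hΓc, hpat.absb z g (by omega) (by omega) hpΓ hfib ?_, ?_⟩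
  · rintro e he hinj ⟨h1, h2, h3⟩
    constructor
    · have := hL e he hinj ∅ (empty_subset _) (by
        rw [hSQ x hx _ (empty_subset _) _ h1]; simpa using h3)
      simpa using this
    · have : e ∩ Sp = ∅ := by
        rw [← disjoint_iff_inter_eq_empty, disjoint_left]
        exact fun y hy => hΓS y (he hy)
      rw [this]; simp
  · intro u hu
    obtain ⟨T, hT, hTc, hTE⟩ := hatt u hu
    refine att_of z g (by omega) hfib hT hTc ?_
    intro D hD hinj hDT
    constructor
    · have := hL D hD hinj {u} (by simpa using hu) (by
        rw [hDT, hSQ x hx _ (by simpa using hu) _ hT]; exact hTE)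
      rwa [← insert_eq] at this
    · have : insert u D ∩ Sp ⊆ {u} := by
        intro y hy
        obtain ⟨h1, h2⟩ := mem_inter.1 hy
        rcases mem_insert.1 h1 with rfl | h
        · simp
        · exact absurd h2 (hΓS y (hD h))
      simpa using card_le_card this

theorem good_core {k p : ℕ} {E : Set (Finset ℕ)} {V : Finset ℕ} {τ : ℕ → ℕ} (hk : 2 ≤ k)
    (hp : 2 ≤ p) (h : CS k p E V τ) (Bd : Finset ℕ) (hB : Bd.card < p / 2) :
    ∃ u u' I, LP E u u' I ∧ insert u' I ⊆ V ∧ u ∉ Bd ∧ u' ∉ Bd ∧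
      (V \ insert u' I).card ≤ k ∧ ∀ x ∈ V \ insert u' I, x ∉ Bd := by
  have hgood : ∃ i, ∀ c ∈ Ico (i * (k - 1)) ((i + 1) * (k - 1) + 1), τ c ∉ Bd := by
    by_contra hcon
    push Not at hcon
    choose f hf hfB using hcon
    have hinj : Set.InjOn (fun i => τ (f (2 * i))) (range (p / 2) : Set ℕ) := by
      have hpos : ∀ i < p / 2, f (2 * i) < p * (k - 1) := by
        intro i hi
        have h1 := (mem_Ico.1 (hf (2 * i))).2
        have h2 : (2 * i + 1 + 1) * (k - 1) ≤ p * (k - 1) := Nat.mul_le_mul_right _ (by omega)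
        have h3 : (2 * i + 1 + 1) * (k - 1) = (2 * i + 1) * (k - 1) + (k - 1) := by ring
        omega
      have hlt : ∀ i i', i < i' → f (2 * i) < f (2 * i') := by
        intro i i' hii
        have h1 := (mem_Ico.1 (hf (2 * i))).2
        have h1' := (mem_Ico.1 (hf (2 * i'))).1
        have h2 : (2 * i + 1 + 1) * (k - 1) ≤ (2 * i') * (k - 1) :=
          Nat.mul_le_mul_right _ (by omega)
        have h3 : (2 * i + 1 + 1) * (k - 1) = (2 * i + 1) * (k - 1) + (k - 1) := by ring
        omega
      intro i hi i' hi' hii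
      have h1 := hpos i (by simpa using hi)
      have h2 := hpos i' (by simpa using hi')
      have h3 := h.inj 0 ⟨Nat.zero_le _, by omega⟩ ⟨Nat.zero_le _, by omega⟩ hii
      rcases lt_trichotomy i i' with h4 | h4 | h4
      · have := hlt _ _ h4; omega
      · exact h4
      · have := hlt _ _ h4; omega
    have h5 := card_le_card_of_injOn (s := range (p / 2)) (t := Bd) (fun i => τ (f (2 * i)))
      (fun i _ => hfB _) hinj
    rw [card_range] at h5
    omega
  obtain ⟨i, hi⟩ := hgood
  have hL := h.LP hk hp (p - 1) (i + 1) (by omega)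
  have e1 : (i + 1 + (p - 1)) * (k - 1) = i * (k - 1) + p * (k - 1) := by
    rw [show i + 1 + (p - 1) = i + p by omega, add_mul]
  have e2 : (i + 1) * (k - 1) = i * (k - 1) + (k - 1) := by ring
  rw [e1, e2] at hL
  rw [e2] at hi
  have hpk : 2 * (k - 1) ≤ p * (k - 1) := Nat.mul_le_mul_right _ hp
  have himg := h.img (i * (k - 1) + (k - 1))
  have hper : ∀ c, τ (c + p * (k - 1)) = τ c := h.per
  set S := (Ico (i * (k - 1) + (k - 1)) (i * (k - 1) + p * (k - 1))).image τ with hS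
  have hsub : insert (τ (i * (k - 1) + p * (k - 1))) S ⊆ V := by
    rw [← himg]
    refine insert_subset (mem_image_of_mem _ (mem_Ico.2 ⟨by omega, by omega⟩))
      (image_subset_image (Ico_subset_Ico le_rfl (by omega)))
  have hin : V \ insert (τ (i * (k - 1) + p * (k - 1))) S ⊆
      (Ico (i * (k - 1)) (i * (k - 1) + k)).image τ := by
    intro x hx
    obtain ⟨hxV, hxn⟩ := mem_sdiff.1 hx
    rw [← himg] at hxV
    obtain ⟨c, hc, rfl⟩ := mem_image.1 hxV
    have hc' := mem_Ico.1 hc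
    by_cases hcc : c < i * (k - 1) + p * (k - 1)
    · exact absurd (mem_insert_of_mem (mem_image_of_mem _ (mem_Ico.2 ⟨hc'.1, hcc⟩))) hxn
    · refine mem_image.2 ⟨c - p * (k - 1), mem_Ico.2 ⟨by omega, by omega⟩, ?_⟩
      rw [← hper, Nat.sub_add_cancel (by omega)]
  refine ⟨_, _, S, hL, hsub, hi _ (mem_Ico.2 ⟨by omega, by omega⟩), ?_, ?_, ?_⟩
  · rw [hper]; exact hi _ (mem_Ico.2 ⟨by omega, by omega⟩)
  · refine (card_le_card hin).trans (card_image_le.trans ?_)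
    simp
  · intro x hx
    obtain ⟨c, hc, rfl⟩ := mem_image.1 (hin hx)
    have := mem_Ico.1 hc
    exact hi c (mem_Ico.2 ⟨by omega, by omega⟩)

theorem Att.mono {E E' : Set (Finset ℕ)} {k z u : ℕ} {Γ : Finset ℕ} (h : Att E k Γ z u)
    (hE : E ⊆ E') : Att E' k Γ z u := by
  intro Z hZ
  obtain ⟨D, h1, h2, h3, h4⟩ := h Z hZ
  exact ⟨D, h1, h2, h3, hE h4⟩

theorem Absb.mono {E E' : Set (Finset ℕ)} {k z K : ℕ} {Γ : Finset ℕ} (h : Absb E k Γ z K)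
    (hE : E ⊆ E') : Absb E' k Γ z K := by
  refine ⟨?_, ?_⟩
  · intro γ h1 γ' h2 h3 Z h4 h5
    obtain ⟨D, g1, g2, g3, g4, g5, g6⟩ := h.join γ h1 γ' h2 h3 Z h4 h5
    exact ⟨D, g1, g2, g3, g4, g5, g6.mono hE⟩
  · intro D h1 h2 γ h3 v h4 h5
    exact (h.fin D h1 h2 γ h3 v h4 h5).mono hE

theorem assemble {E : Set (Finset ℕ)} {k z K zr a b u u' : ℕ} {Γ R I X V : Finset ℕ} (hk : 2 ≤ k)
    (hE : ∀ e ∈ E, e.card = k) (hA : Absb E k Γ z K) (hI : LP E u u' I)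
    (hRa : ∀ r ∈ R, Att E k Γ z r) (ha : Att E k Γ z a) (hb : Att E k Γ z b)
    (hu : Att E k R zr u) (hu' : Att E k R zr u') (hX : ∀ x ∈ X, Att E k R zr x)
    (hXc : X.card ≤ 2 * k) (hzr : zr = 4 * k ^ 2 + 3 * k)
    (hz : z = 2 * k + (1 + 2 * k + R.card) * (K + 2 * k))
    (d1 : Disjoint (insert u' I) Γ) (d2 : Disjoint (insert u' I) R) (d3 : Disjoint (insert u' I) X)
    (d4 : Disjoint X Γ) (d5 : Disjoint X R) (d6 : Disjoint R Γ)
    (a1 : a ∉ Γ) (a2 : a ∉ R) (a3 : a ∉ X) (a4 : a ∉ insert u' I)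
    (b1 : b ∉ Γ) (b2 : b ∉ R) (b3 : b ∉ X) (b4 : b ∉ insert u' I) (hab : a ≠ b)
    (hV : ∀ x, x ∈ V ↔ x = a ∨ x ∈ insert u' I ∨ x ∈ X ∨ x ∈ R ∨ x ∈ Γ)
    (hdiv : (k - 1) ∣ V.card) : LP E a b V := by
  have hz' : z = 2 * k + ((K + 2 * k) + 2 * k * (K + 2 * k) + R.card * (K + 2 * k)) := by
    rw [hz]; ring
  have hzr' : zr = 2 * k * (2 * k) + 3 * k := by rw [hzr]; ring
  have hXK := Nat.mul_le_mul_right (K + 2 * k) hXc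
  have hXk := Nat.mul_le_mul_right (2 * k) hXc
  have s0 := stA_init hk ha a1
  have ic : ({a} ∩ R).card = 0 := by
    rw [card_eq_zero, singleton_inter_of_notMem a2]
  obtain ⟨R1, hR1, hR1c, hR1d, s1⟩ := stA_good hk hA d6 hRa s0 hI d1
    (by rw [disjoint_singleton_right]; exact a4) d2 hu hu' (by omega) (by omega)
  have hJ : Disjoint (insert u' I) X := d3
  generalize insert u' I = J at *
  have ic1 : (({a} ∪ (J ∪ R1)) ∩ R).card ≤ 2 * k := by
    refine le_trans (card_le_card ?_) hR1c
    intro x hx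
    simp only [mem_inter, mem_union, mem_singleton] at hx
    rcases hx with ⟨rfl | h | h, hr⟩
    · exact absurd hr a2
    · exact absurd hr (disjoint_left.1 d2 h)
    · exact mem_inter.2 ⟨h, hr⟩
  obtain ⟨R2, hR2, hR2d, hR2c, s2⟩ := stA_goods hk hA d6 hRa s1 X d4 (by
      rw [disjoint_left]
      intro x hx hx'
      simp only [mem_union, mem_singleton] at hx'
      rcases hx' with rfl | h | h
      · exact a3 hx
      · exact disjoint_left.1 d3 h hx
      · exact disjoint_left.1 d5 hx (hR1 h)) d5 hX (by omega) (by omega)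
  have hsd : R \ (R1 ∪ R2) ⊆ R := sdiff_subset
  have hsc := Nat.mul_le_mul_right (K + 2 * k) (card_le_card hsd)
  have s3 := stA_direct hk hA s2 (R \ (R1 ∪ R2)) (d6.mono_left hsd) (by
      rw [disjoint_left]
      intro x hx hx'
      obtain ⟨hxR, hxn⟩ := mem_sdiff.1 hx
      simp only [mem_union, mem_singleton, not_or] at hx' hxn
      rcases hx' with (rfl | h | h) | h | h
      · exact a2 hxR
      · exact disjoint_left.1 d2 h hxR
      · exact hxn.1 h
      · exact disjoint_left.1 d5 h hxR
      · exact hxn.2 h) (fun u hu => hRa u (hsd hu)) (by omega)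
  have hVeq : ({a} ∪ (J ∪ R1) ∪ (X ∪ R2) ∪ (R \ (R1 ∪ R2))) ∪ Γ = V := by
    ext x
    rw [hV]
    simp only [mem_union, mem_singleton, mem_sdiff]
    constructor
    · rintro ((((h | h | h) | h | h) | h) | h)
      · exact Or.inl h
      · exact Or.inr (Or.inl h)
      · have := hR1 h; tauto
      · tauto
      · have := hR2 h; tauto
      · tauto
      · tauto
    · tauto
  have := stA_final hk hE hA s3 hb b1 (by
      simp only [mem_union, mem_singleton, mem_sdiff, not_or]
      have h1 : b ∉ R1 := fun h => b2 (hR1 h)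
      have h2 : b ∉ R2 := fun h => b2 (hR2 h)
      have h3 : b ≠ a := hab.symm
      tauto) (by omega) (by rw [hVeq]; exact hdiv)
  rwa [hVeq] at this

theorem MinDegOn_verts {k j : ℕ} {G : HGraph k} {d : ℝ} (h : G.MinDegGe j d) :
    G.MinDegOnGe j G.verts d := by
  intro T hT hTc
  refine (h T hT hTc).trans (Nat.cast_le.2 (card_le_card ?_))
  intro e he
  rw [mem_filter] at he ⊢
  exact ⟨mem_filter.2 ⟨he.1, G.edge_sub e he.1⟩, he.2⟩

theorem HC {k j : ℕ} (hj : 1 ≤ j) (hjk : j < k) (ε : ℝ) (hε : 0 < ε) :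
    ∃ n0 : ℕ, ∀ G : HGraph k, n0 ≤ G.verts.card → (k - 1) ∣ G.verts.card - 1 →
      G.MinDegGe j ((looseHamThreshold j k + ε) * (G.verts.card : ℝ) ^ (k - j)) →
      ∀ a ∈ G.verts, ∀ b ∈ G.verts, a ≠ b →
      LP {e | e ∈ G.edges ∧ ¬ (a ∈ e ∧ b ∈ e)} a b (G.verts.erase b) := by
  have hk : 2 ≤ k := by omega
  have hδ := thr_nonneg j k
  set δ := looseHamThreshold j k with hδdef
  obtain ⟨N1, n1, hres⟩ := reservoir hj hjk ε (1 / (4 * k)) hε (by positivity)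
    (4 * k ^ 2 + 3 * k) 2
  obtain ⟨N, hgad⟩ := gadget hj hjk hk ε hε (N1 + 2)
  obtain ⟨q0, n2, hgad⟩ := hgad (2 * k + (1 + 2 * k + N1) * (4 * N + 2 * k))
  obtain ⟨n3, hcs⟩ := pat_CS (k := k) hj hk (ε / 2) (by positivity)
  set c0 := N1 + 2 + q0 + k with hc0
  obtain ⟨n4, has⟩ := asym (δ + ε) (δ + ε / 2) c0 0 0 (k - j) (by omega) (by linarith)
  refine ⟨n1 + n2 + n3 + n4 + 4 * c0 + 8 * k, fun G hn hdvd hdeg a ha b hb hab => ?_⟩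
  set n := G.verts.card with hndef
  obtain ⟨R, hR, hRc, hbad⟩ := hres G (by omega) (by
    intro T hT hTc
    refine le_trans ?_ (hdeg T hT hTc)
    gcongr
    linarith) {a, b} card_le_two
  set Bd := (G.verts \ R).filter fun u => ¬ Att {e | e ∈ G.edges} k R (4 * k ^ 2 + 3 * k) u with hBd
  have hBc : 4 * k * Bd.card ≤ n := by
    have h0 : (0 : ℝ) < 4 * k := by positivity
    have : (4 * k : ℝ) * Bd.card ≤ n := by
      have h1 := mul_le_mul_of_nonneg_left hbad h0.le
      rwa [← mul_assoc, mul_one_div_cancel h0.ne', one_mul] at h1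
    exact_mod_cast this
  have haR : a ∉ R := fun h => (mem_sdiff.1 (hR h)).2 (by simp)
  have hbR : b ∉ R := fun h => (mem_sdiff.1 (hR h)).2 (by simp)
  have hRV : R ⊆ G.verts := hR.trans sdiff_subset
  have hSpc : (R ∪ {a, b}).card ≤ N1 + 2 :=
    (card_union_le _ _).trans (by have : ({a, b} : Finset ℕ).card ≤ 2 := card_le_two
                                  omega)
  obtain ⟨Γ, hΓ, hΓc, hA, hAt⟩ := hgad G (by omega) hdeg (R ∪ {a, b})
    (union_subset hRV (by
      intro x hx
      rcases mem_insert.1 hx with rfl | hx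
      · exact ha
      · rw [mem_singleton.1 hx]; exact hb)) hSpc
  set E0 : Set (Finset ℕ) := {e | e ∈ G.edges ∧ ¬ (a ∈ e ∧ b ∈ e)} with hE0
  have hEE : {e | e ∈ G.edges ∧ (e ∩ (R ∪ {a, b})).card ≤ 1} ⊆ E0 := by
    rintro e ⟨he, hc⟩
    refine ⟨he, fun hh => ?_⟩
    exact hab (card_le_one.1 hc a (by simp [hh.1]) b (by simp [hh.2]))
  have hA' := hA.mono hEE
  have hAt' : ∀ u ∈ R ∪ {a, b}, Att E0 k Γ _ u := fun u hu => (hAt u hu).mono hEE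
  have hΓV : Γ ⊆ G.verts := hΓ.trans sdiff_subset
  have hΓR : Disjoint R Γ := by
    rw [disjoint_left]
    exact fun x hx hx' => (mem_sdiff.1 (hΓ hx')).2 (mem_union_left _ hx)
  have haΓ : a ∉ Γ := fun h => (mem_sdiff.1 (hΓ h)).2 (by simp)
  have hbΓ : b ∉ Γ := fun h => (mem_sdiff.1 (hΓ h)).2 (by simp)
  -- good vertices
  have hgood : ∀ u ∈ G.verts, u ∉ R → u ≠ a → u ≠ b → u ∉ Bd →
      Att E0 k R (4 * k ^ 2 + 3 * k) u := by
    intro u hu huR hua hub hB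
    have h1 : Att {e | e ∈ G.edges} k R (4 * k ^ 2 + 3 * k) u := by
      by_contra hcon
      exact hB (mem_filter.2 ⟨mem_sdiff.2 ⟨hu, huR⟩, hcon⟩)
    intro Z hZ
    obtain ⟨D, g1, g2, g3, g4⟩ := h1 Z hZ
    refine ⟨D, g1, g2, g3, g4, fun hh => ?_⟩
    rcases mem_insert.1 hh.1 with h | h
    · exact hua h.symm
    · exact haR (g1 h)
  -- V0, dropped vertices
  set V0 := G.verts \ (R ∪ {a, b} ∪ Γ) with hV0
  have hV0c : n ≤ V0.card + (N1 + 2 + q0) := by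
    have h1 : _ ≤ V0.card := le_card_sdiff (R ∪ {a, b} ∪ Γ) G.verts
    have h2 := card_union_le (R ∪ {a, b}) Γ
    omega
  have hBk : 4 * Bd.card ≤ n :=
    le_trans (Nat.mul_le_mul_right _ (by omega)) hBc
  have hVB : k ≤ (V0 \ Bd).card := by
    have h1 := le_card_sdiff Bd V0
    omega
  obtain ⟨D0, hD0, hD0c⟩ := exists_subset_card_eq (show V0.card % (k - 1) ≤ (V0 \ Bd).card by
    have := Nat.mod_lt V0.card (show 0 < k - 1 by omega)
    omega)
  have hD0V : D0 ⊆ V0 := hD0.trans sdiff_subset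
  have hD0k : D0.card ≤ k := by
    have := Nat.mod_lt V0.card (show 0 < k - 1 by omega)
    omega
  set V1 := V0 \ D0 with hV1
  have hV1c : V1.card + D0.card = V0.card := card_sdiff_add_card_eq_card hD0V
  have hV1d : (k - 1) ∣ V1.card := by
    have := Nat.div_add_mod V0.card (k - 1)
    exact ⟨V0.card / (k - 1), by omega⟩
  have hV1V : V1 ⊆ G.verts := sdiff_subset.trans sdiff_subset
  have hV1n : V1.card ≤ n := card_le_card hV1V
  have hV1deg : G.MinDegOnGe j (V1.image id) ((δ + ε / 2) * (V1.card : ℝ) ^ (k - j)) := by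
    rw [image_id]
    have h1 := MinDegOn_del hjk G G.verts (G.verts \ V1) _ (MinDegOn_verts hdeg)
    rw [Finset.sdiff_sdiff_eq_self hV1V] at h1
    intro T hT hTc
    refine le_trans ?_ (h1 T hT hTc)
    have h2 := has n (by omega)
    rw [add_zero, sub_zero] at h2
    have h3 : ((G.verts \ V1).card : ℝ) ≤ c0 := by
      have := card_sdiff_add_card_eq_card hV1V
      exact_mod_cast (show (G.verts \ V1).card ≤ c0 by omega)
    have h4 : ((G.verts \ V1).card : ℝ) * (n : ℝ) ^ (k - j - 1) ≤ c0 * (n : ℝ) ^ (k - j - 1) := by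
      gcongr
    have h5 : (δ + ε / 2) * (V1.card : ℝ) ^ (k - j) ≤ (δ + ε / 2) * (n : ℝ) ^ (k - j) := by
      gcongr
    linarith
  obtain ⟨p, τ, hp, hpc, hCS⟩ := hcs G V1 id Function.injective_id.injOn (by omega) hV1d hV1deg
  have hpB : Bd.card < p / 2 := by
    have h1 : (2 * Bd.card + 2) ≤ p := by
      have h2 : (2 * Bd.card + 2) * (k - 1) ≤ p * (k - 1) := by
        have h3 : (2 * Bd.card + 2) * (k - 1) ≤ (2 * Bd.card + 2) * k :=
          Nat.mul_le_mul_left _ (by omega)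
        have h4 : 2 * ((2 * Bd.card + 2) * k) = 4 * k * Bd.card + 4 * k := by ring
        omega
      exact Nat.le_of_mul_le_mul_right h2 (by omega)
    omega
  obtain ⟨u, u', I, hL, hIV, huB, hu'B, hinc, hinB⟩ := good_core hk hp hCS Bd hpB
  have hV0m : ∀ x ∈ V0, x ∈ G.verts ∧ x ∉ R ∧ x ≠ a ∧ x ≠ b ∧ x ∉ Γ := by
    intro x hx
    simp only [hV0, mem_sdiff, mem_union, mem_insert, mem_singleton] at hx
    tauto
  have hV1m : ∀ x ∈ V1, x ∈ V0 ∧ x ∉ D0 := fun x hx => mem_sdiff.1 hx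
  have huV : u ∈ V1 := hIV hL.start_mem
  have hg0 : ∀ x ∈ V0, x ∉ Bd → Att E0 k R (4 * k ^ 2 + 3 * k) x := by
    intro x hx hB
    obtain ⟨h1, h2, h3, h4, -⟩ := hV0m x hx
    exact hgood x h1 h2 h3 h4 hB
  have hX : ∀ x ∈ (V1 \ insert u' I) ∪ D0, x ∈ V0 ∧ x ∉ Bd := by
    intro x hx
    rcases mem_union.1 hx with h | h
    · exact ⟨(hV1m x (mem_sdiff.1 h).1).1, hinB x h⟩
    · exact mem_sdiff.1 (hD0 h)
  have hJ0 : ∀ x ∈ insert u' I, x ∈ V0 := fun x hx => (hV1m x (hIV hx)).1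
  refine assemble (X := (V1 \ insert u' I) ∪ D0) (Γ := Γ) (R := R) hk
    (fun e he => G.edge_card e he.1) hA' (hL.mono ?_)
    (fun r hr => hAt' r (mem_union_left _ hr)) (hAt' a (by simp)) (hAt' b (by simp))
    (hg0 u (hV1m u huV).1 huB) (hg0 u' (hJ0 u' (mem_insert_self _ _)) hu'B)
    (fun x hx => hg0 x (hX x hx).1 (hX x hx).2)
    ((card_union_le _ _).trans (by omega)) rfl (by rw [hRc])
    ?_ ?_ ?_ ?_ ?_ hΓR haΓ haR ?_ ?_ hbΓ hbR ?_ ?_ hab ?_ ?_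
  · rintro e ⟨he1, he2, he3⟩
    rw [image_id] at he3
    exact ⟨he3, fun hh => (hV0m a (hV1m a (he1 hh.1)).1).2.2.1 rfl⟩
  · rw [disjoint_left]; exact fun x hx => (hV0m x (hJ0 x hx)).2.2.2.2
  · rw [disjoint_left]; exact fun x hx => (hV0m x (hJ0 x hx)).2.1
  · rw [disjoint_left]
    intro x hx hx'
    rcases mem_union.1 hx' with h | h
    · exact (mem_sdiff.1 h).2 hx
    · exact (hV1m x (hIV hx)).2 h
  · rw [disjoint_left]; exact fun x hx => (hV0m x (hX x hx).1).2.2.2.2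
  · rw [disjoint_left]; exact fun x hx => (hV0m x (hX x hx).1).2.1
  · exact fun hx => (hV0m a (hX a hx).1).2.2.1 rfl
  · exact fun hx => (hV0m a (hJ0 a hx)).2.2.1 rfl
  · exact fun hx => (hV0m b (hX b hx).1).2.2.2.1 rfl
  · exact fun hx => (hV0m b (hJ0 b hx)).2.2.2.1 rfl
  · intro x
    rw [mem_erase]
    constructor
    · rintro ⟨hxb, hxV⟩
      by_cases h1 : x = a
      · exact Or.inl h1
      by_cases h2 : x ∈ R
      · tauto
      by_cases h3 : x ∈ Γ
      · tauto
      by_cases h4 : x ∈ insert u' I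
      · exact Or.inr (Or.inl h4)
      have h5 : x ∈ V0 := by
        simp only [hV0, mem_sdiff, mem_union, mem_insert, mem_singleton]
        tauto
      right; right; left
      by_cases h6 : x ∈ D0
      · exact mem_union_right _ h6
      · exact mem_union_left _ (mem_sdiff.2 ⟨mem_sdiff.2 ⟨h5, h6⟩, h4⟩)
    · rintro (rfl | h | h | h | h)
      · exact ⟨hab, ha⟩
      · exact ⟨(hV0m x (hJ0 x h)).2.2.2.1, (hV0m x (hJ0 x h)).1⟩
      · exact ⟨(hV0m x (hX x h).1).2.2.2.1, (hV0m x (hX x h).1).1⟩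
      · exact ⟨fun hh => hbR (hh ▸ h), hRV h⟩
      · exact ⟨fun hh => hbΓ (hh ▸ h), hΓV h⟩
  · rw [card_erase_of_mem hb]; exact hdvd

theorem row_fix {q s : ℕ} {W : Finset ℕ} (hW : W.card = q * s) (i : Fin q) (x : Fin s → W) :
    (univ.filter fun σ : Fin q × Fin s ≃ W => (fun h => σ (i, h)) = x).card ≤
      (q * s - s).factorial := by
  by_cases hx : Function.Injective x
  swap
  · rw [card_eq_zero.2]
    · exact Nat.zero_le _
    · rw [filter_eq_empty_iff]
      intro σ _ h
      apply hx
      rw [← h]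
      intro a b hab
      have := σ.injective hab
      simpa using this
  have c1 : Fintype.card {p : Fin q × Fin s // p.1 ≠ i} = q * s - s := by
    have h0 : Fintype.card {p : Fin q × Fin s // p.1 = i} = s := by
      rw [Fintype.card_subtype]
      have : (univ.filter fun p : Fin q × Fin s => p.1 = i) = univ.image (fun h => (i, h)) := by
        ext ⟨a, b⟩
        simp [eq_comm]
      rw [this, card_image_of_injective _ (fun a b h => by simpa using h)]
      simp
    have := Fintype.card_subtype_compl (fun p : Fin q × Fin s => p.1 = i)
    rw [h0] at this
    simpa using this
  have c2 : Fintype.card {w : W // w ∉ Set.range x} = q * s - s := by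
    have := Fintype.card_subtype_compl (fun w : W => w ∈ Set.range x)
    rw [this, Fintype.card_coe, hW]
    congr 1
    have : Fintype.card (Set.range x) = s := by
      rw [Set.card_range_of_injective hx]; simp
    convert this
  have key : (univ.filter fun σ : Fin q × Fin s ≃ W => (fun h => σ (i, h)) = x).card ≤
      Fintype.card ({p : Fin q × Fin s // p.1 ≠ i} ↪ {w : W // w ∉ Set.range x}) := by
    rw [← Fintype.card_subtype]
    refine Fintype.card_le_of_injective (fun σ => ⟨fun p => ⟨σ.1 p.1, ?_⟩, ?_⟩) ?_
    · rintro ⟨h, hh⟩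
      have h1 := congrFun σ.2 h
      have hh : σ.1 p.1 = σ.1 (i, h) := (hh.symm.trans h1.symm)
      have h2 := σ.1.injective hh
      exact p.2 (by rw [h2])
    · intro p p' hpp
      simp only [Subtype.mk.injEq] at hpp
      exact Subtype.ext (σ.1.injective hpp)
    · intro σ σ' hs
      apply Subtype.ext
      apply Equiv.ext
      rintro ⟨a, b⟩
      by_cases ha : a = i
      · subst ha
        have h1 := congrFun σ.2 b
        have h2 := congrFun σ'.2 b
        exact h1.trans h2.symm
      · have := DFunLike.congr_fun hs ⟨(a, b), ha⟩
        exact congrArg Subtype.val this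
  rw [Fintype.card_embedding_eq, c1, c2, Nat.descFactorial_self] at key
  exact key

theorem row_count {q s : ℕ} {W : Finset ℕ} (hW : W.card = q * s) (hs : 2 * s ^ 2 ≤ q * s)
    (i : Fin q) (𝒳 : Finset (Fin s → W)) :
    (univ.filter fun σ : Fin q × Fin s ≃ W => (fun h => σ (i, h)) ∈ 𝒳).card * (q * s) ^ s ≤
      2 * 𝒳.card * (q * s).factorial := by
  have h1 : (univ.filter fun σ : Fin q × Fin s ≃ W => (fun h => σ (i, h)) ∈ 𝒳).card ≤
      𝒳.card * (q * s - s).factorial := by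
    have := card_le_mul_card_image_of_maps_to
      (s := univ.filter fun σ : Fin q × Fin s ≃ W => (fun h => σ (i, h)) ∈ 𝒳) (t := 𝒳)
      (f := fun σ h => σ (i, h)) (fun σ hσ => (mem_filter.1 hσ).2) (q * s - s).factorial
      (fun x _ => by
        refine le_trans (card_le_card ?_) (row_fix hW i x)
        intro σ hσ
        exact mem_filter.2 ⟨mem_univ _, (mem_filter.1 hσ).2⟩)
    rwa [mul_comm] at this
  have h2 := desc_ge (q * s) s hs
  have hsM : s ≤ q * s := Nat.le_mul_of_pos_left _ (Fin.pos i)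
  have h3 := Nat.factorial_mul_descFactorial hsM
  calc _ ≤ (𝒳.card * (q * s - s).factorial) * (2 * (q * s).descFactorial s) :=
        Nat.mul_le_mul h1 h2
    _ = 2 * 𝒳.card * ((q * s - s).factorial * (q * s).descFactorial s) := by ring
    _ = _ := by rw [h3]

theorem avg {q s : ℕ} {W : Finset ℕ} (hW : W.card = q * s) (hs : 2 * s ^ 2 ≤ q * s) (hq : 0 < q)
    (hs0 : 0 < s) (X1 X2 : Fin q → Finset (Fin s → W)) (c1 c2 : ℝ)
    (h1 : ∀ i, ((X1 i).card : ℝ) ≤ c1 * ((q * s : ℕ) : ℝ) ^ s)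
    (h2 : ∀ i, ((X2 i).card : ℝ) ≤ c2 * ((q * s : ℕ) : ℝ) ^ s)
    (hc : 2 * q * c1 + 8 * c2 < 1) :
    ∃ σ : Fin q × Fin s ≃ W, (∀ i, (fun h => σ (i, h)) ∉ X1 i) ∧
      4 * (univ.filter fun i => (fun h => σ (i, h)) ∈ X2 i).card < q := by
  have hM : (0 : ℝ) < ((q * s : ℕ) : ℝ) ^ s := by
    have : 0 < q * s := Nat.mul_pos hq hs0
    positivity
  have hqR : (0 : ℝ) < q := by exact_mod_cast hq
  have hrow : ∀ (i : Fin q) (𝒳 : Finset (Fin s → W)) (c : ℝ),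
      (𝒳.card : ℝ) ≤ c * ((q * s : ℕ) : ℝ) ^ s →
      ((univ.filter fun σ : Fin q × Fin s ≃ W => (fun h => σ (i, h)) ∈ 𝒳).card : ℝ) ≤
        2 * c * (q * s).factorial := by
    intro i 𝒳 c hX
    have h3 : ((univ.filter fun σ : Fin q × Fin s ≃ W => (fun h => σ (i, h)) ∈ 𝒳).card : ℝ) *
        ((q * s : ℕ) : ℝ) ^ s ≤ 2 * 𝒳.card * (q * s).factorial := by
      exact_mod_cast row_count hW hs i 𝒳
    have h4 : (2 : ℝ) * 𝒳.card * (q * s).factorial ≤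
        2 * (c * ((q * s : ℕ) : ℝ) ^ s) * (q * s).factorial := by gcongr
    have h5 := h3.trans h4
    refine le_of_mul_le_mul_right (h5.trans (le_of_eq ?_)) hM
    ring
  have hcard : Fintype.card (Fin q × Fin s ≃ W) = (q * s).factorial := by
    have e : Fin q × Fin s ≃ W := Fintype.equivOfCardEq (by simp [hW])
    rw [Fintype.card_equiv e]
    simp
  by_contra hcon
  push Not at hcon
  have hpt : ∀ σ : Fin q × Fin s ≃ W, (1 : ℝ) ≤
      ∑ i, ((if (fun h => σ (i, h)) ∈ X1 i then (1 : ℝ) else 0) +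
        4 / q * (if (fun h => σ (i, h)) ∈ X2 i then (1 : ℝ) else 0)) := by
    intro σ
    by_cases hh : ∀ i, (fun h => σ (i, h)) ∉ X1 i
    · have h3 := hcon σ hh
      rw [sum_add_distrib, ← mul_sum, sum_boole, sum_boole]
      have h4 : (0 : ℝ) ≤ ((univ.filter fun i => (fun h => σ (i, h)) ∈ X1 i).card : ℝ) :=
        Nat.cast_nonneg _
      have h5 : (1 : ℝ) ≤ 4 / q * ((univ.filter fun i => (fun h => σ (i, h)) ∈ X2 i).card : ℝ) := by
        rw [div_mul_eq_mul_div, one_le_div hqR]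
        exact_mod_cast h3
      linarith
    · push Not at hh
      obtain ⟨i, hi⟩ := hh
      refine le_trans ?_ (single_le_sum (f := fun i =>
        ((if (fun h => σ (i, h)) ∈ X1 i then (1 : ℝ) else 0) +
        4 / q * (if (fun h => σ (i, h)) ∈ X2 i then (1 : ℝ) else 0))) (fun i _ => ?_) (mem_univ i))
      · simp only [hi, if_true]
        have : (0 : ℝ) ≤ 4 / q * (if (fun h => σ (i, h)) ∈ X2 i then (1 : ℝ) else 0) := by
          split_ifs <;> positivity
        linarith
      · split_ifs <;> positivity
  have hsum := sum_le_sum fun σ (_ : σ ∈ (univ : Finset (Fin q × Fin s ≃ W))) => hpt σ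
  rw [sum_const, card_univ, hcard, nsmul_eq_mul, mul_one, sum_comm] at hsum
  have hb : ∀ i ∈ (univ : Finset (Fin q)), ∑ σ : Fin q × Fin s ≃ W,
      ((if (fun h => σ (i, h)) ∈ X1 i then (1 : ℝ) else 0) +
        4 / q * (if (fun h => σ (i, h)) ∈ X2 i then (1 : ℝ) else 0)) ≤
      (2 * c1 + 8 / q * c2) * (q * s).factorial := by
    intro i _
    rw [sum_add_distrib, ← mul_sum, sum_boole, sum_boole]
    have g1 := hrow i (X1 i) c1 (h1 i)
    have g2 := mul_le_mul_of_nonneg_left (hrow i (X2 i) c2 (h2 i))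
      (show (0 : ℝ) ≤ 4 / q by positivity)
    have g3 : (2 * c1 + 8 / q * c2) * ((q * s).factorial : ℝ) =
      2 * c1 * (q * s).factorial + 4 / q * (2 * c2 * (q * s).factorial) := by ring
    rw [g3]
    linarith
  have h6 := hsum.trans (sum_le_sum hb)
  rw [sum_const, card_univ, Fintype.card_fin, nsmul_eq_mul, ← mul_assoc] at h6
  have h7 : (q : ℝ) * (2 * c1 + 8 / q * c2) = 2 * q * c1 + 8 * c2 := by
    field_simp
  rw [h7] at h6
  have h8 : (0 : ℝ) < (q * s).factorial := by exact_mod_cast Nat.factorial_pos _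
  nlinarith

theorem count_upd {s : ℕ} {α : Type} [Fintype α] (h : Fin s) (Pr : (Fin s → α) → Prop)
    (N : (Fin s → α) → Finset α) (D : ℕ)
    (hPr : ∀ x w, Pr (Function.update x h w) ↔ Pr x)
    (hN : ∀ x w, N (Function.update x h w) = N x) (hD : ∀ x, (N x).card ≤ D) :
    (univ.filter fun x => Pr x ∧ x h ∈ N x).card * Fintype.card α ≤
      D * (univ.filter fun x => Pr x).card := by
  have h1 : ((univ.filter fun x => Pr x ∧ x h ∈ N x) ×ˢ (univ : Finset α)).card ≤
      ((univ.filter fun x => Pr x).sigma N).card := by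
    apply card_le_card_of_injOn (fun p => ⟨Function.update p.1 h p.2, p.1 h⟩)
    · rintro ⟨x, w⟩ hx
      have hx' := (mem_filter.1 (mem_product.1 hx).1).2
      exact mem_sigma.2 ⟨mem_filter.2 ⟨mem_univ _, (hPr x w).2 hx'.1⟩, by
        simp only; rw [hN]; exact hx'.2⟩
    · rintro ⟨x, w⟩ - ⟨x', w'⟩ - hxx
      simp only [Sigma.mk.injEq, heq_eq_eq] at hxx
      obtain ⟨h2, h3⟩ := hxx
      have h4 : w = w' := by
        have := congrFun h2 h
        simpa using this
      refine Prod.ext ?_ h4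
      funext y
      by_cases hy : y = h
      · rw [hy]; exact h3
      · have := congrFun h2 y
        simpa [Function.update_of_ne hy] using this
  rw [card_product, card_univ, card_sigma] at h1
  refine h1.trans ((sum_le_card_nsmul _ _ D fun x _ => hD x).trans (le_of_eq ?_))
  rw [smul_eq_mul, mul_comm]

/-- position `h` conflicts with something earlier -/
def BadP (B : Finset (Finset ℕ)) (Fr : Finset ℕ) {s : ℕ} {W : Finset ℕ} (x : Fin s → W)
    (h : Fin s) : Prop :=
  ∃ v ∈ Fr ∪ (univ.filter fun h' => h' < h).image (fun h' => (x h' : ℕ)),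
    ({v, (x h : ℕ)} : Finset ℕ) ∈ B

theorem nb_card {B : Finset (Finset ℕ)} {Δ : ℕ} (hΔ : ∀ v : ℕ, (B.filter fun b => v ∈ b).card ≤ Δ)
    (W : Finset ℕ) (v : ℕ) : (W.filter fun w => ({v, w} : Finset ℕ) ∈ B).card ≤ Δ := by
  refine le_trans (card_le_card_of_injOn (fun w => ({v, w} : Finset ℕ)) ?_ ?_) (hΔ v)
  · intro w hw
    exact mem_coe.2 (mem_filter.2 ⟨(mem_filter.1 hw).2, by simp⟩)
  · intro w _ w' _ hww
    simp only at hww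
    have h1 : w ∈ ({v, w'} : Finset ℕ) := by rw [← hww]; simp
    have h2 : w' ∈ ({v, w} : Finset ℕ) := by rw [hww]; simp
    simp only [mem_insert, mem_singleton] at h1 h2
    rcases h1 with h1 | h1
    · rcases h2 with h2 | h2
      · rw [h1, h2]
      · exact h2.symm
    · exact h1

theorem nbs_card {B : Finset (Finset ℕ)} {Δ : ℕ} (hΔ : ∀ v : ℕ, (B.filter fun b => v ∈ b).card ≤ Δ)
    (W A : Finset ℕ) : (W.filter fun w => ∃ v ∈ A, ({v, w} : Finset ℕ) ∈ B).card ≤ A.card * Δ := by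
  have : (W.filter fun w => ∃ v ∈ A, ({v, w} : Finset ℕ) ∈ B) ⊆
      A.biUnion fun v => W.filter fun w => ({v, w} : Finset ℕ) ∈ B := by
    intro w hw
    obtain ⟨hw, v, hv, hb⟩ := mem_filter.1 hw
    exact mem_biUnion.2 ⟨v, hv, mem_filter.2 ⟨hw, hb⟩⟩
  exact (card_le_card this).trans (card_biUnion_le_card_mul _ _ _ fun v _ => nb_card hΔ W v)

theorem bad_step {B : Finset (Finset ℕ)} {Δ : ℕ}
    (hΔ : ∀ v : ℕ, (B.filter fun b => v ∈ b).card ≤ Δ) {Fr : Finset ℕ} (hF : Fr.card ≤ 2)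
    {s : ℕ} {W : Finset ℕ} (h : Fin s) (Pr : (Fin s → W) → Prop)
    (hPr : ∀ x w, Pr (Function.update x h w) ↔ Pr x) :
    (univ.filter fun x => Pr x ∧ BadP B Fr x h).card * W.card ≤
      ((s + 2) * Δ) * (univ.filter fun x => Pr x).card := by
  have key := count_upd h Pr (fun x => univ.filter fun w : W => ∃ v ∈ Fr ∪
    (univ.filter fun h' => h' < h).image (fun h' => (x h' : ℕ)), ({v, (w : ℕ)} : Finset ℕ) ∈ B)
    ((s + 2) * Δ) hPr ?_ ?_
  · rw [Fintype.card_coe] at key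
    refine le_trans (le_of_eq ?_) key
    congr 2
    ext x
    simp only [mem_filter, mem_univ, true_and]
    exact Iff.rfl
  · intro x w
    have : (univ.filter fun h' => h' < h).image (fun h' => ((Function.update x h w) h' : ℕ)) =
        (univ.filter fun h' => h' < h).image (fun h' => (x h' : ℕ)) := by
      apply image_congr
      intro h' hh
      have : h' < h := by simpa using hh
      simp only [Function.update_of_ne this.ne]
    ext y
    simp only [this, mem_filter, mem_univ, true_and]
  · intro x
    set A := Fr ∪ (univ.filter fun h' => h' < h).image (fun h' => (x h' : ℕ)) with hA
    have hAc : A.card ≤ s + 2 := by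
      refine (card_union_le _ _).trans ?_
      have h1 : ((univ.filter fun h' => h' < h).image (fun h' => (x h' : ℕ))).card ≤ s :=
        card_image_le.trans ((card_filter_le _ _).trans (by simp))
      omega
    refine le_trans ?_ (Nat.mul_le_mul_right Δ hAc)
    refine le_trans ?_ (nbs_card hΔ W A)
    apply card_le_card_of_injOn (fun w : W => (w : ℕ))
    · intro w hw
      simp only [mem_coe, mem_filter] at hw
      exact mem_coe.2 (mem_filter.2 ⟨w.2, hw.2⟩)
    · exact Subtype.val_injective.injOn

theorem one_bad {B : Finset (Finset ℕ)} {Δ : ℕ}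
    (hΔ : ∀ v : ℕ, (B.filter fun b => v ∈ b).card ≤ Δ) {Fr : Finset ℕ} (hF : Fr.card ≤ 2)
    {s : ℕ} {W : Finset ℕ} :
    (univ.filter fun x : Fin s → W => ∃ h, BadP B Fr x h).card * W.card ≤
      s * ((s + 2) * Δ) * W.card ^ s := by
  have h1 : (univ.filter fun x : Fin s → W => ∃ h, BadP B Fr x h).card ≤
      ∑ h : Fin s, (univ.filter fun x : Fin s → W => True ∧ BadP B Fr x h).card := by
    refine le_trans (card_le_card ?_) card_biUnion_le
    intro x hx
    obtain ⟨h, hh⟩ := (mem_filter.1 hx).2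
    exact mem_biUnion.2 ⟨h, mem_univ _, mem_filter.2 ⟨mem_univ _, trivial, hh⟩⟩
  refine (Nat.mul_le_mul_right _ h1).trans ?_
  rw [sum_mul]
  refine (sum_le_card_nsmul _ _ (((s + 2) * Δ) * W.card ^ s) fun h _ => ?_).trans (le_of_eq ?_)
  · have g1 := bad_step (W := W) hΔ hF h (fun _ => True) (fun _ _ => Iff.rfl)
    simp only [true_and, filter_true] at g1 ⊢
    have e2 : (univ : Finset (Fin s → W)).card = W.card ^ s := by simp
    rw [e2] at g1
    exact g1
  · simp; ring

theorem two_bad {B : Finset (Finset ℕ)} {Δ : ℕ}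
    (hΔ : ∀ v : ℕ, (B.filter fun b => v ∈ b).card ≤ Δ) {Fr : Finset ℕ} (hF : Fr.card ≤ 2)
    {s : ℕ} {W : Finset ℕ} :
    (univ.filter fun x : Fin s → W => ∃ h h', h < h' ∧ BadP B Fr x h ∧ BadP B Fr x h').card *
      W.card ^ 2 ≤ (s * ((s + 2) * Δ)) ^ 2 * W.card ^ s := by
  have h1 : (univ.filter fun x : Fin s → W => ∃ h h', h < h' ∧ BadP B Fr x h ∧ BadP B Fr x h').card ≤
      ∑ p : Fin s × Fin s, (univ.filter fun x : Fin s → W => p.1 < p.2 ∧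
        BadP B Fr x p.1 ∧ BadP B Fr x p.2).card := by
    refine le_trans (card_le_card ?_) card_biUnion_le
    intro x hx
    obtain ⟨h, h', hh⟩ := (mem_filter.1 hx).2
    exact mem_biUnion.2 ⟨(h, h'), mem_univ _, mem_filter.2 ⟨mem_univ _, hh⟩⟩
  refine (Nat.mul_le_mul_right _ h1).trans ?_
  rw [sum_mul]
  refine (sum_le_card_nsmul _ _ (((s + 2) * Δ) ^ 2 * W.card ^ s) fun p _ => ?_).trans (le_of_eq ?_)
  · by_cases hp : p.1 < p.2
    swap
    · simp [hp]
    have g1 := bad_step (W := W) hΔ hF p.1 (fun _ => True) (fun _ _ => Iff.rfl)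
    have g2 := bad_step (W := W) hΔ hF p.2 (fun x => BadP B Fr x p.1) (by
      intro x w
      have e1 : (univ.filter fun h' => h' < p.1).image
          (fun h' => ((Function.update x p.2 w) h' : ℕ)) =
          (univ.filter fun h' => h' < p.1).image (fun h' => (x h' : ℕ)) := by
        apply image_congr
        intro h' hh
        have : h' < p.1 := by simpa using hh
        simp only [Function.update_of_ne (this.trans hp).ne]
      unfold BadP
      rw [e1, Function.update_of_ne hp.ne])
    simp only [true_and, filter_true] at g1
    have e2 : (univ : Finset (Fin s → W)).card = W.card ^ s := by simp
    rw [e2] at g1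
    simp only [hp, true_and]
    calc _ = ((univ.filter fun x : Fin s → W => BadP B Fr x p.1 ∧ BadP B Fr x p.2).card * W.card) *
          W.card := by ring
      _ ≤ (((s + 2) * Δ) * (univ.filter fun x : Fin s → W => BadP B Fr x p.1).card) * W.card :=
          Nat.mul_le_mul_right _ g2
      _ = ((s + 2) * Δ) * ((univ.filter fun x : Fin s → W => BadP B Fr x p.1).card * W.card) := by
          ring
      _ ≤ ((s + 2) * Δ) * (((s + 2) * Δ) * W.card ^ s) := Nat.mul_le_mul_left _ g1
      _ = _ := by ring
  · simp; ring

theorem hall_big {ι α : Type} [Fintype ι] (A : ι → Finset α) (h : ∀ i, Fintype.card ι ≤ (A i).card) :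
    ∃ f : ι → α, Function.Injective f ∧ ∀ i, f i ∈ A i := by
  rw [← Finset.all_card_le_biUnion_card_iff_exists_injective]
  intro s
  rcases s.eq_empty_or_nonempty with rfl | ⟨i, hi⟩
  · simp
  · exact (card_le_univ s).trans ((h i).trans (card_le_card (subset_biUnion_of_mem A hi)))

theorem not_bad_fr {B : Finset (Finset ℕ)} {Fr : Finset ℕ} {s : ℕ} {W : Finset ℕ} {x : Fin s → W}
    {h : Fin s} (hb : ¬ BadP B Fr x h) : ∀ v ∈ Fr, ({v, (x h : ℕ)} : Finset ℕ) ∉ B :=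
  fun v hv hB => hb ⟨v, mem_union_left _ hv, hB⟩

theorem not_bad_pair {B : Finset (Finset ℕ)} {Fr : Finset ℕ} {s : ℕ} {W : Finset ℕ} {x : Fin s → W}
    {h h' : Fin s} (hb : ¬ BadP B Fr x h) (hb' : ¬ BadP B Fr x h') (hh : h ≠ h') :
    ({(x h : ℕ), (x h' : ℕ)} : Finset ℕ) ∉ B := by
  intro hB
  rcases lt_or_gt_of_ne hh with h1 | h1
  · exact hb' ⟨x h, mem_union_right _ (mem_image.2 ⟨h, by simpa using h1, rfl⟩), hB⟩
  · exact hb ⟨x h', mem_union_right _ (mem_image.2 ⟨h', by simpa using h1, rfl⟩), by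
      rwa [pair_comm]⟩

theorem swap_fix {q s Δ : ℕ} {W : Finset ℕ} {B : Finset (Finset ℕ)}
    (hΔ : ∀ v : ℕ, (B.filter fun b => v ∈ b).card ≤ Δ) (hs0 : 0 < s)
    (σ : Fin q × Fin s ≃ W) (Fr : Fin q → Finset ℕ) (hF : ∀ i, (Fr i).card ≤ 2)
    (hFd : ∀ i i', i ≠ i' → Disjoint (Fr i) (Fr i')) (hFW : ∀ i, Disjoint (Fr i) W)
    (h2 : ∀ i, ¬ ∃ h h', h < h' ∧ BadP B (Fr i) (fun h => σ (i, h)) h ∧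
      BadP B (Fr i) (fun h => σ (i, h)) h')
    (h1 : 4 * (univ.filter fun i => ∃ h, BadP B (Fr i) (fun h => σ (i, h)) h).card < q)
    (hq : 2 * ((s + 3) * Δ) ≤ q) :
    ∃ x : Fin q × Fin s → W, Function.Injective x ∧
      (∀ i h, ∀ v ∈ Fr i, ({v, (x (i, h) : ℕ)} : Finset ℕ) ∉ B) ∧
      (∀ i h h', h ≠ h' → ({(x (i, h) : ℕ), (x (i, h') : ℕ)} : Finset ℕ) ∉ B) ∧
      ∀ i, ∃ h0, ∀ h ≠ h0, x (i, h) = σ (i, h) := by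
  set Rb := univ.filter fun i => ∃ h, BadP B (Fr i) (fun h => σ (i, h)) h with hRb
  let z0 : Fin s := ⟨0, hs0⟩
  -- the bad position
  have hpe : ∀ i : Fin q, ∃ h : Fin s, (i ∈ Rb → BadP B (Fr i) (fun h => σ (i, h)) h) := by
    intro i
    by_cases hi : i ∈ Rb
    · obtain ⟨h, hh⟩ := (mem_filter.1 hi).2
      exact ⟨h, fun _ => hh⟩
    · exact ⟨z0, fun h => absurd h hi⟩
  choose hp hhp using hpe
  have hgoodR : ∀ i ∈ Rb, ∀ h, h ≠ hp i → ¬ BadP B (Fr i) (fun h => σ (i, h)) h := by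
    intro i hi h hh hb
    rcases lt_or_gt_of_ne hh with g | g
    · exact h2 i ⟨h, hp i, g, hb, hhp i hi⟩
    · exact h2 i ⟨hp i, h, g, hhp i hi, hb⟩
  have hgoodC : ∀ i, i ∉ Rb → ∀ h, ¬ BadP B (Fr i) (fun h => σ (i, h)) h := by
    intro i hi h hb
    exact hi (mem_filter.2 ⟨mem_univ _, h, hb⟩)
  let S : Fin q → Finset ℕ := fun i => Fr i ∪ univ.image (fun h => (σ (i, h) : ℕ))
  have hSc : ∀ i, (S i).card ≤ s + 2 := by
    intro i
    refine (card_union_le _ _).trans ?_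
    have g1 : (univ.image (fun h => (σ (i, h) : ℕ))).card ≤ s := card_image_le.trans (by simp)
    have g2 := hF i
    omega
  have hSd : ∀ i i', ∀ v, v ∈ S i → v ∈ S i' → i = i' := by
    intro i i' v hv hv'
    by_contra hne
    rcases mem_union.1 hv with g | g <;> rcases mem_union.1 hv' with g' | g'
    · exact disjoint_left.1 (hFd i i' hne) g g'
    · obtain ⟨h, -, rfl⟩ := mem_image.1 g'
      exact disjoint_left.1 (hFW i) g (σ (i', h)).2
    · obtain ⟨h, -, rfl⟩ := mem_image.1 g
      exact disjoint_left.1 (hFW i') g' (σ (i, h)).2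
    · obtain ⟨h, -, rfl⟩ := mem_image.1 g
      obtain ⟨h', -, e⟩ := mem_image.1 g'
      have := σ.injective (Subtype.ext e)
      exact hne (by simpa using (congrArg Prod.fst this).symm)
  let f1 : Fin q → Finset (Fin q) := fun i => univ.filter fun i' =>
    ∃ v ∈ S i, ({v, (σ (i', z0) : ℕ)} : Finset ℕ) ∈ B
  let f2 : Fin q → Finset (Fin q) := fun i => univ.filter fun i' =>
    ∃ v ∈ S i', ({v, (σ (i, hp i) : ℕ)} : Finset ℕ) ∈ B
  have hf1 : ∀ i, (f1 i).card ≤ (s + 2) * Δ := by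
    intro i
    refine le_trans ?_ ((nbs_card hΔ W (S i)).trans (Nat.mul_le_mul_right _ (hSc i)))
    apply card_le_card_of_injOn (fun i' => (σ (i', z0) : ℕ))
    · intro i' hi'
      rw [mem_coe, mem_filter] at hi'
      exact mem_coe.2 (mem_filter.2 ⟨(σ (i', z0)).2, hi'.2⟩)
    · intro a _ b _ hab
      have := σ.injective (Subtype.ext hab)
      exact congrArg Prod.fst this
  have hf2 : ∀ i, (f2 i).card ≤ Δ := by
    intro i
    have hex : ∀ i', ∃ v, i' ∈ f2 i → v ∈ S i' ∧ ({v, (σ (i, hp i) : ℕ)} : Finset ℕ) ∈ B := by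
      intro i'
      by_cases hi : i' ∈ f2 i
      · obtain ⟨v, hv⟩ := (mem_filter.1 hi).2
        exact ⟨v, fun _ => hv⟩
      · exact ⟨0, fun h => absurd h hi⟩
    choose g hg using hex
    refine le_trans (card_le_card_of_injOn (t := (univ.biUnion S).filter fun w =>
      ({(σ (i, hp i) : ℕ), w} : Finset ℕ) ∈ B) g ?_ ?_) (nb_card hΔ (univ.biUnion S) _)
    · intro i' hi'
      obtain ⟨g1, g2⟩ := hg i' hi'
      rw [pair_comm] at g2
      exact mem_coe.2 (mem_filter.2 ⟨mem_biUnion.2 ⟨i', mem_univ _, g1⟩, g2⟩)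
    · intro a ha b hb hab
      have g1 := (hg a ha).1
      have g2 := (hg b hb).1
      rw [← hab] at g2
      exact hSd a b _ g1 g2
  obtain ⟨ψ', hψi, hψA⟩ := hall_big (ι := Rb) (fun i => univ \ (Rb ∪ (f1 i ∪ f2 i))) (by
    intro i
    rw [Fintype.card_coe]
    have g1 := le_card_sdiff (Rb ∪ (f1 i ∪ f2 i)) (univ : Finset (Fin q))
    have g2 := card_union_le Rb (f1 i ∪ f2 i)
    have g3 := card_union_le (f1 i) (f2 i)
    have g4 := hf1 i
    have g5 := hf2 i
    have g6 : (s + 3) * Δ = (s + 2) * Δ + Δ := by ring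
    rw [card_univ, Fintype.card_fin] at g1
    omega)
  obtain ⟨ψ, hψ⟩ : ∃ ψ : Fin q → Fin q, ∀ i (hi : i ∈ Rb), ψ i = ψ' ⟨i, hi⟩ :=
    ⟨fun i => if hi : i ∈ Rb then ψ' ⟨i, hi⟩ else i, fun i hi => by simp [hi]⟩
  have hψinj : ∀ i ∈ Rb, ∀ i' ∈ Rb, ψ i = ψ i' → i = i' := by
    intro i hi i' hi' h
    rw [hψ i hi, hψ i' hi'] at h
    simpa using hψi h
  have hψm : ∀ i ∈ Rb, ψ i ∉ Rb ∧ ψ i ∉ f1 i ∧ ψ i ∉ f2 i := by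
    intro i hi
    have := (mem_sdiff.1 (hψA ⟨i, hi⟩)).2
    rw [← hψ i hi] at this
    simp only [mem_union, not_or] at this
    exact this
  let π : Fin q × Fin s → Fin q × Fin s := fun p =>
    if p.1 ∈ Rb ∧ p.2 = hp p.1 then (ψ p.1, z0)
    else if h : ∃ i0 ∈ Rb, ψ i0 = p.1 ∧ p.2 = z0 then (h.choose, hp h.choose) else p
  have π1 : ∀ i ∈ Rb, π (i, hp i) = (ψ i, z0) := by
    intro i hi
    simp only [π, hi, and_self, if_true]
  have π2 : ∀ i ∈ Rb, π (ψ i, z0) = (i, hp i) := by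
    intro i hi
    have g1 : ¬ (ψ i ∈ Rb ∧ z0 = hp (ψ i)) := fun h => (hψm i hi).1 h.1
    have g2 : ∃ i0 ∈ Rb, ψ i0 = ψ i ∧ z0 = z0 := ⟨i, hi, rfl, rfl⟩
    have g3 : g2.choose = i := hψinj _ g2.choose_spec.1 _ hi g2.choose_spec.2.1
    refine (if_neg g1).trans ((dif_pos g2).trans ?_)
    rw [g3]
  have π3 : ∀ p, ¬ (p.1 ∈ Rb ∧ p.2 = hp p.1) → ¬ (∃ i0 ∈ Rb, ψ i0 = p.1 ∧ p.2 = z0) → π p = p := by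
    intro p g1 g2
    simp only [π]
    rw [if_neg g1, dif_neg g2]
  have πinv : ∀ p, π (π p) = p := by
    intro p
    by_cases g1 : p.1 ∈ Rb ∧ p.2 = hp p.1
    · have : p = (p.1, hp p.1) := Prod.ext rfl g1.2
      rw [this, π1 _ g1.1, π2 _ g1.1]
    · by_cases g2 : ∃ i0 ∈ Rb, ψ i0 = p.1 ∧ p.2 = z0
      · obtain ⟨i0, hi0, e1, e2⟩ := g2
        have : p = (ψ i0, z0) := Prod.ext e1.symm e2
        rw [this, π2 _ hi0, π1 _ hi0]
      · rw [π3 p g1 g2, π3 p g1 g2]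
  have key : ∀ i, ∃ h0, (∀ h, h ≠ h0 → σ (π (i, h)) = σ (i, h)) ∧
      (∀ h, h ≠ h0 → ¬ BadP B (Fr i) (fun h => σ (i, h)) h) ∧
      (∀ v ∈ Fr i, ({v, (σ (π (i, h0)) : ℕ)} : Finset ℕ) ∉ B) ∧
      (∀ h, h ≠ h0 → ({(σ (i, h) : ℕ), (σ (π (i, h0)) : ℕ)} : Finset ℕ) ∉ B) := by
    intro i
    by_cases hi : i ∈ Rb
    · refine ⟨hp i, ?_, hgoodR i hi, ?_, ?_⟩
      · intro h hh
        rw [π3]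
        · exact fun g => hh g.2
        · rintro ⟨i0, hi0, e1, -⟩
          exact (hψm i0 hi0).1 (e1 ▸ hi)
      · intro v hv hB
        rw [π1 i hi] at hB
        exact (hψm i hi).2.1 (mem_filter.2 ⟨mem_univ _, v, mem_union_left _ hv, hB⟩)
      · intro h _ hB
        rw [π1 i hi] at hB
        exact (hψm i hi).2.1 (mem_filter.2 ⟨mem_univ _, _,
          mem_union_right _ (mem_image_of_mem _ (mem_univ h)), hB⟩)
    · by_cases hψe : ∃ i0 ∈ Rb, ψ i0 = i
      · obtain ⟨i0, hi0, rfl⟩ := hψe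
        refine ⟨z0, ?_, fun h _ => hgoodC _ hi h, ?_, ?_⟩
        · intro h hh
          rw [π3]
          · exact fun g => hi g.1
          · rintro ⟨i1, hi1, -, e1⟩
            exact hh e1
        · intro v hv hB
          rw [π2 i0 hi0] at hB
          exact (hψm i0 hi0).2.2 (mem_filter.2 ⟨mem_univ _, v, mem_union_left _ hv, hB⟩)
        · intro h _ hB
          rw [π2 i0 hi0] at hB
          exact (hψm i0 hi0).2.2 (mem_filter.2 ⟨mem_univ _, _,
            mem_union_right _ (mem_image_of_mem _ (mem_univ h)), hB⟩)
      · have e : ∀ h, π (i, h) = (i, h) := by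
          intro h
          rw [π3]
          · exact fun g => hi g.1
          · rintro ⟨i1, hi1, e1, -⟩
            exact hψe ⟨i1, hi1, e1⟩
        refine ⟨z0, fun h _ => by rw [e], fun h _ => hgoodC _ hi h, ?_, ?_⟩
        · rw [e]
          exact not_bad_fr (hgoodC i hi z0)
        · intro h hh
          rw [e]
          exact not_bad_pair (hgoodC i hi h) (hgoodC i hi z0) hh
  refine ⟨fun p => σ (π p), ?_, ?_, ?_, ?_⟩
  · intro p p' hpp
    have := σ.injective hpp
    rw [← πinv p, ← πinv p', this]
  · intro i h
    obtain ⟨h0, k1, k2, k3, k4⟩ := key i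
    by_cases hh : h = h0
    · rw [hh]; exact k3
    · simp only
      rw [k1 h hh]
      exact not_bad_fr (k2 h hh)
  · intro i h h' hne
    obtain ⟨h0, k1, k2, k3, k4⟩ := key i
    simp only
    by_cases hh : h = h0
    · have hh' : h' ≠ h0 := fun e => hne (hh.trans e.symm)
      rw [hh, k1 h' hh', pair_comm]
      exact k4 h' hh'
    · by_cases hh' : h' = h0
      · rw [hh', k1 h hh]
        exact k4 h hh
      · rw [k1 h hh, k1 h' hh']
        exact not_bad_pair (k2 h hh) (k2 h' hh') hne
  · intro i
    obtain ⟨h0, k1, -⟩ := key i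
    exact ⟨h0, k1⟩

theorem num_facts {k : ℕ} (hk : 2 ≤ k) (c : ℝ) (hc : 0 < c) (n0 : ℕ) :
    ∃ t0 : ℕ, ∀ t, t0 ≤ t → ∀ s q D Δ : ℕ, s + 2 = t * (k - 1) + 1 → q = t ^ (100 * k) →
      Δ = 2 * t * k ^ 2 → D = (s + 2) * Δ →
      n0 ≤ s ∧ 1 ≤ s ∧ 1 ≤ t ∧ 0 < q ∧ 2 * ((s + 3) * Δ) ≤ q ∧ 2 * s ^ 2 ≤ q * s ∧
      2 * (q : ℝ) * ((((s + 2) * q : ℕ) : ℝ) * Real.exp (-(c * s)) +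
        (((s * D) ^ 2 : ℕ) : ℝ) / (((q * s) ^ 2 : ℕ) : ℝ)) +
        8 * (((s * D : ℕ) : ℝ) / ((q * s : ℕ) : ℝ)) < 1 := by
  obtain ⟨N1, hN1⟩ := exp_beats (2 * k) (c / 4) (200 * k + 1) (by positivity)
  obtain ⟨N2, hN2⟩ := exp_small (c / 4) (1 / 4) (by positivity) (by norm_num)
  refine ⟨N1 + N2 + n0 + 64 * k ^ 3 + 4, fun t ht s q D Δ hs hq hΔ hD => ?_⟩
  have hk3 : 0 < k ^ 3 := by positivity
  have htk : t ≤ t * (k - 1) := Nat.le_mul_of_pos_right _ (by omega)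
  have htk2 : t * (k - 1) + t = t * k := by
    rw [← Nat.mul_succ]; congr 1; omega
  have hq8 : t ^ 8 ≤ q := by rw [hq]; exact Nat.pow_le_pow_right (by omega) (by omega)
  have hDt : D ≤ t ^ 3 := by
    have h1 : D ≤ (t * k) * (2 * t * k ^ 2) := by
      rw [hD, hΔ]; exact Nat.mul_le_mul_right _ (by omega)
    have h2 : (t * k) * (2 * t * k ^ 2) = (2 * k ^ 3) * t ^ 2 := by ring
    have h3 : (2 * k ^ 3) * t ^ 2 ≤ t * t ^ 2 := Nat.mul_le_mul_right _ (by omega)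
    calc D ≤ _ := h1
      _ = _ := h2
      _ ≤ _ := h3
      _ = t ^ 3 := by ring
  have ht4 : 4 ≤ t := by omega
  have h35 : 4 * t ^ 3 ≤ t ^ 8 := by
    calc 4 * t ^ 3 ≤ t * t ^ 3 := Nat.mul_le_mul_right _ ht4
      _ = t ^ 4 := by ring
      _ ≤ t ^ 8 := Nat.pow_le_pow_right (by omega) (by omega)
  have hq0 : 0 < q := lt_of_lt_of_le (by positivity) hq8
  have hs1 : 1 ≤ s := by omega
  have hΔD : Δ ≤ D := by rw [hD]; exact Nat.le_mul_of_pos_left _ (by omega)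
  have hs3 : (s + 3) * Δ = D + Δ := by rw [hD]; ring
  have hΔ1 : 0 < Δ := by rw [hΔ]; positivity
  have hsD : s ≤ D := by
    rw [hD]
    exact le_trans (by omega) (Nat.le_mul_of_pos_right (s + 2) hΔ1)
  refine ⟨by omega, hs1, by omega, hq0, by omega, ?_, ?_⟩
  · rw [sq, ← mul_assoc]
    exact Nat.mul_le_mul_right _ (by omega)
  have hsR : (0 : ℝ) < s := by exact_mod_cast hs1
  have hqR : (0 : ℝ) < q := by exact_mod_cast hq0
  have htR : (4 : ℝ) ≤ t := by exact_mod_cast ht4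
  have hDR : (D : ℝ) ≤ (t : ℝ) ^ 3 := by exact_mod_cast hDt
  have hqR8 : (t : ℝ) ^ 8 ≤ q := by exact_mod_cast hq8
  have e2 : 2 * (q : ℝ) * ((((s * D) ^ 2 : ℕ) : ℝ) / (((q * s) ^ 2 : ℕ) : ℝ)) ≤ 1 / 8 := by
    have : 2 * (q : ℝ) * ((((s * D) ^ 2 : ℕ) : ℝ) / (((q * s) ^ 2 : ℕ) : ℝ)) = 2 * (D : ℝ) ^ 2 / q := by
      push_cast
      field_simp
    rw [this, div_le_iff₀ hqR]
    have g1 : (D : ℝ) ^ 2 ≤ ((t : ℝ) ^ 3) ^ 2 := by gcongr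
    have g2 : (16 : ℝ) * ((t : ℝ) ^ 3) ^ 2 ≤ (t : ℝ) ^ 8 := by
      have : (t : ℝ) ^ 8 = (t : ℝ) ^ 2 * ((t : ℝ) ^ 3) ^ 2 := by ring
      rw [this]
      gcongr
      nlinarith
    linarith
  have e3 : 8 * (((s * D : ℕ) : ℝ) / ((q * s : ℕ) : ℝ)) ≤ 1 / 8 := by
    have : 8 * (((s * D : ℕ) : ℝ) / ((q * s : ℕ) : ℝ)) = 8 * D / q := by
      push_cast
      field_simp
    rw [this, div_le_iff₀ hqR]
    have g2 : (64 : ℝ) * (t : ℝ) ^ 3 ≤ (t : ℝ) ^ 8 := by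
      have h1 : (t : ℝ) ^ 8 = (t : ℝ) ^ 5 * (t : ℝ) ^ 3 := by ring
      have h2 : (4 : ℝ) ^ 5 ≤ (t : ℝ) ^ 5 := by gcongr
      rw [h1]
      gcongr
      norm_num at h2 ⊢
      linarith
    linarith
  have e1 : 2 * (q : ℝ) * ((((s + 2) * q : ℕ) : ℝ) * Real.exp (-(c * s))) ≤ 1 / 4 := by
    have g1 := hN1 t (by omega)
    have g2 := hN2 t (by omega)
    have hst : (t : ℝ) ≤ 2 * s := by exact_mod_cast (show t ≤ 2 * s by omega)
    have g3 : Real.exp (-(c * s)) ≤ Real.exp (-(2 * (c / 4) * t)) := by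
      apply Real.exp_le_exp.2
      nlinarith
    have hsk : ((s + 2 : ℕ) : ℝ) ≤ (t : ℝ) * k := by exact_mod_cast (show s + 2 ≤ t * k by omega)
    have g4 : 2 * (q : ℝ) * ((((s + 2) * q : ℕ) : ℝ)) ≤ 2 * k * ((t : ℝ) + 1) ^ (200 * k + 1) := by
      have h1 : 2 * (q : ℝ) * ((((s + 2) * q : ℕ) : ℝ)) = 2 * ((s + 2 : ℕ) : ℝ) * (q : ℝ) ^ 2 := by
        rw [Nat.cast_mul]; ring
      have h2 : (q : ℝ) ^ 2 = (t : ℝ) ^ (200 * k) := by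
        rw [hq]; push_cast; rw [← pow_mul]; congr 1; ring
      rw [h1, h2]
      calc 2 * ((s + 2 : ℕ) : ℝ) * (t : ℝ) ^ (200 * k) ≤ 2 * ((t : ℝ) * k) * (t : ℝ) ^ (200 * k) := by
            gcongr
        _ = 2 * k * (t : ℝ) ^ (200 * k + 1) := by rw [pow_succ]; ring
        _ ≤ _ := by gcongr; linarith
    calc _ = 2 * (q : ℝ) * ((((s + 2) * q : ℕ) : ℝ)) * Real.exp (-(c * s)) := by ring
      _ ≤ 2 * k * ((t : ℝ) + 1) ^ (200 * k + 1) * Real.exp (-(2 * (c / 4) * t)) := by gcongr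
      _ ≤ _ := g1
      _ ≤ _ := g2
  rw [mul_add]
  linarith

theorem row_deg {k j s : ℕ} (hjk : j < k) {β B' : ℝ} (hB' : 0 ≤ B')
    (has : B' * ((s : ℝ) + 3) ^ (k - j) + 1 * ((s : ℝ) + 3) ^ (k - j - 1) ≤
      β * ((s : ℝ) - 0) ^ (k - j))
    {G : HGraph k} {W : Finset ℕ} {a b : ℕ} (haV : a ∈ G.verts) (haW : a ∉ W) (hbW : b ∉ W)
    (hW : W ⊆ G.verts) (r x : Fin s → W) (hr : Function.Injective r) (hx : Function.Injective x)
    (h0 : Fin s) (hrx : ∀ h, h ≠ h0 → x h = r h)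
    (hgood : ∀ y ∈ G.verts, r ∉ badS G j s W {a, b, y} (β * (s : ℝ) ^ (k - j))) :
    G.MinDegOnGe j ({a, b} ∪ univ.image (fun h => (x h : ℕ)))
      (B' * ((s + 2 : ℕ) : ℝ) ^ (k - j)) := by
  set S' := {a, b} ∪ univ.image (fun h => (x h : ℕ)) with hS'
  obtain ⟨y, hyV, hyr, hxy⟩ : ∃ y ∈ G.verts, (∀ h, (r h : ℕ) ≠ y) ∧
      ∀ h, (x h : ℕ) = y ∨ ∃ h', (x h : ℕ) = r h' := by
    by_cases he : ∃ h', x h0 = r h'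
    · refine ⟨a, haV, fun h e => haW (e ▸ (r h).2), fun h => Or.inr ?_⟩
      by_cases hh : h = h0
      · obtain ⟨h', e⟩ := he
        exact ⟨h', by rw [hh, e]⟩
      · exact ⟨h, by rw [hrx h hh]⟩
    · refine ⟨x h0, hW (x h0).2, fun h e => he ⟨h, Subtype.ext e.symm⟩, fun h => ?_⟩
      by_cases hh : h = h0
      · left; rw [hh]
      · exact Or.inr ⟨h, by rw [hrx h hh]⟩
  have h1 : G.MinDegOnGe j ({a, b, y} ∪ univ.image (fun i => (r i : ℕ)))
      (β * (s : ℝ) ^ (k - j)) := by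
    by_contra hcon
    apply hgood y hyV
    refine mem_filter.2 ⟨mem_univ _, hr, fun i hi => ?_, hcon⟩
    simp only [mem_insert, mem_singleton] at hi
    rcases hi with e | e | e
    · exact haW (e ▸ (r i).2)
    · exact hbW (e ▸ (r i).2)
    · exact hyr i e
  set U' := {a, b, y} ∪ univ.image (fun i => (r i : ℕ)) with hU'
  have hsub : S' ⊆ U' := by
    intro v hv
    simp only [hS', hU', mem_union, mem_insert, mem_singleton, mem_image, mem_univ, true_and] at hv ⊢
    rcases hv with (h | h) | ⟨h, rfl⟩
    · tauto
    · tauto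
    · rcases hxy h with e | ⟨h', e⟩
      · tauto
      · exact Or.inr ⟨h', e.symm⟩
  have hU'c : U'.card ≤ s + 3 := by
    refine (card_union_le _ _).trans ?_
    have g1 : (univ.image (fun i => (r i : ℕ))).card ≤ s := card_image_le.trans (by simp)
    have g2 : ({a, b, y} : Finset ℕ).card ≤ 3 := card_le_three
    omega
  have hXc : (U' \ S').card ≤ 1 := by
    have hS'c : S'.card = ({a, b} : Finset ℕ).card + s := by
      have hinj : Function.Injective (fun h => (x h : ℕ)) := fun p p' e => hx (Subtype.ext e)
      rw [hS', card_union_of_disjoint, card_image_of_injective univ hinj, card_univ,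
        Fintype.card_fin]
      rw [disjoint_left]
      intro v hv hv'
      obtain ⟨h, -, rfl⟩ := mem_image.1 hv'
      simp only [mem_insert, mem_singleton] at hv
      rcases hv with e | e
      · exact haW (e ▸ (x h).2)
      · exact hbW (e ▸ (x h).2)
    have hU'c' : U'.card ≤ ({a, b} : Finset ℕ).card + 1 + s := by
      refine (card_union_le _ _).trans ?_
      have g1 : (univ.image (fun i => (r i : ℕ))).card ≤ s := card_image_le.trans (by simp)
      have g2 : ({a, b, y} : Finset ℕ).card ≤ ({a, b} : Finset ℕ).card + 1 := by
        have : ({a, b, y} : Finset ℕ) = insert y {a, b} := by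
          ext v; simp only [mem_insert, mem_singleton]; tauto
        rw [this]
        exact card_insert_le _ _
      omega
    have := card_sdiff_add_card_eq_card hsub
    omega
  have h2 := MinDegOn_del hjk G U' (U' \ S') _ h1
  rw [Finset.sdiff_sdiff_eq_self hsub] at h2
  intro T hT hTc
  refine le_trans ?_ (h2 T hT hTc)
  rw [sub_zero] at has
  have g1 : ((U' \ S').card : ℝ) * (U'.card : ℝ) ^ (k - j - 1) ≤ 1 * ((s : ℝ) + 3) ^ (k - j - 1) := by
    have : (U'.card : ℝ) ≤ (s : ℝ) + 3 := by exact_mod_cast hU'c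
    gcongr
    exact_mod_cast hXc
  have g2 : B' * ((s + 2 : ℕ) : ℝ) ^ (k - j) ≤ B' * ((s : ℝ) + 3) ^ (k - j) := by
    gcongr
    push_cast
    linarith
  linarith

theorem W_deg {k j s q : ℕ} (hjk : j < k) {δ e' : ℝ} (hδ : 0 ≤ δ) (he : 0 < e') {G : HGraph k}
    (hV : G.verts.card = (s + 2) * q) {U : Finset ℕ} (hU : U.card = 2 * q)
    (hs : 32 ≤ e' * ((s : ℝ) + 2))
    (hdeg : G.MinDegGe j ((δ + e' / 4) * (((s + 2) * q : ℕ) : ℝ) ^ (k - j))) :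
    ∀ Q ⊆ G.verts, Q.card = j →
      (δ + e' / 8 + e' / 16) * ((G.verts \ U).card : ℝ) ^ (k - j) ≤ G.degIn Q (G.verts \ U) := by
  intro Q hQ hQc
  have h1 := degIn_ge G Q U (by omega)
  have h2 := hdeg Q hQ hQc
  rw [hQc, hV, hU] at h1
  have h3 : ((G.verts \ U).card : ℝ) ≤ (((s + 2) * q : ℕ) : ℝ) := by
    rw [← hV]; exact_mod_cast card_le_card sdiff_subset
  have h4 : ((2 * q : ℕ) : ℝ) ≤ e' / 16 * (((s + 2) * q : ℕ) : ℝ) := by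
    push_cast
    nlinarith [mul_le_mul_of_nonneg_right hs (Nat.cast_nonneg (α := ℝ) q)]
  set m : ℝ := (((s + 2) * q : ℕ) : ℝ)
  have hm : 0 ≤ m := Nat.cast_nonneg _
  have h5 : ((2 * q : ℕ) : ℝ) * m ^ (k - j - 1) ≤ e' / 16 * m ^ (k - j) := by
    have : m ^ (k - j) = m * m ^ (k - j - 1) := by rw [← pow_succ']; congr 1; omega
    rw [this, ← mul_assoc]
    gcongr
  calc (δ + e' / 8 + e' / 16) * ((G.verts \ U).card : ℝ) ^ (k - j)
      ≤ (δ + e' / 8 + e' / 16) * m ^ (k - j) := by gcongr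
    _ ≤ _ := by linarith

theorem tile_row {k j s t : ℕ} (hk : 2 ≤ k) (hst : s + 2 = t * (k - 1) + 1) {d : ℝ} {n0 : ℕ}
    (hs : n0 ≤ s)
    (hHC : ∀ G : HGraph k, n0 ≤ G.verts.card → (k - 1) ∣ G.verts.card - 1 →
      G.MinDegGe j (d * (G.verts.card : ℝ) ^ (k - j)) →
      ∀ a ∈ G.verts, ∀ b ∈ G.verts, a ≠ b →
      LP {e | e ∈ G.edges ∧ ¬ (a ∈ e ∧ b ∈ e)} a b (G.verts.erase b))
    {G : HGraph k} {S : Finset ℕ} (hS : S ⊆ G.verts) (hSc : S.card = s + 2)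
    (hdeg : G.MinDegOnGe j S (d * ((s + 2 : ℕ) : ℝ) ^ (k - j))) {a b : ℕ} (ha : a ∈ S) (hb : b ∈ S)
    (hab : a ≠ b) :
    ∃ P : LoosePath k t G, P.verts = S ∧ P.endA = a ∧ P.endB = b ∧
      ∀ e ∈ P.edgeSet, e ⊆ S ∧ ¬ (a ∈ e ∧ b ∈ e) := by
  let H : HGraph k := ⟨S, G.inducedEdges S, fun e he => (mem_filter.1 he).2,
    fun e he => G.edge_card e (mem_filter.1 he).1⟩
  have h := hHC H (by change n0 ≤ S.card; omega)
    (by change (k - 1) ∣ S.card - 1; rw [hSc, hst]; exact ⟨t, by rw [Nat.add_sub_cancel, mul_comm]⟩)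
    (by
      intro T hT hTc
      change d * (S.card : ℝ) ^ (k - j) ≤ _
      rw [hSc]
      exact hdeg T hT hTc) a ha b hb hab
  have hins : insert b (S.erase b) = S := insert_erase hb
  obtain ⟨l, P, h1, h2, h3, h4, h5⟩ := LP.toLoosePath hk
    (G := G) (E := {e | e ∈ H.edges ∧ ¬ (a ∈ e ∧ b ∈ e)})
    (fun e he => (mem_filter.1 he.1).1) h (by change insert b (S.erase b) ⊆ _; rw [hins]; exact hS)
  have hl : l = t := by
    change (S.erase b).card = _ at h1
    rw [card_erase_of_mem hb, hSc, hst, Nat.add_sub_cancel] at h1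
    exact (Nat.eq_of_mul_eq_mul_right (by omega) h1).symm
  subst hl
  refine ⟨P, h2.trans hins, h3, h4, fun e he => ?_⟩
  exact ⟨(mem_filter.1 (h5 e he).1).2, (h5 e he).2⟩

theorem core {k j s q t Δ n0 : ℕ} (hk : 2 ≤ k) (hjk : j < k) {β B' c : ℝ}
    (hB' : 0 ≤ B') (hst : s + 2 = t * (k - 1) + 1) (hs0 : 1 ≤ s) (hq0 : 0 < q) (hn0 : n0 ≤ s)
    (hqd : 2 * ((s + 3) * Δ) ≤ q) (hqs : 2 * s ^ 2 ≤ q * s)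
    (hnum : 2 * (q : ℝ) * ((((s + 2) * q : ℕ) : ℝ) * Real.exp (-(c * s)) +
        (((s * ((s + 2) * Δ)) ^ 2 : ℕ) : ℝ) / (((q * s) ^ 2 : ℕ) : ℝ)) +
        8 * (((s * ((s + 2) * Δ) : ℕ) : ℝ) / ((q * s : ℕ) : ℝ)) < 1)
    (has : B' * ((s : ℝ) + 3) ^ (k - j) + 1 * ((s : ℝ) + 3) ^ (k - j - 1) ≤
      β * ((s : ℝ) - 0) ^ (k - j))
    (hHC : ∀ G : HGraph k, n0 ≤ G.verts.card → (k - 1) ∣ G.verts.card - 1 →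
      G.MinDegGe j (B' * (G.verts.card : ℝ) ^ (k - j)) →
      ∀ a ∈ G.verts, ∀ b ∈ G.verts, a ≠ b →
      LP {e | e ∈ G.edges ∧ ¬ (a ∈ e ∧ b ∈ e)} a b (G.verts.erase b))
    {G : HGraph k} (hV : G.verts.card = (s + 2) * q) {ua ub : Fin q → ℕ}
    (hu : ∀ i, ua i ∈ G.verts ∧ ub i ∈ G.verts ∧ ua i ≠ ub i)
    (hd : ∀ i i' : Fin q, i ≠ i' → Disjoint ({ua i, ub i} : Finset ℕ) {ua i', ub i'})
    {W : Finset ℕ} (hW : W = G.verts \ univ.biUnion fun i => {ua i, ub i}) (hWc : W.card = q * s)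
    (hsamp : ∀ F ⊆ G.verts, F.card ≤ 3 →
      ((badS G j s W F (β * (s : ℝ) ^ (k - j))).card : ℝ) ≤
        Real.exp (-(c * s)) * (W.card : ℝ) ^ s)
    {B : Finset (Finset ℕ)} (hB : ∀ b ∈ B, b ⊆ G.verts ∧ b.card = 2)
    (hΔ : ∀ v : ℕ, (B.filter fun b => v ∈ b).card ≤ Δ) :
    ∃ (P : Fin q → LoosePath k t G),
      (∀ i i' : Fin q, i ≠ i' → Disjoint (P i).verts (P i').verts) ∧
      (Finset.univ.biUnion (fun i => (P i).verts) = G.verts) ∧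
      (∀ i, ({(P i).endA, (P i).endB} : Finset ℕ) = {ua i, ub i}) ∧
      (∀ i, ∀ e ∈ (P i).edgeSet, ∀ b ∈ B, ¬ b ⊆ e) := by
  have hWV : W ⊆ G.verts := hW ▸ sdiff_subset
  have haW : ∀ i, ua i ∉ W := fun i h => by
    rw [hW, mem_sdiff] at h
    exact h.2 (mem_biUnion.2 ⟨i, mem_univ _, by simp⟩)
  have hbW : ∀ i, ub i ∉ W := fun i h => by
    rw [hW, mem_sdiff] at h
    exact h.2 (mem_biUnion.2 ⟨i, mem_univ _, by simp⟩)
  have hFc : ∀ i, ({ua i, ub i} : Finset ℕ).card ≤ 2 := fun i => card_le_two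
  have hFW : ∀ i, Disjoint ({ua i, ub i} : Finset ℕ) W := fun i => by
    rw [disjoint_left]
    intro v hv
    simp only [mem_insert, mem_singleton] at hv
    rcases hv with rfl | rfl
    · exact haW i
    · exact hbW i
  have hqs0 : (0 : ℝ) < ((q * s : ℕ) : ℝ) := by
    exact_mod_cast Nat.mul_pos hq0 hs0
  obtain ⟨σ, hσ1, hσ2⟩ := avg hWc hqs hq0 hs0
    (fun i => (G.verts.biUnion fun y => badS G j s W {ua i, ub i, y} (β * (s : ℝ) ^ (k - j))) ∪
      univ.filter fun x : Fin s → W => ∃ h h', h < h' ∧ BadP B {ua i, ub i} x h ∧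
        BadP B {ua i, ub i} x h')
    (fun i => univ.filter fun x : Fin s → W => ∃ h, BadP B {ua i, ub i} x h) _ _
    (by
      intro i
      have e1 : ((G.verts.biUnion fun y => badS G j s W {ua i, ub i, y}
          (β * (s : ℝ) ^ (k - j))).card : ℝ) ≤
          (((s + 2) * q : ℕ) : ℝ) * Real.exp (-(c * s)) * ((q * s : ℕ) : ℝ) ^ s := by
        calc _ ≤ ∑ y ∈ G.verts, ((badS G j s W {ua i, ub i, y}
          (β * (s : ℝ) ^ (k - j))).card : ℝ) := by exact_mod_cast card_biUnion_le
          _ ≤ ∑ y ∈ G.verts, Real.exp (-(c * s)) * ((q * s : ℕ) : ℝ) ^ s := by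
            refine sum_le_sum fun y hy => ?_
            rw [← hWc]
            refine hsamp _ ?_ card_le_three
            intro v hv
            simp only [mem_insert, mem_singleton] at hv
            rcases hv with rfl | rfl | rfl
            · exact (hu i).1
            · exact (hu i).2.1
            · exact hy
          _ = _ := by rw [sum_const, hV, nsmul_eq_mul, mul_assoc]
      have e2 := two_bad hΔ (hFc i) (s := s) (W := W)
      have e3 : ((univ.filter fun x : Fin s → W => ∃ h h', h < h' ∧ BadP B {ua i, ub i} x h ∧
        BadP B {ua i, ub i} x h').card : ℝ) ≤
          (((s * ((s + 2) * Δ)) ^ 2 : ℕ) : ℝ) / (((q * s) ^ 2 : ℕ) : ℝ) *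
            ((q * s : ℕ) : ℝ) ^ s := by
        rw [hWc] at e2
        rw [div_mul_eq_mul_div, le_div_iff₀ (by push_cast at hqs0 ⊢; positivity)]
        exact_mod_cast e2
      rw [add_mul]
      refine le_trans ?_ (add_le_add e1 e3)
      exact_mod_cast card_union_le _ _)
    (by
      intro i
      have e2 := one_bad hΔ (hFc i) (s := s) (W := W)
      rw [hWc] at e2
      rw [div_mul_eq_mul_div, le_div_iff₀ hqs0]
      exact_mod_cast e2)
    hnum
  obtain ⟨x, hxi, hx1, hx2, hx3⟩ := swap_fix hΔ hs0 σ (fun i => {ua i, ub i}) hFc hd hFW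
    (fun i hcon => hσ1 i (mem_union_right _ (by simpa only [mem_filter, mem_univ, true_and] using hcon)))
    (by simpa only [mem_filter, mem_univ, true_and] using hσ2) hqd
  let S : Fin q → Finset ℕ := fun i => {ua i, ub i} ∪ univ.image (fun h => (x (i, h) : ℕ))
  have hSdef : ∀ i, S i = {ua i, ub i} ∪ univ.image (fun h => (x (i, h) : ℕ)) := fun i => rfl
  have hmem : ∀ i v, v ∈ S i ↔ (v = ua i ∨ v = ub i) ∨ ∃ h, (x (i, h) : ℕ) = v := by
    intro i v
    simp only [hSdef, mem_union, mem_insert, mem_singleton, mem_image, mem_univ, true_and]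
  have hSV : ∀ i, S i ⊆ G.verts := by
    intro i v hv
    rcases (hmem i v).1 hv with (rfl | rfl) | ⟨h, rfl⟩
    · exact (hu i).1
    · exact (hu i).2.1
    · exact hWV (x (i, h)).2
  have hinj : ∀ i, Function.Injective (fun h => x (i, h)) := fun i h h' e =>
    (Prod.mk.inj (hxi e)).2
  have hinj' : ∀ i, Function.Injective (fun h => (x (i, h) : ℕ)) := fun i h h' e =>
    hinj i (Subtype.ext e)
  have hSc : ∀ i, (S i).card = s + 2 := by
    intro i
    rw [hSdef, card_union_of_disjoint, card_image_of_injective univ (hinj' i), card_univ,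
      Fintype.card_fin, card_pair (hu i).2.2, add_comm]
    refine disjoint_of_subset_right ?_ (hFW i)
    intro v hv
    obtain ⟨h, -, rfl⟩ := mem_image.1 hv
    exact (x (i, h)).2
  have hdegS : ∀ i, G.MinDegOnGe j (S i) (B' * ((s + 2 : ℕ) : ℝ) ^ (k - j)) := by
    intro i
    obtain ⟨h0, hh0⟩ := hx3 i
    refine row_deg hjk hB' has (hu i).1 (haW i) (hbW i) hWV (fun h => σ (i, h))
      (fun h => x (i, h)) (fun h h' e => (Prod.mk.inj (σ.injective e)).2) (hinj i) h0 hh0 ?_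
    intro y hy hcon
    exact hσ1 i (mem_union_left _ (mem_biUnion.2 ⟨y, hy, hcon⟩))
  have hP : ∀ i, ∃ P : LoosePath k t G, P.verts = S i ∧ P.endA = ua i ∧ P.endB = ub i ∧
      ∀ e ∈ P.edgeSet, e ⊆ S i ∧ ¬ (ua i ∈ e ∧ ub i ∈ e) := fun i =>
    tile_row hk hst hn0 hHC (hSV i) (hSc i) (hdegS i) ((hmem _ _).2 (by simp))
      ((hmem _ _).2 (by simp)) (hu i).2.2
  choose P hP1 hP2 hP3 hP4 using hP
  have hdisj : ∀ i i' : Fin q, i ≠ i' → Disjoint (S i) (S i') := by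
    intro i i' hii
    rw [disjoint_left]
    intro v hv hv'
    have hdd : v ∈ ({ua i, ub i} : Finset ℕ) → v ∉ ({ua i', ub i'} : Finset ℕ) :=
      fun h => disjoint_left.1 (hd i i' hii) h
    simp only [mem_insert, mem_singleton] at hdd
    rcases (hmem i v).1 hv with h | ⟨h, e⟩ <;> rcases (hmem i' v).1 hv' with h' | ⟨h', e'⟩
    · exact hdd h h'
    · have : v ∈ W := e' ▸ (x (i', h')).2
      rcases h with rfl | rfl
      · exact haW _ this
      · exact hbW _ this
    · have : v ∈ W := e ▸ (x (i, h)).2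
      rcases h' with rfl | rfl
      · exact haW _ this
      · exact hbW _ this
    · exact hii (Prod.mk.inj (hxi (Subtype.ext (e.trans e'.symm)))).1
  refine ⟨P, fun i i' hii => ?_, ?_, fun i => by rw [hP2, hP3], fun i e he b hb hbe => ?_⟩
  · rw [hP1, hP1]; exact hdisj i i' hii
  · simp only [hP1]
    refine eq_of_subset_of_card_le (biUnion_subset.2 fun i _ => hSV i) ?_
    rw [card_biUnion (fun i _ i' _ h => hdisj i i' h), sum_congr rfl (fun i _ => hSc i), sum_const,
      card_univ, Fintype.card_fin, hV, smul_eq_mul, mul_comm]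
  · obtain ⟨heS, hab⟩ := hP4 i e he
    obtain ⟨u, v, huv, rfl⟩ := card_eq_two.1 (hB b hb).2
    have hue : u ∈ e := hbe (by simp)
    have hve : v ∈ e := hbe (by simp)
    have key : ∀ w h, (w = ua i ∨ w = ub i) → ({w, (x (i, h) : ℕ)} : Finset ℕ) ∉ B :=
      fun w h hw => hx1 i h w (by simpa only [mem_insert, mem_singleton] using hw)
    rcases (hmem i u).1 (heS hue) with h | ⟨h, rfl⟩ <;>
      rcases (hmem i v).1 (heS hve) with h' | ⟨h', rfl⟩
    · rcases h with rfl | rfl <;> rcases h' with rfl | rfl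
      · exact huv rfl
      · exact hab ⟨hue, hve⟩
      · exact hab ⟨hve, hue⟩
      · exact huv rfl
    · exact key u h' h hb
    · exact key v h h' (by rwa [pair_comm] at hb)
    · exact hx2 i h h' (fun e => huv (by rw [e])) hb

/-- Lemma: path tilings. -/
theorem path_tilings (j k : ℕ) (hj : 1 ≤ j) (hjk : j < k) (ε : ℝ) (hε : 0 < ε) :
    ∃ t₀ : ℕ, ∀ t : ℕ, t₀ ≤ t →
      ∀ G' : HGraph k, G'.verts.card = mOf k t →
        G'.MinDegGe j ((looseHamThreshold j k + ε / 4) * (mOf k t : ℝ) ^ (k - j)) →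
        ∀ ua ub : Fin (mtOf k t) → ℕ,
          (∀ i, ua i ∈ G'.verts ∧ ub i ∈ G'.verts ∧ ua i ≠ ub i) →
          (∀ i i' : Fin (mtOf k t), i ≠ i' →
            Disjoint ({ua i, ub i} : Finset ℕ) {ua i', ub i'}) →
          ∀ B : Finset (Finset ℕ), (∀ b ∈ B, b ⊆ G'.verts ∧ b.card = 2) →
            (∀ v : ℕ, (B.filter fun b => v ∈ b).card ≤ 2 * t * k ^ 2) →
            ∃ (ℓ : Fin (mtOf k t) → ℕ)
              (P : (i : Fin (mtOf k t)) → LoosePath k (ℓ i) G'),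
              (∀ i, 1 ≤ ℓ i ∧ ℓ i ≤ 2 * t) ∧
              (∀ i i' : Fin (mtOf k t), i ≠ i' → Disjoint (P i).verts (P i').verts) ∧
              (Finset.univ.biUnion (fun i => (P i).verts) = G'.verts) ∧
              (∀ i, ({(P i).endA, (P i).endB} : Finset ℕ) = {ua i, ub i}) ∧
              (∀ i, ∀ e ∈ (P i).edgeSet, ∀ b ∈ B, ¬ b ⊆ e) := by
  have hk : 2 ≤ k := by omega
  have hδ := thr_nonneg j k
  set δ := looseHamThreshold j k with hδdef
  set e' := min ε 1 with he'
  have he0 : 0 < e' := lt_min hε one_pos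
  have heε : e' ≤ ε := min_le_left _ _
  have he1 : e' ≤ 1 := min_le_right _ _
  obtain ⟨c, hc, N0, hsamp⟩ := sampling hjk (δ + e' / 8) (e' / 16) (by positivity) (by positivity)
    (by linarith) 3
  obtain ⟨N1, has⟩ := asym (δ + e' / 8) (δ + e' / 16) 1 0 3 (k - j) (by omega) (by linarith)
  obtain ⟨n0, hHC⟩ := HC hj hjk (e' / 16) (by positivity)
  obtain ⟨t0, hnum⟩ := num_facts hk c hc (N0 + N1 + n0 + ⌈32 / e'⌉₊)
  refine ⟨t0 + 1, fun t ht G' hV hdeg => ?_⟩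
  obtain ⟨s, hs⟩ : ∃ s, s + 2 = t * (k - 1) + 1 := by
    have : 1 ≤ t * (k - 1) := Nat.mul_pos (by omega) (by omega)
    exact ⟨t * (k - 1) - 1, by omega⟩
  have hm : mOf k t = (s + 2) * mtOf k t := by rw [hs]; rfl
  have hq : mtOf k t = t ^ (100 * k) := rfl
  rw [hm] at hV hdeg
  clear hm
  generalize mtOf k t = q at hV hdeg hq ⊢
  intro ua ub hu hd B hB hΔ
  obtain ⟨f1, f2, f3, f4, f5, f6, f7⟩ := hnum t (by omega) s q _ _ hs hq rfl rfl
  have hUc : (univ.biUnion fun i => ({ua i, ub i} : Finset ℕ)).card = 2 * q := by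
    rw [card_biUnion (fun i _ i' _ h => hd i i' h), sum_congr rfl (fun i _ => card_pair (hu i).2.2),
      sum_const, card_univ, Fintype.card_fin, smul_eq_mul, mul_comm]
  have hUV : (univ.biUnion fun i => ({ua i, ub i} : Finset ℕ)) ⊆ G'.verts := by
    refine biUnion_subset.2 fun i _ v hv => ?_
    simp only [mem_insert, mem_singleton] at hv
    rcases hv with rfl | rfl
    · exact (hu i).1
    · exact (hu i).2.1
  set U := univ.biUnion fun i => ({ua i, ub i} : Finset ℕ) with hU
  have hWc : (G'.verts \ U).card = q * s := by
    have := card_sdiff_add_card_eq_card hUV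
    rw [hUc, hV] at this
    have e : (s + 2) * q = q * s + 2 * q := by ring
    omega
  have h32 : 32 ≤ e' * ((s : ℝ) + 2) := by
    have g1 : 32 / e' ≤ (⌈32 / e'⌉₊ : ℝ) := Nat.le_ceil _
    have g2 : (⌈32 / e'⌉₊ : ℝ) ≤ s := by exact_mod_cast (by omega : ⌈32 / e'⌉₊ ≤ s)
    have g3 : 32 / e' ≤ (s : ℝ) + 2 := by linarith
    rw [div_le_iff₀ he0] at g3
    linarith
  have hWd := W_deg hjk hδ he0 hV hUc h32 (by
    intro T hT hTc
    refine le_trans ?_ (hdeg T hT hTc)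
    gcongr)
  have hWne : (G'.verts \ U).Nonempty := by
    rw [← card_pos, hWc]; exact Nat.mul_pos f4 f2
  obtain ⟨P, p1, p2, p3, p4⟩ := core hk hjk (β := δ + e' / 8) (B' := δ + e' / 16) (n0 := n0)
    (by positivity) hs f2 f4 (by omega) f5 f6 f7 (has s (by omega)) hHC hV hu hd rfl hWc
    (hsamp s (by omega) G' (G'.verts \ U) hWne sdiff_subset hWd) hB hΔ
  exact ⟨fun _ => t, P, fun i => ⟨f3, Nat.le_mul_of_pos_left t two_pos⟩, p1, p2, p3, p4⟩

end
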